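/- Let k be an algebraically closed field of characteristic 0, let m be an odd positive integer, let q ∈ k be a primitive m-th root of unity, and let 1 ≤ r ≤ n−1. Then deg M^{r+1}_q(n) = m^{nr − r(r+1)/2}; equivalently, the supremum of dim_k V over all finite-dimensional irreducible M^{r+1}_q(n)-modules V equals m^{nr − r(r+1)/2}. -/

import Mathlib

open scoped BigOperators

/-- `p` is a polynomial identity of the ring `A`. -/
def IsPolyIdentity (A : Type) [Ring A] (p : FreeAlgebra ℤ ℕ) : Prop :=
  ∀ f : ℕ → A, FreeAlgebra.lift ℤ f p = 0

/-- `A` has degree at most `d`: it satisfies all polynomial identities of `d × d`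
matrices over commutative rings. -/
def DegLE (A : Type) [Ring A] (d : ℕ) : Prop :=
  ∀ p : FreeAlgebra ℤ ℕ,
    (∀ (R : Type) [CommRing R], IsPolyIdentity (Matrix (Fin d) (Fin d) R) p) →
    IsPolyIdentity A p

/-- `deg A = d`. -/
def HasDeg (A : Type) [Ring A] (d : ℕ) : Prop :=
  DegLE A d ∧ ∀ e : ℕ, DegLE A e → d ≤ e

/-- `A` satisfies a (nonzero) multilinear identity of degree `b`. -/
def SatisfiesMultilinearIdentity (A : Type) [Ring A] (b : ℕ) : Prop :=
  ∃ c : Equiv.Perm (Fin b) → ℤ, c ≠ 0 ∧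
    ∀ f : Fin b → A,
      ∑ σ : Equiv.Perm (Fin b), c σ • (List.ofFn fun i => f (σ i)).prod = 0

/-- The P.I. degree of `A`: half the smallest degree of a multilinear identity of `A`. -/
noncomputable def piDeg (A : Type) [Ring A] : ℕ :=
  sInf {b : ℕ | 0 < b ∧ SatisfiesMultilinearIdentity A b} / 2

/-- `A` is a P.I. algebra. -/
def IsPIAlgebra (A : Type) [Ring A] : Prop :=
  ∃ b : ℕ, 0 < b ∧ SatisfiesMultilinearIdentity A b

/-- `A` is a prime ring. -/
def IsPrimeRing' (A : Type) [Ring A] : Prop :=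
  ∀ a b : A, (∀ x : A, a * x * b = 0) → a = 0 ∨ b = 0

/-- A two-sided ideal is maximal. -/
def TwoSidedIdeal.IsMaximal' {A : Type} [Ring A] (I : TwoSidedIdeal A) : Prop :=
  I ≠ ⊤ ∧ ∀ J : TwoSidedIdeal A, I < J → J = ⊤

/-- Defining relations of the quantized matrix algebra `M_q(n,r)` (generators `Z (i,j)`). -/
inductive QMatRel (k : Type) [Field k] (q : k) (n r : ℕ) :
    FreeAlgebra k (Fin n × Fin r) → FreeAlgebra k (Fin n × Fin r) → Prop
  | row (i : Fin n) (j l : Fin r) (h : j < l) :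
      QMatRel k q n r (FreeAlgebra.ι k (i, j) * FreeAlgebra.ι k (i, l))
        (q • (FreeAlgebra.ι k (i, l) * FreeAlgebra.ι k (i, j)))
  | col (i s : Fin n) (j : Fin r) (h : i < s) :
      QMatRel k q n r (FreeAlgebra.ι k (i, j) * FreeAlgebra.ι k (s, j))
        (q • (FreeAlgebra.ι k (s, j) * FreeAlgebra.ι k (i, j)))
  | cross (i s : Fin n) (j l : Fin r) (h1 : i < s) (h2 : l < j) :
      QMatRel k q n r (FreeAlgebra.ι k (i, j) * FreeAlgebra.ι k (s, l))
        (FreeAlgebra.ι k (s, l) * FreeAlgebra.ι k (i, j))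
  | diag (i s : Fin n) (j l : Fin r) (h1 : i < s) (h2 : j < l) :
      QMatRel k q n r (FreeAlgebra.ι k (i, j) * FreeAlgebra.ι k (s, l))
        (FreeAlgebra.ι k (s, l) * FreeAlgebra.ι k (i, j) +
          (q - q⁻¹) • (FreeAlgebra.ι k (i, l) * FreeAlgebra.ι k (s, j)))

/-- The quantized matrix algebra `M_q(n,r)`. -/
abbrev QMat (k : Type) [Field k] (q : k) (n r : ℕ) : Type := RingQuot (QMatRel k q n r)

/-- The generator `Z_{i,j}` of `M_q(n,r)`. -/
noncomputable def Zgen (k : Type) [Field k] (q : k) (n r : ℕ) (i : Fin n) (j : Fin r) :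
    QMat k q n r :=
  RingQuot.mkAlgHom k (QMatRel k q n r) (FreeAlgebra.ι k (i, j))

/-- Number of inversions (the length) of a permutation. -/
def invCount {t : ℕ} (σ : Equiv.Perm (Fin t)) : ℕ :=
  (Finset.univ.filter (fun p : Fin t × Fin t => p.1 < p.2 ∧ σ p.2 < σ p.1)).card

/-- The `t × t` quantum minor on rows `row 0 < ... < row (t-1)` and columns
`col 0 < ... < col (t-1)`. -/
noncomputable def qMinor (k : Type) [Field k] (q : k) (n r : ℕ) (t : ℕ)
    (row : Fin t → Fin n) (col : Fin t → Fin r) : QMat k q n r :=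
  ∑ σ : Equiv.Perm (Fin t),
    ((-q) ^ invCount σ) • (List.ofFn fun a => Zgen k q n r (row a) (col (σ a))).prod

/-- The set of all `t × t` quantum minors of `M_q(n)` (rows `ro 0 < ... < ro (t-1)`,
columns `co 0 < ... < co (t-1)`). -/
def minorSet (k : Type) [Field k] (q : k) (n t : ℕ) : Set (QMat k q n n) :=
  {x | ∃ ro co : Fin t → Fin n, StrictMono ro ∧ StrictMono co ∧ x = qMinor k q n n t ro co}

/-- The relation identifying every `t × t` quantum minor of `M_q(n)` with `0`; the
corresponding `RingQuot` is the quotient of `M_q(n)` by the two-sided ideal `I^t_q`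
generated by all `t × t` quantum minors. -/
def minorRel (k : Type) [Field k] (q : k) (n t : ℕ) :
    QMat k q n n → QMat k q n n → Prop :=
  fun a b => a ∈ minorSet k q n t ∧ b = 0

/-- The quantized function algebra `M^{r+1}_q(n) = M_q(n) / I^{r+1}_q` of rank `r`
matrices. -/
abbrev QMatRank (k : Type) [Field k] (q : k) (n r : ℕ) : Type :=
  RingQuot (minorRel k q n (r + 1))

/-- The quotient map `π : M_q(n) → M^{r+1}_q(n)`. -/
noncomputable def rankProj (k : Type) [Field k] (q : k) (n r : ℕ) :
    QMat k q n n →ₐ[k] QMatRank k q n r :=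
  RingQuot.mkAlgHom k (minorRel k q n (r + 1))

/-- The quantum minor `d = d_r`: the `r × r` quantum minor of `M_q(n)` on rows and
columns `1, ..., r`. -/
noncomputable def dMinor (k : Type) [Field k] (q : k) (n r : ℕ) (h : r ≤ n) :
    QMat k q n n :=
  qMinor k q n n r (fun a => Fin.castLE h a) (fun a => Fin.castLE h a)

/-- `q` is either generic (not a root of unity) or a primitive `m`-th root of unity for
some `m ≥ 1`. -/
def GenericOrRootOfUnity (k : Type) [Field k] (q : k) : Prop :=
  (∀ m : ℕ, 0 < m → q ^ m ≠ 1) ∨ ∃ m : ℕ, 0 < m ∧ IsPrimitiveRoot q m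

/-! ### Capelli polynomials and degrees of endomorphism algebras -/

/-- The Capelli polynomial in `s` alternating variables `ι (3 * k)`. -/
noncomputable def capelliPoly (s : ℕ) : FreeAlgebra ℤ ℕ :=
  ∑ σ : Equiv.Perm (Fin s), (Equiv.Perm.sign σ : ℤ) •
    (List.ofFn fun k : Fin s => FreeAlgebra.ι ℤ (3 * (k : ℕ) + 1) *
      FreeAlgebra.ι ℤ (3 * (σ k : ℕ)) * FreeAlgebra.ι ℤ (3 * (k : ℕ) + 2)).prod

theorem lift_capelliPoly {A : Type} [Ring A] (s : ℕ) (f : ℕ → A) :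
    FreeAlgebra.lift ℤ f (capelliPoly s) =
      ∑ σ : Equiv.Perm (Fin s), (Equiv.Perm.sign σ : ℤ) •
        (List.ofFn fun k : Fin s => f (3 * (k : ℕ) + 1) * f (3 * (σ k : ℕ)) *
          f (3 * (k : ℕ) + 2)).prod := by
  simp only [capelliPoly, map_sum, map_zsmul, map_list_prod, List.map_ofFn]
  refine Finset.sum_congr rfl fun σ _ => ?_
  congr 3
  funext k
  simp

theorem capelliPoly_identity (e s : ℕ) (hs : e * e < s) (R : Type) [CommRing R] :
    IsPolyIdentity (Matrix (Fin e) (Fin e) R) (capelliPoly s) := by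
  intro f
  rw [lift_capelliPoly]
  let M : MultilinearMap R (fun _ : Fin s => Matrix (Fin e) (Fin e) R)
      (Matrix (Fin e) (Fin e) R) :=
    (MultilinearMap.mkPiAlgebraFin R s (Matrix (Fin e) (Fin e) R)).compLinearMap
      (fun k => (LinearMap.mulRight R (f (3 * (k : ℕ) + 2))).comp
        (LinearMap.mulLeft R (f (3 * (k : ℕ) + 1))))
  have h0 : MultilinearMap.alternatization M = 0 := by
    refine Module.Basis.ext_alternating (Matrix.stdBasis R (Fin e) (Fin e)) fun v hv => ?_
    exfalso
    have := Fintype.card_le_of_injective v hv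
    simp at this
    omega
  have h1 := congrArg (fun g => g (fun k : Fin s => f (3 * (k : ℕ)))) h0
  simp only [MultilinearMap.alternatization_apply, AlternatingMap.zero_apply] at h1
  rw [← h1]
  refine Finset.sum_congr rfl fun σ _ => ?_
  simp [M, Units.smul_def]

theorem capelliPoly_not_identity (d s : ℕ) (hs : 0 < s) (hsd : s ≤ d * d) (k : Type) [Field k] :
    ¬ IsPolyIdentity (Matrix (Fin d) (Fin d) k) (capelliPoly s) := by
  intro H
  have hd : 0 < d := Nat.pos_of_ne_zero (by rintro rfl; omega)
  obtain ⟨v⟩ : Nonempty (Fin s ↪ Fin d × Fin d) :=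
    Function.Embedding.nonempty_of_card_le (by simpa using hsd)
  let o : Fin d := ⟨0, hd⟩
  let pick : ℕ → Fin d × Fin d := fun n => if h : n < s then v ⟨n, h⟩ else (o, o)
  have hpick : ∀ i : Fin s, pick i = v i := fun i => by simp [pick]
  let f : ℕ → Matrix (Fin d) (Fin d) k := fun n =>
    if n % 3 = 0 then Matrix.single (pick (n / 3)).1 (pick (n / 3)).2 1
    else if n % 3 = 1 then Matrix.single o (pick (n / 3)).1 1
    else Matrix.single (pick (n / 3)).2 o 1
  have f0 : ∀ i : Fin s, f (3 * (i : ℕ)) = Matrix.single (v i).1 (v i).2 1 := fun i => by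
    have h1 : (3 * (i : ℕ)) % 3 = 0 := by omega
    have h2 : (3 * (i : ℕ)) / 3 = i := by omega
    simp only [f, h1, h2, hpick, if_true]
  have f1 : ∀ i : Fin s, f (3 * (i : ℕ) + 1) = Matrix.single o (v i).1 1 := fun i => by
    have h1 : (3 * (i : ℕ) + 1) % 3 = 1 := by omega
    have h2 : (3 * (i : ℕ) + 1) / 3 = i := by omega
    simp only [f, h1, h2, hpick]
    simp
  have f2 : ∀ i : Fin s, f (3 * (i : ℕ) + 2) = Matrix.single (v i).2 o 1 := fun i => by
    have h1 : (3 * (i : ℕ) + 2) % 3 = 2 := by omega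
    have h2 : (3 * (i : ℕ) + 2) / 3 = i := by omega
    simp only [f, h1, h2, hpick]
    simp
  have h := H f
  rw [lift_capelliPoly, Finset.sum_eq_single 1] at h
  · have hc : (List.ofFn fun k_1 : Fin s => f (3 * (k_1 : ℕ) + 1) *
        f (3 * (((1 : Equiv.Perm (Fin s)) k_1 : Fin s) : ℕ)) * f (3 * (k_1 : ℕ) + 2)) =
        List.replicate s (Matrix.single o o (1 : k)) := by
      rw [← List.ofFn_const]
      congr 1
      funext i
      simp [f0, f1, f2]
    rw [hc, List.prod_replicate] at h
    have hi : IsIdempotentElem (Matrix.single o o (1 : k)) := by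
      simp [IsIdempotentElem]
    rw [hi.pow_eq hs.ne'] at h
    have := congrFun (congrFun h o) o
    simp at this
  · intro σ _ hσ
    obtain ⟨i, hi⟩ : ∃ i, σ i ≠ i := by
      by_contra! hc
      exact hσ (Equiv.ext hc)
    rw [List.prod_eq_zero, smul_zero]
    rw [List.mem_ofFn]
    refine ⟨i, ?_⟩
    rw [f0, f1, f2]
    have hne : v (σ i) ≠ v i := fun h => hi (v.injective h)
    by_cases ha : (v i).1 = (v (σ i)).1
    · have hb : (v (σ i)).2 ≠ (v i).2 := fun hb => hne (Prod.ext ha.symm hb)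
      rw [ha, Matrix.single_mul_single_same, Matrix.single_mul_single_of_ne _ _ _ _ hb]
    · rw [Matrix.single_mul_single_of_ne _ _ _ _ ha, zero_mul]
  · simp

theorem IsPolyIdentity.of_surjective {A B : Type} [Ring A] [Ring B] (g : A →+* B)
    (hg : Function.Surjective g) {p : FreeAlgebra ℤ ℕ} (h : IsPolyIdentity A p) :
    IsPolyIdentity B p := by
  intro f
  choose f' hf' using fun n => hg (f n)
  have h1 : (FreeAlgebra.lift ℤ f) = (g.toIntAlgHom).comp (FreeAlgebra.lift ℤ f') := by
    ext n
    simp [hf']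
  rw [h1]
  simp [h f']

theorem IsPolyIdentity.of_injective {A B : Type} [Ring A] [Ring B] (g : A →+* B)
    (hg : Function.Injective g) {p : FreeAlgebra ℤ ℕ} (h : IsPolyIdentity B p) :
    IsPolyIdentity A p := by
  intro f
  have h1 : (FreeAlgebra.lift ℤ (g ∘ f)) = (g.toIntAlgHom).comp (FreeAlgebra.lift ℤ f) := by
    ext n
    simp
  apply hg
  have := h (g ∘ f)
  rw [h1] at this
  simpa using this

/-- An algebra acting faithfully on a free module of rank `d` over a commutative ring has
degree at most `d`. -/
theorem degLE_of_injective {A K V ι : Type} [Ring A] [CommRing K] [AddCommGroup V] [Module K V]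
    [Fintype ι] [DecidableEq ι] (b : Module.Basis ι K V) (g : A →+* Module.End K V)
    (hg : Function.Injective g) : DegLE A (Fintype.card ι) := by
  intro p hp
  let b' := b.reindex (Fintype.equivFin ι)
  exact IsPolyIdentity.of_injective g hg
    (IsPolyIdentity.of_injective (LinearMap.toMatrixAlgEquiv b').toRingEquiv.toRingHom
      (LinearMap.toMatrixAlgEquiv b').injective (hp K))

theorem finrank_le_of_degLE {A k V : Type} [Ring A] [Field k] [AddCommGroup V] [Module k V]
    [Module.Finite k V] (g : A →+* Module.End k V) (hg : Function.Surjective g) {e : ℕ}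
    (h : DegLE A e) : Module.finrank k V ≤ e := by
  by_contra! hlt
  have h1 := h (capelliPoly (e * e + 1)) fun R _ => capelliPoly_identity e _ (by omega) R
  have h2 := IsPolyIdentity.of_surjective
    (LinearMap.toMatrixAlgEquiv (Module.finBasis k V)).toRingEquiv.toRingHom
    (LinearMap.toMatrixAlgEquiv (Module.finBasis k V)).surjective
    (IsPolyIdentity.of_surjective g hg h1)
  exact capelliPoly_not_identity _ _ (by omega) (by nlinarith) k h2

/-- Burnside's theorem: a finite-dimensional simple module over an algebraically closed field
has surjective structure map. -/
theorem surjective_toEnd_of_isSimpleModule (k : Type) [Field k] [IsAlgClosed k] {A V : Type}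
    [Ring A] [Algebra k A] [AddCommGroup V] [Module k V] [Module A V] [IsScalarTower k A V]
    [IsSimpleModule A V] [Module.Finite k V] :
    Function.Surjective (Algebra.lsmul k k V : A →ₐ[k] Module.End k V) := by
  have hfin : Module.Finite (Module.End A V) V := Module.Finite.of_restrictScalars_finite k _ _
  intro f
  have hb := (IsSimpleModule.algebraMap_end_bijective_of_isAlgClosed (A := A) (V := V) k).2
  let f' : Module.End (Module.End A V) V :=
    { toFun := f
      map_add' := f.map_add
      map_smul' := fun c x => by
        obtain ⟨c, rfl⟩ := hb c
        simp }
  obtain ⟨a, ha⟩ := Module.Finite.toModuleEnd_moduleEnd_surjective (R := A) (M := V) f'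
  refine ⟨a, LinearMap.ext fun v => ?_⟩
  have h : a • v = f v := by simpa using! congrArg (fun g => g v) ha
  simpa using h

theorem finrank_le_of_isSimpleModule (k : Type) [Field k] [IsAlgClosed k] {A V : Type}
    [Ring A] [Algebra k A] [AddCommGroup V] [Module k V] [Module A V] [IsScalarTower k A V]
    [IsSimpleModule A V] [Module.Finite k V] {e : ℕ} (h : DegLE A e) :
    Module.finrank k V ≤ e :=
  finrank_le_of_degLE (Algebra.lsmul k k V : A →ₐ[k] Module.End k V).toRingHom
    (surjective_toEnd_of_isSimpleModule k) h

/-! ### Quantum matrices with entries in an algebra -/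

section QuantumMatrices

variable {k R : Type} [Field k] [Ring R] [Algebra k R]

/-- The array `X` satisfies the relations of the quantized matrix algebra. -/
structure IsQuantumMatrix (q : k) (X : ℕ → ℕ → R) : Prop where
  row : ∀ i j l, j < l → X i j * X i l = q • (X i l * X i j)
  col : ∀ i s j, i < s → X i j * X s j = q • (X s j * X i j)
  cross : ∀ i s j l, i < s → l < j → X i j * X s l = X s l * X i j
  diag : ∀ i s j l, i < s → j < l →
    X i j * X s l = X s l * X i j + (q - q⁻¹) • (X i l * X s j)

theorem IsQuantumMatrix.transpose {q : k} {X : ℕ → ℕ → R} (h : IsQuantumMatrix q X) :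
    IsQuantumMatrix q (fun i j => X j i) where
  row i j l hjl := h.col j l i hjl
  col i s j his := h.row j i s his
  cross i s j l his hlj := (h.cross l j s i hlj his).symm
  diag i s j l his hjl := by
    rw [h.diag j l i s hjl his, h.cross j l s i hjl his]

theorem sum_range_sum_range_congr {M : Type*} [AddCommGroup M] (r : ℕ) (f g : ℕ → ℕ → M)
    (hd : ∀ a, f a a = g a a) (ho : ∀ a b, a < b → f a b + f b a = g a b + g b a) :
    ∑ a ∈ Finset.range r, ∑ b ∈ Finset.range r, f a b =
      ∑ a ∈ Finset.range r, ∑ b ∈ Finset.range r, g a b := by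
  induction r with
  | zero => simp
  | succ r ih =>
    have key : ∀ f : ℕ → ℕ → M, ∑ a ∈ Finset.range (r + 1), ∑ b ∈ Finset.range (r + 1), f a b =
        ∑ a ∈ Finset.range r, ∑ b ∈ Finset.range r, f a b +
          ∑ a ∈ Finset.range r, (f a r + f r a) + f r r := fun f => by
      rw [Finset.sum_range_succ]
      simp only [Finset.sum_range_succ _ r, Finset.sum_add_distrib]
      abel
    rw [key f, key g, ih, hd]
    congr 2
    exact Finset.sum_congr rfl fun a ha => ho a r (Finset.mem_range.mp ha)

theorem IsQuantumMatrix.mul {q : k} (hq : q ≠ 0) {X Y : ℕ → ℕ → R} (hX : IsQuantumMatrix q X)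
    (hY : IsQuantumMatrix q Y) (hc : ∀ i a b j, X i a * Y b j = Y b j * X i a) (r : ℕ) :
    IsQuantumMatrix q (fun i j => ∑ a ∈ Finset.range r, X i a * Y a j) := by
  have hmul : ∀ i j s l, (∑ a ∈ Finset.range r, X i a * Y a j) *
      (∑ a ∈ Finset.range r, X s a * Y a l) =
      ∑ a ∈ Finset.range r, ∑ b ∈ Finset.range r, (X i a * X s b) * (Y a j * Y b l) := by
    intro i j s l
    rw [Finset.sum_mul_sum]
    refine Finset.sum_congr rfl fun a _ => Finset.sum_congr rfl fun b _ => ?_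
    rw [mul_assoc, ← mul_assoc (Y a j), ← hc, mul_assoc, mul_assoc]
  constructor
  · intro i j l hjl
    simp only [hmul, Finset.smul_sum]
    refine sum_range_sum_range_congr r _ _ (fun a => ?_) (fun a b hab => ?_)
    · rw [hY.row a j l hjl, mul_smul_comm]
    · rw [hX.row i a b hab, hY.diag a b j l hab hjl, hY.cross a b l j hab hjl]
      simp only [smul_mul_assoc, mul_smul_comm, mul_add]
      match_scalars <;> field_simp <;> ring
  · intro i s j his
    simp only [hmul, Finset.smul_sum]
    refine sum_range_sum_range_congr r _ _ (fun a => ?_) (fun a b hab => ?_)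
    · rw [hX.col i s a his, smul_mul_assoc]
    · rw [hY.col a b j hab, hX.diag i s a b his hab, hX.cross i s b a his hab]
      simp only [smul_mul_assoc, mul_smul_comm, add_mul]
      match_scalars <;> field_simp <;> ring
  · intro i s j l his hlj
    simp only [hmul]
    refine sum_range_sum_range_congr r _ _ (fun a => ?_) (fun a b hab => ?_)
    · rw [hX.col i s a his, hY.row a l j hlj, smul_mul_assoc, mul_smul_comm]
    · rw [hX.diag i s a b his hab, hX.cross i s b a his hab, hY.diag a b l j hab hlj,
        hY.cross a b j l hab hlj]
      simp only [smul_mul_assoc, mul_smul_comm, add_mul, mul_add]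
      module
  · intro i s j l his hjl
    simp only [hmul, Finset.smul_sum, ← Finset.sum_add_distrib]
    refine sum_range_sum_range_congr r _ _ (fun a => ?_) (fun a b hab => ?_)
    · rw [hX.col i s a his, hY.row a j l hjl]
      simp only [smul_mul_assoc, mul_smul_comm]
      match_scalars; field_simp; ring
    · rw [hX.diag i s a b his hab, hX.cross i s b a his hab, hY.diag a b j l hab hjl,
        hY.cross a b l j hab hjl]
      simp only [smul_mul_assoc, mul_smul_comm, add_mul, mul_add]
      match_scalars <;> ring

theorem mul_left_of_smul_comm {A B : R} {c : k} (h : A * B = c • (B * A)) (z : R) :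
    A * (B * z) = c • (B * (A * z)) := by
  rw [← mul_assoc, h, smul_mul_assoc, mul_assoc]

/-- Hypotheses under which a new column `x` can be glued to the array `y`. -/
structure IsColumnData (q : k) (x : ℕ → R) (y : ℕ → ℕ → R) : Prop where
  xx : ∀ i s, i < s → x i * x s = q • (x s * x i)
  xy_le : ∀ s j a, j ≤ s → y j a * x s = q⁻¹ • (x s * y j a)
  xy_lt : ∀ s j a, s < j → y j a * x s = q • (x s * y j a)
  yy_row : ∀ j a c, a < c → y j a * y j c = q • (y j c * y j a)
  yy_col : ∀ j l a, j < l → y j a * y l a = q ^ 2 • (y l a * y j a)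
  yy_cross : ∀ j l a c, j < l → c < a → y j a * y l c = q • (y l c * y j a)
  yy_diag : ∀ j l a c, j < l → a < c →
    y j a * y l c = q • (y l c * y j a) + (q ^ 2 - 1) • (y l a * y j c)

theorem IsColumnData.isQuantumMatrix {q : k} (hq : q ≠ 0) {x : ℕ → R} {y : ℕ → ℕ → R}
    (h : IsColumnData q x y) (b : ℕ) (hb : ∀ j a, a < b → y j a = 0) :
    IsQuantumMatrix q
      (fun i a => if a = b then x i else x i * ∑ j ∈ Finset.range (i + 1), y j a) := by
  set P : ℕ → ℕ → R := fun i a => ∑ j ∈ Finset.range (i + 1), y j a with hP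
  set D : ℕ → ℕ → ℕ → R := fun i s a => ∑ j ∈ Finset.Ico (i + 1) (s + 1), y j a with hD
  have hPD : ∀ i s a, i < s → P s a = P i a + D i s a := fun i s a his => by
    simp only [hP, hD]
    rw [Finset.sum_range_add_sum_Ico _ (by omega)]
  have hP0 : ∀ i a, a < b → P i a = 0 := fun i a ha =>
    Finset.sum_eq_zero fun j _ => hb j a ha
  have Px : ∀ i s a, i ≤ s → P i a * x s = q⁻¹ • (x s * P i a) := fun i s a his => by
    simp only [hP, Finset.sum_mul, Finset.mul_sum, Finset.smul_sum]
    refine Finset.sum_congr rfl fun j hj => h.xy_le s j a ?_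
    have := Finset.mem_range.mp hj; omega
  have Dx : ∀ i s a, D i s a * x i = q • (x i * D i s a) := fun i s a => by
    simp only [hD, Finset.sum_mul, Finset.mul_sum, Finset.smul_sum]
    refine Finset.sum_congr rfl fun j hj => h.xy_lt i j a ?_
    have := Finset.mem_Ico.mp hj; omega
  have PDcol : ∀ i s a, P i a * D i s a = q ^ 2 • (D i s a * P i a) := fun i s a => by
    simp only [hD, hP, Finset.sum_mul, Finset.mul_sum, Finset.smul_sum]
    rw [Finset.sum_comm]
    refine Finset.sum_congr rfl fun j hj => Finset.sum_congr rfl fun l hl => h.yy_col j l a ?_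
    have := Finset.mem_Ico.mp hl; have := Finset.mem_range.mp hj; omega
  have PDcross : ∀ i s a c, c < a → P i a * D i s c = q • (D i s c * P i a) :=
      fun i s a c hca => by
    simp only [hD, hP, Finset.sum_mul, Finset.mul_sum, Finset.smul_sum]
    rw [Finset.sum_comm]
    refine Finset.sum_congr rfl fun j hj => Finset.sum_congr rfl fun l hl =>
      h.yy_cross j l a c ?_ hca
    have := Finset.mem_Ico.mp hl; have := Finset.mem_range.mp hj; omega
  have PDdiag : ∀ i s a c, a < c →
      P i a * D i s c = q • (D i s c * P i a) + (q ^ 2 - 1) • (D i s a * P i c) :=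
      fun i s a c hac => by
    simp only [hD, hP, Finset.sum_mul, Finset.mul_sum, Finset.smul_sum]
    rw [Finset.sum_comm, ← Finset.sum_add_distrib]
    refine Finset.sum_congr rfl fun j hj => ?_
    rw [← Finset.sum_add_distrib]
    refine Finset.sum_congr rfl fun l hl => h.yy_diag j l a c ?_ hac
    have := Finset.mem_Ico.mp hl; have := Finset.mem_range.mp hj; omega
  have Prow : ∀ i a c, a < c → P i a * P i c = q • (P i c * P i a) := by
    intro i a c hac
    induction i with
    | zero => simpa [hP] using h.yy_row 0 a c hac
    | succ i ih =>
      have hDy : ∀ a, D i (i + 1) a = y (i + 1) a := fun a => by simp [hD]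
      rw [hPD i (i + 1) a (by omega), hPD i (i + 1) c (by omega)]
      simp only [add_mul, mul_add]
      rw [ih, PDdiag i _ a c hac, PDcross i _ c a hac, hDy, hDy, h.yy_row _ _ _ hac]
      match_scalars <;> ring
  have key : ∀ i s a c, i < s → a ≠ b → c ≠ b →
      (x i * P i a) * (x s * P s c) = x s * (x i * (P i a * P s c)) := by
    intro i s a c his _ _
    rw [mul_assoc, ← mul_assoc (P i a), Px i s a his.le, smul_mul_assoc, mul_smul_comm,
      ← mul_assoc, ← mul_assoc, h.xx i s his]
    simp only [smul_mul_assoc, smul_smul, inv_mul_cancel₀ hq, one_smul, mul_assoc]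
  have key2 : ∀ i s a c, i < s → a ≠ b → c ≠ b →
      (x s * P s c) * (x i * P i a) = x s * (x i * (q⁻¹ • (P i c * P i a) +
        q • (D i s c * P i a))) := by
    intro i s a c his _ _
    rw [mul_assoc, hPD i s c his, ← mul_assoc (P i c + D i s c), add_mul, Px i i c le_rfl, Dx]
    simp only [mul_add, add_mul, smul_mul_assoc, mul_smul_comm, mul_assoc]
  constructor
  · intro i j l hjl
    by_cases hj : j = b
    · have hl : l ≠ b := by omega
      simp only [hj, hl, if_true, if_false]
      rw [mul_assoc (x i) _ (x i), Px i i l le_rfl, mul_smul_comm, smul_smul, mul_inv_cancel₀ hq,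
        one_smul]
    · simp only [hj, if_false]
      by_cases hl : l = b
      · simp only [hl, if_true]
        change (x i * P i j) * x i = q • (x i * (x i * P i j))
        rw [hP0 i j (by omega)]
        simp
      · simp only [hl, if_false]
        change (x i * P i j) * (x i * P i l) = q • ((x i * P i l) * (x i * P i j))
        rw [mul_assoc, ← mul_assoc (P i j), Px i i j le_rfl, mul_assoc (x i) (P i l),
          ← mul_assoc (P i l), Px i i l le_rfl]
        simp only [smul_mul_assoc, mul_smul_comm, mul_assoc]
        rw [Prow i j l hjl]
        simp only [mul_smul_comm]
        module
  · intro i s j his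
    by_cases hj : j = b
    · simp only [hj, if_true]
      exact h.xx i s his
    · simp only [hj, if_false]
      change (x i * P i j) * (x s * P s j) = q • ((x s * P s j) * (x i * P i j))
      rw [key i s j j his hj hj, key2 i s j j his hj hj, hPD i s j his, mul_add, PDcol]
      simp only [mul_add, mul_smul_comm]
      match_scalars <;> field_simp
  · intro i s j l his hlj
    by_cases hj : j = b
    · have hl : l ≠ b := by omega
      simp only [hj, hl, if_true, if_false]
      change x i * (x s * P s l) = (x s * P s l) * x i
      rw [hP0 s l (by omega)]
      simp
    · simp only [hj, if_false]
      by_cases hl : l = b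
      · simp only [hl, if_true]
        change (x i * P i j) * x s = x s * (x i * P i j)
        rw [mul_assoc, Px i s j his.le, mul_smul_comm, ← mul_assoc, h.xx i s his, smul_mul_assoc,
          smul_smul, inv_mul_cancel₀ hq, one_smul, mul_assoc]
      · simp only [hl, if_false]
        change (x i * P i j) * (x s * P s l) = (x s * P s l) * (x i * P i j)
        rw [key i s j l his hj hl, key2 i s j l his hj hl, hPD i s l his, mul_add,
          PDcross i s j l hlj, Prow i l j hlj]
        simp only [mul_add, mul_smul_comm]
        match_scalars <;> field_simp
  · intro i s j l his hjl
    by_cases hj : j = b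
    · have hl : l ≠ b := by omega
      simp only [hj, hl, if_true, if_false]
      change x i * (x s * P s l) = (x s * P s l) * x i + (q - q⁻¹) • ((x i * P i l) * x s)
      rw [mul_assoc (x i), Px i s l his.le, mul_assoc (x s), hPD i s l his, add_mul,
        Px i i l le_rfl, Dx]
      simp only [mul_add, mul_smul_comm]
      rw [mul_left_of_smul_comm (h.xx i s his), mul_left_of_smul_comm (h.xx i s his)]
      match_scalars <;> field_simp <;> ring
    · simp only [hj, if_false]
      by_cases hl : l = b
      · simp only [hl, if_true]
        change (x i * P i j) * x s = x s * (x i * P i j) + (q - q⁻¹) • (x i * (x s * P s j))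
        rw [hP0 i j (by omega), hP0 s j (by omega)]
        simp
      · simp only [hl, if_false]
        change (x i * P i j) * (x s * P s l) = (x s * P s l) * (x i * P i j) +
          (q - q⁻¹) • ((x i * P i l) * (x s * P s j))
        rw [key i s j l his hj hl, key2 i s j l his hj hl, key i s l j his hl hj,
          hPD i s l his, hPD i s j his, mul_add, mul_add (P i l), PDdiag i s j l hjl,
          PDcross i s l j hjl, Prow i j l hjl]
        simp only [mul_add, mul_smul_comm]
        match_scalars <;> field_simp <;> ring

end QuantumMatrices

section TorusData

variable {k R : Type} [Field k] [Ring R] [Algebra k R]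

/-- The commutation exponent of the torus generators at positions `(i, a)` and `(s, b)`. -/
def torusExp (i a s b : ℕ) : ℤ :=
  if i = s then (if a < b then 1 else if b < a then -1 else 0)
  else if a = b then (if i < s then 1 else -1) else 0

/-- Quantum torus generators `t` with inverses `ti`, placed in the region `a ≤ i`. -/
structure IsTorusData (q : k) (n r : ℕ) (t ti : ℕ → ℕ → R) : Prop where
  tt : ∀ i a s b, t i a * t s b = q ^ torusExp i a s b • (t s b * t i a)
  tit : ∀ i a s b, ti i a * t s b = q ^ (-torusExp i a s b) • (t s b * ti i a)
  tti : ∀ i a s b, t i a * ti s b = q ^ (-torusExp i a s b) • (ti s b * t i a)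
  titi : ∀ i a s b, ti i a * ti s b = q ^ torusExp i a s b • (ti s b * ti i a)
  ti_zero : ∀ i a, ¬(a ≤ i ∧ i < n ∧ a < r) → ti i a = 0
  inv : ∀ i a, a ≤ i → i < n → a < r → t i a * ti i a = 1

/-- The triangular array built column by column, starting at column `b`, with `c` columns. -/
def triArray (t ti : ℕ → ℕ → R) : ℕ → ℕ → ℕ → ℕ → R
  | _, 0 => fun _ _ => 0
  | b, c + 1 => fun i a => if a = b then t i b else
      t i b * ∑ j ∈ Finset.range (i + 1), ti j b * triArray t ti (b + 1) c j a

variable {q : k} {n r : ℕ} {t ti : ℕ → ℕ → R}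

theorem triArray_of_lt (b c i a : ℕ) (h : a < b) : triArray t ti b c i a = 0 := by
  induction c generalizing b i with
  | zero => rfl
  | succ c ih =>
    simp only [triArray, h.ne, if_false]
    rw [Finset.sum_eq_zero, mul_zero]
    intro j _
    rw [ih _ _ (by omega), mul_zero]

theorem triArray_comm (hq : q ≠ 0) (h : IsTorusData q n r t ti) (b c s b' j a : ℕ) (hb : b' < b) :
    t s b' * triArray t ti b c j a =
      (if s = j then q else 1) • (triArray t ti b c j a * t s b') := by
  induction c generalizing b j with
  | zero => simp [triArray]
  | succ c ih =>
    have e1 : ∀ j, torusExp s b' j b = if s = j then 1 else 0 := fun j => by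
      simp only [torusExp, hb, hb.ne, if_true, if_false]
    have h1 : t s b' * t j b = (if s = j then q else 1) • (t j b * t s b') := by
      rw [h.tt, e1]; split_ifs <;> simp
    by_cases ha : a = b
    · simp only [triArray, ha, if_true]
      exact h1
    · simp only [triArray, ha, if_false]
      rw [← mul_assoc, h1, smul_mul_assoc, mul_assoc, mul_assoc (t j b)]
      congr 2
      simp only [Finset.sum_mul, Finset.mul_sum]
      refine Finset.sum_congr rfl fun j' _ => ?_
      rw [← mul_assoc, h.tti, e1, smul_mul_assoc, mul_assoc, ih (b + 1) j' (by omega)]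
      split_ifs <;> simp [smul_smul, mul_assoc, hq]

theorem triArray_comm_inv (hq : q ≠ 0) (h : IsTorusData q n r t ti) (b c s b' j a : ℕ)
    (hb : b' < b) :
    triArray t ti b c j a * ti s b' =
      (if s = j then q else 1) • (ti s b' * triArray t ti b c j a) := by
  by_cases hv : b' ≤ s ∧ s < n ∧ b' < r
  · have hi : ti s b' * t s b' = 1 := by
      have := h.tit s b' s b'
      simp only [torusExp, lt_irrefl, if_true, if_false, neg_zero, zpow_zero, one_smul] at this
      rw [this, h.inv s b' hv.1 hv.2.1 hv.2.2]
    have h2 := congrArg (fun z => ti s b' * z * ti s b') (triArray_comm hq h b c s b' j a hb)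
    simp only [mul_smul_comm, smul_mul_assoc] at h2
    rw [← mul_assoc, hi, one_mul, ← mul_assoc, mul_assoc _ (t s b'),
      h.inv s b' hv.1 hv.2.1 hv.2.2, mul_one] at h2
    exact h2
  · simp [h.ti_zero s b' hv]

theorem isQuantumMatrix_triArray (hq : q ≠ 0) (h : IsTorusData q n r t ti) (b c : ℕ) :
    IsQuantumMatrix q (triArray t ti b c) := by
  induction c generalizing b with
  | zero => constructor <;> intros <;> simp [triArray]
  | succ c ih =>
    have ih := ih (b + 1)
    have cX := fun s j a => triArray_comm hq h (b + 1) c s b j a (by omega)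
    have cXi := fun s j a => triArray_comm_inv hq h (b + 1) c s b j a (by omega)
    set X := triArray t ti (b + 1) c with hX
    have hcol : ∀ j l, torusExp j b l b = if j < l then 1 else if l < j then -1 else 0 := by
      intro j l
      simp only [torusExp]
      split_ifs <;> omega
    have cXt : ∀ s j a, X j a * t s b = (if s = j then q⁻¹ else 1) • (t s b * X j a) := by
      intro s j a
      rw [cX]
      split_ifs <;> simp [smul_smul, hq]
    have yy : ∀ j l a c, j < l → (ti j b * X j a) * (ti l b * X l c) =
        q • (ti l b * (ti j b * (X j a * X l c))) := by
      intro j l a c hjl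
      rw [mul_assoc, ← mul_assoc (X j a), cXi, if_neg hjl.ne', one_smul, mul_assoc (ti l b),
        ← mul_assoc, h.titi, hcol, if_pos hjl, zpow_one, smul_mul_assoc, mul_assoc]
    have yy' : ∀ j l a c, j < l → (ti l b * X l c) * (ti j b * X j a) =
        (ti l b * (ti j b * (X l c * X j a))) := by
      intro j l a c hjl
      rw [mul_assoc, ← mul_assoc (X l c), cXi, if_neg hjl.ne, one_smul, mul_assoc (ti j b)]
    have hcd : IsColumnData q (fun i => t i b) (fun j a => ti j b * X j a) := by
      constructor
      · intro i s his
        rw [h.tt, hcol, if_pos his, zpow_one]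
      · intro s j a hjs
        rw [mul_assoc, cXt, mul_smul_comm, ← mul_assoc, h.tit, hcol]
        rcases hjs.lt_or_eq with hjs | rfl
        · simp [hjs, hjs.ne', mul_assoc]
        · simp [mul_assoc]
      · intro s j a hsj
        rw [mul_assoc, cXt, mul_smul_comm, ← mul_assoc, h.tit, hcol]
        simp [hsj, hsj.ne, hsj.not_gt, mul_assoc]
      · intro j a c hac
        rw [mul_assoc, ← mul_assoc (X j a), cXi, mul_assoc (ti j b) (X j c), ← mul_assoc (X j c),
          cXi]
        simp only [if_true, smul_mul_assoc, mul_smul_comm, mul_assoc]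
        rw [ih.row j a c hac]
        simp only [mul_smul_comm]
      · intro j l a hjl
        rw [yy j l a a hjl, yy' j l a a hjl, ih.col j l a hjl]
        simp only [mul_smul_comm]
        module
      · intro j l a c hjl hca
        rw [yy j l a c hjl, yy' j l a c hjl, ih.cross j l a c hjl hca]
      · intro j l a c hjl hac
        rw [yy j l a c hjl, yy' j l a c hjl, yy' j l c a hjl, ih.diag j l a c hjl hac,
          ih.cross j l c a hjl hac]
        simp only [mul_smul_comm, mul_add]
        match_scalars <;> field_simp
    have := hcd.isQuantumMatrix hq b (fun j a hab => by
      rw [hX, triArray_of_lt _ _ _ _ (by omega), mul_zero])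
    exact this

end TorusData

/-! ### Weyl systems -/

section WeylSystem

variable {S : Type} [Fintype S] [DecidableEq S]

/-- The bilinear form over `ZMod m` with integer Gram matrix `Ω`. -/
noncomputable def gramForm (Ω : S → S → ℤ) (m : ℕ) : LinearMap.BilinForm (ZMod m) (S → ZMod m) :=
  Matrix.toBilin' (Matrix.of fun s t => (Ω s t : ZMod m))

theorem gramForm_apply (Ω : S → S → ℤ) (m : ℕ) (g h : S → ZMod m) :
    gramForm Ω m g h = ∑ s, ∑ t, g s * (Ω s t : ZMod m) * h t := by
  simp [gramForm, Matrix.toBilin'_apply]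

/-- Half of `gramForm`. -/
noncomputable def halfForm (Ω : S → S → ℤ) (m : ℕ) : LinearMap.BilinForm (ZMod m) (S → ZMod m) :=
  (2 : ZMod m)⁻¹ • gramForm Ω m

theorem two_mul_inv_two_zmod {m : ℕ} (hodd : Odd m) : (2 : ZMod m) * 2⁻¹ = 1 := by
  have h : Nat.Coprime 2 m := by simpa using hodd
  simpa using ZMod.coe_mul_inv_eq_one 2 h

theorem halfForm_add_self {m : ℕ} (hodd : Odd m) (Ω : S → S → ℤ) (g h : S → ZMod m) :
    halfForm Ω m g h + halfForm Ω m g h = gramForm Ω m g h := by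
  simp only [halfForm, LinearMap.smul_apply, smul_eq_mul]
  rw [← two_mul, ← mul_assoc, two_mul_inv_two_zmod hodd, one_mul]

theorem gramForm_swap {Ω : S → S → ℤ} (hΩ : ∀ s t, Ω t s = -Ω s t) {m : ℕ} (g h : S → ZMod m) :
    gramForm Ω m h g = -gramForm Ω m g h := by
  rw [gramForm_apply, gramForm_apply, Finset.sum_comm]
  simp only [← Finset.sum_neg_distrib]
  refine Finset.sum_congr rfl fun s _ => Finset.sum_congr rfl fun t _ => ?_
  rw [hΩ s t]
  push_cast
  ring

theorem halfForm_swap {Ω : S → S → ℤ} (hΩ : ∀ s t, Ω t s = -Ω s t) {m : ℕ} (g h : S → ZMod m) :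
    halfForm Ω m h g = -halfForm Ω m g h := by
  simp only [halfForm, LinearMap.smul_apply, smul_eq_mul]
  rw [gramForm_swap hΩ, mul_neg]

theorem eq_zero_of_add_self_zmod {m : ℕ} (hodd : Odd m) {x : ZMod m} (h : x + x = 0) : x = 0 := by
  have h2 := two_mul_inv_two_zmod hodd
  calc x = (2 * 2⁻¹) * x := by rw [h2, one_mul]
    _ = 2⁻¹ * (x + x) := by ring
    _ = 0 := by rw [h, mul_zero]

theorem halfForm_self {m : ℕ} (hodd : Odd m) {Ω : S → S → ℤ} (hΩ : ∀ s t, Ω t s = -Ω s t)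
    (g : S → ZMod m) : halfForm Ω m g g = 0 := by
  apply eq_zero_of_add_self_zmod hodd
  nth_rw 1 [halfForm_swap hΩ g g]
  rw [neg_add_cancel]

theorem halfForm_eq_zero {m : ℕ} {Ω : S → S → ℤ} {g h : S → ZMod m}
    (H : gramForm Ω m g h = 0) : halfForm Ω m g h = 0 := by
  simp [halfForm, H]

/-- Reduction of an integer vector modulo `m`. -/
def redMod (m : ℕ) : (S → ℤ) →+ (S → ZMod m) where
  toFun γ := fun s => (γ s : ZMod m)
  map_zero' := by ext; simp
  map_add' γ δ := by ext; simp

theorem gramForm_single (Ω : S → S → ℤ) (m : ℕ) (s t : S) (x y : ℤ) :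
    gramForm Ω m (redMod m (Pi.single s x)) (redMod m (Pi.single t y)) =
      ((x * Ω s t * y : ℤ) : ZMod m) := by
  rw [gramForm_apply, Finset.sum_eq_single s, Finset.sum_eq_single t]
  · simp [redMod]
  · intro b _ hb; simp [redMod, hb]
  · simp
  · intro b _ hb; simp [redMod, hb]
  · simp

variable {k K : Type} [Field k] [CommRing K] [Algebra k K]

/-- The family `T` multiplies like a twisted group algebra of `S → ℤ`. -/
structure IsTwistedFamily {R : Type} [Ring R] [Algebra k R] (T : (S → ℤ) → R)
    (c : (S → ℤ) → (S → ℤ) → k) : Prop where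
  zero : T 0 = 1
  mul : ∀ γ δ, T γ * T δ = c γ δ • T (γ + δ)
  ne_zero : ∀ γ δ, c γ δ ≠ 0

/-- The Weyl operator attached to the lattice vector `γ`. -/
noncomputable def weylOp (Ω : S → S → ℤ) {m : ℕ} (χ : AddChar (ZMod m) k) (y : (S → ℤ) → K)
    (γ : S → ℤ) : Module.End K ((S → ZMod m) → K) where
  toFun f h := algebraMap k K (χ (halfForm Ω m (redMod m γ) h)) * y γ * f (h - redMod m γ)
  map_add' f g := by ext; simp [mul_add]
  map_smul' a f := by ext; simp; ring

theorem weylOp_apply (Ω : S → S → ℤ) {m : ℕ} (χ : AddChar (ZMod m) k) (y : (S → ℤ) → K)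
    (γ : S → ℤ) (f : (S → ZMod m) → K) (h : S → ZMod m) :
    weylOp Ω χ y γ f h =
      algebraMap k K (χ (halfForm Ω m (redMod m γ) h)) * y γ * f (h - redMod m γ) := rfl

theorem isTwistedFamily_weylOp {Ω : S → S → ℤ} (hΩ : ∀ s t, Ω t s = -Ω s t) {m : ℕ}
    (χ : AddChar (ZMod m) k) (y : (S → ℤ) → K) (hy0 : y 0 = 1)
    (hy : ∀ γ δ, y (γ + δ) = y γ * y δ) :
    IsTwistedFamily (k := k) (weylOp Ω χ y)
      (fun γ δ => χ (halfForm Ω m (redMod m γ) (redMod m δ))) where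
  zero := by
    ext1 f
    ext h
    simp [weylOp_apply, hy0]
  mul γ δ := by
    ext1 f
    ext h
    rw [Module.End.mul_apply, weylOp_apply, weylOp_apply, LinearMap.smul_apply, Pi.smul_apply,
      weylOp_apply, Algebra.smul_def, hy, map_add, sub_sub, map_add (halfForm Ω m),
      LinearMap.add_apply, map_sub (halfForm Ω m (redMod m δ)),
      halfForm_swap hΩ (redMod m γ) (redMod m δ), sub_neg_eq_add, AddChar.map_add_eq_mul,
      AddChar.map_add_eq_mul, map_mul, map_mul]
    ring
  ne_zero γ δ := (AddChar.val_isUnit χ _).ne_zero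

end WeylSystem

/-! ### Quantum determinants of quantum matrices -/

section QuantumDeterminant

theorem prod_ofFn_adjacent {R : Type} [Monoid R] {t : ℕ} (p p' : Fin t)
    (hp : (p' : ℕ) = p + 1) (f : Fin t → R) :
    ∃ A B : R, ∀ g : Fin t → R, (∀ x, x ≠ p → x ≠ p' → g x = f x) →
      (List.ofFn g).prod = A * (g p * g p') * B := by
  obtain ⟨k, hk⟩ : ∃ k, (p : ℕ) = k := ⟨_, rfl⟩
  obtain ⟨b, rfl⟩ : ∃ b, t = k + (2 + b) := ⟨t - p - 2, by omega⟩
  refine ⟨(List.ofFn fun i : Fin k => f (Fin.castAdd (2 + b) i)).prod,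
    (List.ofFn fun i : Fin b => f (Fin.natAdd k (Fin.natAdd 2 i))).prod, fun g hg => ?_⟩
  rw [List.ofFn_add, List.prod_append, List.ofFn_add, List.prod_append, ← mul_assoc]
  congr 1
  · congr 1
    · congr 2
      funext i
      apply hg <;> intro h <;> have := congrArg Fin.val h <;> simp at this <;> omega
    · simp only [List.ofFn_succ, List.ofFn_zero, List.prod_cons, List.prod_nil, mul_one]
      congr 2 <;> ext <;> simp [hp, hk]
  · congr 2
    funext i
    apply hg <;> intro h <;> have := congrArg Fin.val h <;> simp at this <;> omega

theorem invCount_mul_swap {t : ℕ} (p p' : Fin t) (hp : (p' : ℕ) = p + 1)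
    (σ : Equiv.Perm (Fin t)) (h : σ p < σ p') :
    invCount (σ * Equiv.swap p p') = invCount σ + 1 := by
  unfold invCount
  set s := Equiv.swap p p' with hs
  have hlt : ∀ x y : Fin t, ¬(x = p ∧ y = p') → x < y → s x < s y := by
    intro x y hxy hlt
    rw [hs, Equiv.swap_apply_def, Equiv.swap_apply_def]
    simp only [Fin.lt_def, Fin.ext_iff] at *
    split_ifs <;> omega
  have hset : (Finset.univ.filter (fun x : Fin t × Fin t =>
      x.1 < x.2 ∧ (σ * s) x.2 < (σ * s) x.1)) =
      insert (p, p') ((Finset.univ.filter (fun x : Fin t × Fin t =>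
        x.1 < x.2 ∧ σ x.2 < σ x.1)).map (s.prodCongr s).toEmbedding) := by
    ext ⟨x, y⟩
    rw [Finset.mem_filter, Finset.mem_insert, Finset.mem_map]
    simp only [Finset.mem_filter, Finset.mem_univ, true_and, Prod.exists, Prod.mk.injEq]
    constructor
    · rintro ⟨hxy, hσ⟩
      by_cases hpp : x = p ∧ y = p'
      · exact Or.inl hpp
      · refine Or.inr ⟨s x, s y, ⟨hlt x y hpp hxy, hσ⟩, ?_⟩
        simp [hs]
    · rintro (⟨rfl, rfl⟩ | ⟨a, b, ⟨hab, hσ⟩, he⟩)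
      · refine ⟨by rw [Fin.lt_def]; omega, ?_⟩
        simpa [hs] using h
      · simp only [Equiv.coe_toEmbedding, Equiv.prodCongr_apply, Prod.map_apply,
          Prod.mk.injEq] at he
        obtain ⟨rfl, rfl⟩ := he
        have hne : ¬(a = p ∧ b = p') := by
          rintro ⟨rfl, rfl⟩
          exact absurd h hσ.not_gt
        refine ⟨hlt a b hne hab, ?_⟩
        simpa [hs] using hσ
  rw [hset, Finset.card_insert_of_notMem, Finset.card_map]
  simp only [Finset.mem_map, Finset.mem_filter, Finset.mem_univ, true_and, Prod.exists, not_exists,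
    not_and]
  rintro a b ⟨hab, hσ⟩ he
  simp only [Equiv.coe_toEmbedding, Equiv.prodCongr_apply, Prod.map_apply, Prod.mk.injEq] at he
  have ha : a = p' := by rw [← s.injective.eq_iff, he.1, hs, Equiv.swap_apply_right]
  have hb : b = p := by rw [← s.injective.eq_iff, he.2, hs, Equiv.swap_apply_left]
  rw [ha, hb, Fin.lt_def] at hab
  omega

variable {k R : Type} [Field k] [Ring R] [Algebra k R]

/-- The quantum determinant of the rows `a` and columns `J` of an array. -/
noncomputable def qDetArray (q : k) (Y : ℕ → ℕ → R) {t : ℕ} (a J : Fin t → ℕ) : R :=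
  ∑ σ : Equiv.Perm (Fin t), ((-q) ^ invCount σ) •
    (List.ofFn fun i => Y (a i) (J (σ i))).prod

theorem qDetArray_adjacent (q : k) (Y : ℕ → ℕ → R) {t : ℕ} (a J : Fin t → ℕ) (p p' : Fin t)
    (hp : (p' : ℕ) = p + 1) :
    ∃ A B : Equiv.Perm (Fin t) → R, ∀ a' : Fin t → ℕ, (∀ x, x ≠ p → x ≠ p' → a' x = a x) →
      qDetArray q Y a' J = ∑ σ : Equiv.Perm (Fin t) with σ p < σ p',
        ((-q) ^ invCount σ) • (A σ * (Y (a' p) (J (σ p)) * Y (a' p') (J (σ p')) -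
          q • (Y (a' p) (J (σ p')) * Y (a' p') (J (σ p)))) * B σ) := by
  choose A B hAB using fun σ : Equiv.Perm (Fin t) =>
    prod_ofFn_adjacent p p' hp (fun i => Y (a i) (J (σ i)))
  refine ⟨A, B, fun a' ha' => ?_⟩
  have hne : p ≠ p' := by rintro rfl; omega
  unfold qDetArray
  rw [← Finset.sum_filter_add_sum_filter_not Finset.univ
    (fun σ : Equiv.Perm (Fin t) => σ p < σ p')]
  have h2 : ∑ σ : Equiv.Perm (Fin t) with ¬ σ p < σ p', ((-q) ^ invCount σ) •
      (List.ofFn fun i => Y (a' i) (J (σ i))).prod =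
      ∑ σ : Equiv.Perm (Fin t) with σ p < σ p', ((-q) ^ invCount (σ * Equiv.swap p p')) •
        (List.ofFn fun i => Y (a' i) (J ((σ * Equiv.swap p p') i))).prod := by
    symm
    refine Finset.sum_bij (fun σ _ => σ * Equiv.swap p p') ?_ ?_ ?_ ?_
    · intro σ hσ
      simp only [Finset.mem_filter, Finset.mem_univ, true_and] at hσ ⊢
      simpa using hσ.le
    · intro σ _ τ _ h
      exact mul_right_cancel h
    · intro σ hσ
      refine ⟨σ * Equiv.swap p p', ?_, by simp [mul_assoc]⟩
      simp only [Finset.mem_filter, Finset.mem_univ, true_and, not_lt] at hσ ⊢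
      simpa using lt_of_le_of_ne hσ (fun h => hne (σ.injective h).symm)
    · intros; rfl
  rw [h2, ← Finset.sum_add_distrib]
  refine Finset.sum_congr rfl fun σ hσ => ?_
  simp only [Finset.mem_filter, Finset.mem_univ, true_and] at hσ
  rw [invCount_mul_swap p p' hp σ hσ, hAB σ (fun i => Y (a' i) (J (σ i))), hAB σ]
  · simp only [Equiv.Perm.mul_apply, Equiv.swap_apply_left, Equiv.swap_apply_right, mul_sub,
      sub_mul, mul_smul_comm, smul_mul_assoc, smul_sub, pow_succ]
    module
  · intro x h1 h2
    simp only [Equiv.Perm.mul_apply]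
    rw [Equiv.swap_apply_of_ne_of_ne h1 h2, ha' x h1 h2]
  · intro x h1 h2
    rw [ha' x h1 h2]

variable {q : k} {Y : ℕ → ℕ → R}

theorem qDetArray_eq_zero_of_adjacent (hY : IsQuantumMatrix q Y) {t : ℕ} (a J : Fin t → ℕ)
    (hJ : StrictMono J) (p p' : Fin t) (hp : (p' : ℕ) = p + 1) (h : a p = a p') :
    qDetArray q Y a J = 0 := by
  obtain ⟨A, B, hAB⟩ := qDetArray_adjacent q Y a J p p' hp
  rw [hAB a (fun _ _ _ => rfl)]
  refine Finset.sum_eq_zero fun σ hσ => ?_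
  simp only [Finset.mem_filter, Finset.mem_univ, true_and] at hσ
  rw [h, hY.row _ _ _ (hJ hσ)]
  simp

theorem qDetArray_swap (hq : q ≠ 0) (hY : IsQuantumMatrix q Y) {t : ℕ} (a J : Fin t → ℕ)
    (hJ : StrictMono J) (p p' : Fin t) (hp : (p' : ℕ) = p + 1) (h : a p < a p') :
    qDetArray q Y (a ∘ Equiv.swap p p') J = (-q) • qDetArray q Y a J := by
  obtain ⟨A, B, hAB⟩ := qDetArray_adjacent q Y a J p p' hp
  rw [hAB a (fun _ _ _ => rfl), hAB _ (fun x h1 h2 => by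
    rw [Function.comp_apply, Equiv.swap_apply_of_ne_of_ne h1 h2]), Finset.smul_sum]
  refine Finset.sum_congr rfl fun σ hσ => ?_
  simp only [Finset.mem_filter, Finset.mem_univ, true_and] at hσ
  simp only [Function.comp_apply, Equiv.swap_apply_left, Equiv.swap_apply_right]
  rw [hY.diag _ _ _ _ h (hJ hσ), ← hY.cross _ _ _ _ h (hJ hσ)]
  simp only [mul_sub, sub_mul, mul_add, add_mul, mul_smul_comm, smul_mul_assoc, smul_sub]
  match_scalars <;> field_simp <;> ring

theorem qDetArray_eq_zero (hq : q ≠ 0) (hY : IsQuantumMatrix q Y) {t : ℕ} (a J : Fin t → ℕ)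
    (hJ : StrictMono J) (ha : ¬ Function.Injective a) : qDetArray q Y a J = 0 := by
  have key : ∀ d : ℕ, ∀ a : Fin t → ℕ, ∀ i j : Fin t, (j : ℕ) = i + d + 1 → a i = a j →
      qDetArray q Y a J = 0 := by
    intro d
    induction d with
    | zero => exact fun a i j hij h => qDetArray_eq_zero_of_adjacent hY a J hJ i j hij h
    | succ d ih =>
      intro a i j hij h
      have hj := j.isLt
      let l : Fin t := ⟨i + d + 1, by omega⟩
      have hlj : (j : ℕ) = l + 1 := by simp [l]; omega
      have hsw : qDetArray q Y (a ∘ Equiv.swap l j) J = 0 := by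
        refine ih _ i l rfl ?_
        rw [Function.comp_apply, Function.comp_apply, Equiv.swap_apply_left,
          Equiv.swap_apply_of_ne_of_ne, h]
        · intro e; have := congrArg Fin.val e; simp [l] at this; omega
        · intro e; have := congrArg Fin.val e; omega
      rcases lt_trichotomy (a l) (a j) with hlt | heq | hgt
      · rw [qDetArray_swap hq hY a J hJ l j hlj hlt] at hsw
        exact (smul_eq_zero.mp hsw).resolve_left (neg_ne_zero.mpr hq)
      · exact qDetArray_eq_zero_of_adjacent hY a J hJ l j hlj heq
      · have h2 := qDetArray_swap hq hY (a ∘ Equiv.swap l j) J hJ l j hlj (by simpa using hgt)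
        rw [hsw, smul_zero, Function.comp_assoc, ← Equiv.coe_trans] at h2
        simpa using h2
  simp only [Function.Injective, not_forall] at ha
  obtain ⟨i, j, hij, hne⟩ := ha
  rcases lt_or_gt_of_ne hne with h | h
  · exact key (j - i - 1) a i j (by rw [Fin.lt_def] at h; omega) hij
  · exact key (i - j - 1) a j i (by rw [Fin.lt_def] at h; omega) hij.symm

theorem prod_ofFn_mul_of_commute {t : ℕ} (f g : Fin t → R) (h : ∀ i j, f i * g j = g j * f i) :
    (List.ofFn fun i => f i * g i).prod = (List.ofFn f).prod * (List.ofFn g).prod := by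
  induction t with
  | zero => simp
  | succ t ih =>
    simp only [List.ofFn_succ, List.prod_cons]
    rw [ih _ _ (fun i j => h _ _)]
    have hc : Commute (g 0) (List.ofFn fun i : Fin t => f i.succ).prod := by
      apply Commute.list_prod_right
      intro x hx
      obtain ⟨i, rfl⟩ := (List.mem_ofFn).mp hx
      exact (h _ _).symm
    simp only [mul_assoc]
    rw [← mul_assoc (g 0), hc.eq, mul_assoc]

/-- The Cauchy-Binet expansion over all index functions. -/
theorem qDetArray_mul (X Y : ℕ → ℕ → R) (hc : ∀ i a b j, X i a * Y b j = Y b j * X i a) (r : ℕ)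
    {t : ℕ} (I J : Fin t → ℕ) :
    qDetArray q (fun i j => ∑ a ∈ Finset.range r, X i a * Y a j) I J =
      ∑ a : Fin t → Fin r, (List.ofFn fun i => X (I i) (a i)).prod *
        qDetArray q Y (fun i => (a i : ℕ)) J := by
  unfold qDetArray
  simp only [Finset.mul_sum]
  rw [Finset.sum_comm]
  refine Finset.sum_congr rfl fun σ _ => ?_
  simp only [mul_smul_comm, ← Finset.smul_sum]
  congr 1
  have := (MultilinearMap.mkPiAlgebraFin k t R).map_sum
    (fun i (a : Fin r) => X (I i) a * Y a (J (σ i)))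
  simp only [MultilinearMap.mkPiAlgebraFin_apply] at this
  simp only [Finset.sum_range]
  rw [this]
  refine Finset.sum_congr rfl fun a _ => ?_
  exact prod_ofFn_mul_of_commute _ _ fun i j => hc _ _ _ _

end QuantumDeterminant

/-! ### Leading terms -/

theorem le_apply_of_strictMono_fin {t : ℕ} {f : Fin t → ℕ} (hf : StrictMono f) (i : Fin t) :
    (i : ℕ) ≤ f i := by
  obtain ⟨i, hi⟩ := i
  induction i with
  | zero => exact Nat.zero_le _
  | succ i ih =>
    have h1 := ih (by omega)
    have h2 : f ⟨i, by omega⟩ < f ⟨i + 1, hi⟩ := hf (by simp [Fin.lt_def])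
    simp only at h1 ⊢
    omega

theorem sum_mul_rearrange {t : ℕ} (c : Fin t → ℤ) (hc : StrictAnti c) (hpos : ∀ i, 0 < c i)
    (a : Fin t → ℕ) (ha : Function.Injective a) :
    (∑ i, c i * (i : ℕ) ≤ ∑ i, c i * a i) ∧
      ((∃ i, a i ≠ i) → ∑ i, c i * (i : ℕ) < ∑ i, c i * a i) := by
  have hsum : ∀ (t : ℕ) (a : Fin t → ℕ), Function.Injective a →
      ∑ i : Fin t, (i : ℕ) ≤ ∑ i, a i := by
    intro t a ha
    rw [← Equiv.sum_comp (Tuple.sort a) a]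
    exact Finset.sum_le_sum fun i _ => le_apply_of_strictMono_fin
      ((Tuple.monotone_sort a).strictMono_of_injective (ha.comp (Tuple.sort a).injective)) i
  induction t with
  | zero => simp
  | succ t ih =>
    have hl := fun i : Fin t => hc (Fin.castSucc_lt_last i)
    have := ih (fun i => c i.castSucc - c (Fin.last t))
      (fun i j hij => by
        have := hc (show i.castSucc < j.castSucc from hij)
        dsimp only; omega)
      (fun i => by have := hl i; omega)
      (fun i => a i.castSucc) (fun i j h => by simpa using ha h)
    have e : ∀ f : Fin (t + 1) → ℕ, ∑ i, c i * (f i : ℤ) =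
        ∑ i : Fin t, (c i.castSucc - c (Fin.last t)) * f i.castSucc +
          c (Fin.last t) * ((∑ i, f i : ℕ) : ℤ) := fun f => by
      rw [Fin.sum_univ_castSucc, Fin.sum_univ_castSucc]
      push_cast
      rw [mul_add, Finset.mul_sum, ← add_assoc, ← Finset.sum_add_distrib]
      congr 1
      exact Finset.sum_congr rfl fun i _ => by ring
    rw [e a, e (fun i => (i : ℕ))]
    have hp := hpos (Fin.last t)
    have hs := hsum _ a ha
    simp only [Fin.val_castSucc] at this ⊢
    have h1 : c (Fin.last t) * ((∑ i : Fin (t + 1), (i : ℕ) : ℕ) : ℤ) ≤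
        c (Fin.last t) * ((∑ i, a i : ℕ) : ℤ) :=
      mul_le_mul_of_nonneg_left (by exact_mod_cast hs) hp.le
    refine ⟨add_le_add this.1 h1, ?_⟩
    rintro ⟨i, hi⟩
    by_cases hex : ∃ i : Fin t, a i.castSucc ≠ i
    · exact add_lt_add_of_lt_of_le (this.2 hex) h1
    · push Not at hex
      refine add_lt_add_of_le_of_lt this.1 (mul_lt_mul_of_pos_left ?_ hp)
      norm_cast
      rw [Fin.sum_univ_castSucc, Fin.sum_univ_castSucc a]
      simp only [hex, Fin.val_castSucc, Fin.val_last]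
      have hla : a (Fin.last t) ≠ t := by
        intro h
        induction i using Fin.lastCases with
        | last => exact hi (by simpa using h)
        | cast i => exact hi (by simpa using hex i)
      have : t ≤ a (Fin.last t) := by
        by_contra! hlt
        have := ha (hex ⟨_, hlt⟩)
        simp [Fin.ext_iff] at this
        omega
      omega

section Leads

variable {k R S : Type} [Field k] [Ring R] [Algebra k R]

/-- The span of the members of the family `T` of weight less than `w`. -/
def lowSpan (k : Type) [Field k] {R S : Type} [Ring R] [Algebra k R] (T : (S → ℤ) → R)
    (W : (S → ℤ) →+ ℤ) (w : ℤ) : Submodule k R :=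
  Submodule.span k (T '' {γ | W γ < w})

/-- `M` is a nonzero multiple of `T γ` up to terms of smaller weight. -/
def HasLead (k : Type) [Field k] {R S : Type} [Ring R] [Algebra k R] (T : (S → ℤ) → R)
    (W : (S → ℤ) →+ ℤ) (M : R) (γ : S → ℤ) : Prop :=
  ∃ u : k, u ≠ 0 ∧ M - u • T γ ∈ lowSpan k T W (W γ)

variable {T : (S → ℤ) → R} {W : (S → ℤ) →+ ℤ} {c : (S → ℤ) → (S → ℤ) → k}

theorem mem_lowSpan {γ : S → ℤ} {w : ℤ} (h : W γ < w) : T γ ∈ lowSpan k T W w :=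
  Submodule.subset_span ⟨γ, h, rfl⟩

theorem lowSpan_mono {v w : ℤ} (h : v ≤ w) : lowSpan k T W v ≤ lowSpan k T W w :=
  Submodule.span_mono (Set.image_mono fun _ hγ => lt_of_lt_of_le hγ h)

theorem IsTwistedFamily.mul_mem_lowSpan (hT : IsTwistedFamily T c) {v w : ℤ} {M N : R}
    (hM : M ∈ lowSpan k T W v) (hN : N ∈ lowSpan k T W w) :
    M * N ∈ lowSpan k T W (v + w - 1) := by
  unfold lowSpan at hM hN
  induction hM using Submodule.span_induction with
  | mem x hx =>
    obtain ⟨γ, hγ, rfl⟩ := hx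
    induction hN using Submodule.span_induction with
    | mem x hx =>
      obtain ⟨δ, hδ, rfl⟩ := hx
      rw [hT.mul]
      refine Submodule.smul_mem _ _ (mem_lowSpan ?_)
      simp only [Set.mem_ofPred_eq] at hγ hδ
      rw [map_add]
      omega
    | zero => simp
    | add x y _ _ hx hy => rw [mul_add]; exact Submodule.add_mem _ hx hy
    | smul a x _ hx => rw [mul_smul_comm]; exact Submodule.smul_mem _ _ hx
  | zero => simp
  | add x y _ _ hx hy => rw [add_mul]; exact Submodule.add_mem _ hx hy
  | smul a x _ hx => rw [smul_mul_assoc]; exact Submodule.smul_mem _ _ hx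

theorem HasLead.mem_lowSpan {M : R} {γ : S → ℤ} (h : HasLead k T W M γ) {w : ℤ} (hw : W γ < w) :
    M ∈ lowSpan k T W w := by
  obtain ⟨u, _, hu⟩ := h
  have := Submodule.add_mem _ (lowSpan_mono hw.le hu)
    (Submodule.smul_mem _ u (_root_.mem_lowSpan (k := k) (T := T) hw))
  simpa using this

theorem hasLead_self (γ : S → ℤ) : HasLead k T W (T γ) γ := ⟨1, one_ne_zero, by simp⟩

theorem HasLead.add {M N : R} {γ : S → ℤ} (h : HasLead k T W M γ)
    (hN : N ∈ lowSpan k T W (W γ)) : HasLead k T W (M + N) γ := by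
  obtain ⟨u, hu0, hu⟩ := h
  refine ⟨u, hu0, ?_⟩
  rw [add_sub_right_comm]
  exact Submodule.add_mem _ hu hN

theorem HasLead.smul {M : R} {γ : S → ℤ} (h : HasLead k T W M γ) {a : k} (ha : a ≠ 0) :
    HasLead k T W (a • M) γ := by
  obtain ⟨u, hu0, hu⟩ := h
  refine ⟨a * u, mul_ne_zero ha hu0, ?_⟩
  rw [mul_smul, ← smul_sub]
  exact Submodule.smul_mem _ _ hu

theorem HasLead.mul (hT : IsTwistedFamily T c) {M N : R} {γ δ : S → ℤ} (hM : HasLead k T W M γ)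
    (hN : HasLead k T W N δ) : HasLead k T W (M * N) (γ + δ) := by
  obtain ⟨u, hu0, hu⟩ := hM
  have hN' := hN.mem_lowSpan (lt_add_one _)
  obtain ⟨v, hv0, hv⟩ := hN
  refine ⟨u * v * c γ δ, mul_ne_zero (mul_ne_zero hu0 hv0) (hT.ne_zero _ _), ?_⟩
  have e : M * N - (u * v * c γ δ) • T (γ + δ) =
      (M - u • T γ) * N + (u • T γ) * (N - v • T δ) := by
    rw [sub_mul, mul_sub, smul_mul_smul_comm, hT.mul, smul_smul]
    abel
  rw [e, map_add]
  refine Submodule.add_mem _ ?_ ?_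
  · have := hT.mul_mem_lowSpan hu hN'
    rwa [show W γ + (W δ + 1) - 1 = W γ + W δ by ring] at this
  · have := hT.mul_mem_lowSpan (Submodule.smul_mem _ u
      (_root_.mem_lowSpan (k := k) (T := T) (lt_add_one (W γ)))) hv
    rwa [show W γ + 1 + W δ - 1 = W γ + W δ by ring] at this

theorem HasLead.one (hT : IsTwistedFamily T c) : HasLead k T W (1 : R) 0 := by
  rw [← hT.zero]
  exact hasLead_self 0

theorem HasLead.prod_ofFn (hT : IsTwistedFamily T c) {t : ℕ} (f : Fin t → R)
    (γ : Fin t → S → ℤ) (h : ∀ i, HasLead k T W (f i) (γ i)) :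
    HasLead k T W (List.ofFn f).prod (∑ i, γ i) := by
  induction t with
  | zero => simpa using HasLead.one hT
  | succ t ih =>
    rw [List.ofFn_succ, List.prod_cons, Fin.sum_univ_succ]
    exact HasLead.mul hT (h 0) (ih _ _ fun i => h _)

theorem IsTwistedFamily.prod_ofFn_mem_lowSpan (hT : IsTwistedFamily T c) {t : ℕ} (f : Fin t → R)
    (w : Fin t → ℤ) (h : ∀ i, f i ∈ lowSpan k T W (w i + 1)) :
    (List.ofFn f).prod ∈ lowSpan k T W (∑ i, w i + 1) := by
  induction t with
  | zero => simpa using (HasLead.one (W := W) hT).mem_lowSpan (w := 1) (by simp)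
  | succ t ih =>
    rw [List.ofFn_succ, List.prod_cons, Fin.sum_univ_succ]
    have := hT.mul_mem_lowSpan (h 0) (ih _ _ fun i => h i.succ)
    rwa [show w 0 + 1 + (∑ i : Fin t, w i.succ + 1) - 1 = w 0 + ∑ i : Fin t, w i.succ + 1 by
      ring] at this

/-- Elements with pairwise distinct leading exponents are linearly independent. -/
theorem linearIndependent_of_hasLead {F : Type} [AddCommGroup F] [Module k F] (ev : R →ₗ[k] F)
    (hψ : ∀ γ, ∃ ψ : F →ₗ[k] k, ψ (ev (T γ)) = 1 ∧ ∀ δ, δ ≠ γ → ψ (ev (T δ)) = 0)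
    {ι : Type} (M : ι → R) (γ : ι → S → ℤ) (hγ : Function.Injective γ)
    (h : ∀ i, HasLead k T W (M i) (γ i)) :
    LinearIndependent k fun i => ev (M i) := by
  classical
  rw [linearIndependent_iff']
  intro s g hg
  by_contra! hne
  obtain ⟨i₀, hi₀, hgi₀⟩ := hne
  obtain ⟨i, hi, hmax⟩ := (s.filter (fun i => g i ≠ 0)).exists_max_image (fun i => W (γ i))
    ⟨i₀, by simp [hi₀, hgi₀]⟩
  rw [Finset.mem_filter] at hi
  obtain ⟨ψ', hψ1, hψ0⟩ := hψ (γ i)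
  set ψ : R →ₗ[k] k := ψ' ∘ₗ ev with hψdef
  change ψ _ = 1 at hψ1
  change ∀ δ, δ ≠ γ i → ψ (T δ) = 0 at hψ0
  have hlow : ∀ w, w ≤ W (γ i) → ∀ N ∈ lowSpan k T W w, ψ N = 0 := by
    intro w hw N hN
    unfold lowSpan at hN
    induction hN using Submodule.span_induction with
    | mem x hx =>
      obtain ⟨δ, hδ, rfl⟩ := hx
      refine hψ0 δ ?_
      rintro rfl
      exact absurd hδ (not_lt.mpr hw)
    | zero => simp
    | add x y _ _ hx hy => rw [map_add, hx, hy, add_zero]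
    | smul a x _ hx => rw [map_smul, hx, smul_zero]
  have h2 : ∑ i ∈ s, g i * ψ (M i) = 0 := by
    have := congrArg ψ' hg
    simpa [hψdef] using this
  rw [Finset.sum_eq_single i] at h2
  · obtain ⟨u, hu0, hu⟩ := h i
    have h3 := hlow _ le_rfl _ hu
    rw [map_sub, map_smul, hψ1, sub_eq_zero] at h3
    rw [h3] at h2
    simp [hi.2, hu0] at h2
  · intro j hj hji
    by_cases hgj : g j = 0
    · simp [hgj]
    · have hle := hmax j (by simp [hj, hgj])
      obtain ⟨u, hu0, hu⟩ := h j
      have h3 := hlow _ hle _ hu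
      rw [map_sub, map_smul, hψ0 _ (fun e => hji (hγ e)), smul_zero, sub_zero] at h3
      rw [h3, mul_zero]
  · exact fun hni => absurd hi.1 hni

end Leads

/-! ### The torus algebra of two triangular arrays -/

section RankTorus

/-- Positions in a pair of `n × r` arrays. -/
abbrev RankIdx (n r : ℕ) : Type := Bool × Fin n × Fin r

/-- The commutation form on pairs of arrays. -/
def rankOmega (n r : ℕ) (s t : RankIdx n r) : ℤ :=
  if s.1 = t.1 then torusExp s.2.1 s.2.2 t.2.1 t.2.2 else 0

theorem torusExp_swap (i a s b : ℕ) : torusExp s b i a = -torusExp i a s b := by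
  unfold torusExp
  split_ifs <;> omega

theorem rankOmega_swap (n r : ℕ) (s t : RankIdx n r) : rankOmega n r t s = -rankOmega n r s t := by
  unfold rankOmega
  by_cases h : s.1 = t.1
  · rw [if_pos h, if_pos h.symm, torusExp_swap]
  · rw [if_neg h, if_neg (Ne.symm h), neg_zero]

/-- The unit vector at position `(i, a)` of the array `β`. -/
def sideVec (n r : ℕ) (β : Bool) (i a : ℕ) : RankIdx n r → ℤ :=
  fun s => if s.1 = β ∧ (s.2.1 : ℕ) = i ∧ (s.2.2 : ℕ) = a then 1 else 0

theorem sideVec_eq_single {n r : ℕ} (β : Bool) {i a : ℕ} (hi : i < n) (ha : a < r) :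
    sideVec n r β i a = Pi.single (β, ⟨i, hi⟩, ⟨a, ha⟩) 1 := by
  ext ⟨β', i', a'⟩
  simp [sideVec, Pi.single_apply, Fin.ext_iff]

/-- The weight used to order the exponents. -/
def rankWeight (n r : ℕ) : (RankIdx n r → ℤ) →+ ℤ where
  toFun γ := ∑ s, γ s * ((((s.2.1 : ℕ) : ℤ) - n) * (((s.2.2 : ℕ) : ℤ) + 1))
  map_zero' := by simp
  map_add' γ δ := by simp [add_mul, Finset.sum_add_distrib]

theorem rankWeight_sideVec {n r : ℕ} (β : Bool) {i a : ℕ} (hi : i < n) (ha : a < r) :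
    rankWeight n r (sideVec n r β i a) = ((i : ℤ) - n) * (a + 1) := by
  rw [sideVec_eq_single β hi ha]
  simp only [rankWeight, AddMonoidHom.coe_mk, ZeroHom.coe_mk]
  rw [Finset.sum_eq_single (β, ⟨i, hi⟩, ⟨a, ha⟩)]
  · simp
  · intro b _ hb; simp [hb]
  · simp

variable {k R : Type} [Field k] [Ring R] [Algebra k R] {n r : ℕ}

/-- The torus generator at position `(i, a)` of the array `β`. -/
def torusGen (T : (RankIdx n r → ℤ) → R) (β : Bool) (i a : ℕ) : R :=
  if a ≤ i ∧ i < n ∧ a < r then T (sideVec n r β i a) else 0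

/-- The inverse torus generator at position `(i, a)` of the array `β`. -/
def torusInv (T : (RankIdx n r → ℤ) → R) (β : Bool) (i a : ℕ) : R :=
  if a ≤ i ∧ i < n ∧ a < r then T (-sideVec n r β i a) else 0

/-- The triangular array on side `β`. -/
def sideArray (T : (RankIdx n r → ℤ) → R) (β : Bool) (b c : ℕ) : ℕ → ℕ → R :=
  triArray (torusGen T β) (torusInv T β) b c

/-- The quantum matrix of rank `r`. -/
def rankMatrix (T : (RankIdx n r → ℤ) → R) (i j : ℕ) : R :=
  ∑ a ∈ Finset.range r, sideArray T false 0 r i a * sideArray T true 0 r j a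

/-- The commutation relation of a quantum torus. -/
def IsTorusFamily (q : k) (T : (RankIdx n r → ℤ) → R) : Prop :=
  ∀ s t x y, T (Pi.single s x) * T (Pi.single t y) =
    q ^ (x * rankOmega n r s t * y) • (T (Pi.single t y) * T (Pi.single s x))

variable {q : k} {T : (RankIdx n r → ℤ) → R} {c : (RankIdx n r → ℤ) → (RankIdx n r → ℤ) → k}

theorem neg_sideVec_eq_single (β : Bool) {i a : ℕ} (hi : i < n) (ha : a < r) :
    -sideVec n r β i a = Pi.single (β, ⟨i, hi⟩, ⟨a, ha⟩) (-1) := by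
  rw [sideVec_eq_single β hi ha, Pi.single_neg]

theorem IsTorusFamily.isTorusData (h : IsTorusFamily q T) (hT : IsTwistedFamily T c)
    (hc : ∀ γ, c γ (-γ) = 1) (β : Bool) :
    IsTorusData q n r (torusGen T β) (torusInv T β) := by
  constructor
  · intro i a s b
    unfold torusGen
    split_ifs with h1 h2 <;> try simp
    rw [sideVec_eq_single β h1.2.1 h1.2.2, sideVec_eq_single β h2.2.1 h2.2.2, h]
    simp [rankOmega]
  · intro i a s b
    unfold torusGen torusInv
    split_ifs with h1 h2 <;> try simp
    rw [neg_sideVec_eq_single β h1.2.1 h1.2.2, sideVec_eq_single β h2.2.1 h2.2.2, h]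
    simp [rankOmega]
  · intro i a s b
    unfold torusGen torusInv
    split_ifs with h1 h2 <;> try simp
    rw [sideVec_eq_single β h1.2.1 h1.2.2, neg_sideVec_eq_single β h2.2.1 h2.2.2, h]
    simp [rankOmega]
  · intro i a s b
    unfold torusInv
    split_ifs with h1 h2 <;> try simp
    rw [neg_sideVec_eq_single β h1.2.1 h1.2.2, neg_sideVec_eq_single β h2.2.1 h2.2.2, h]
    simp [rankOmega]
  · intro i a h; simp [torusInv, h]
  · intro i a h1 h2 h3
    simp only [torusGen, torusInv, h1, h2, h3, and_self, if_true]
    rw [hT.mul, hc, one_smul, add_neg_cancel, hT.zero]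

theorem triArray_mul_comm {t ti : ℕ → ℕ → R} {z : R} (h : ∀ i a, t i a * z = z * t i a)
    (hi : ∀ i a, ti i a * z = z * ti i a) (b c i a : ℕ) :
    triArray t ti b c i a * z = z * triArray t ti b c i a := by
  induction c generalizing b i with
  | zero => simp [triArray]
  | succ c ih =>
    simp only [triArray]
    split_ifs
    · exact h _ _
    · refine Commute.mul_left (h i b) ?_
      exact Commute.sum_left _ _ _ fun j _ => Commute.mul_left (hi j b) (ih _ _)

theorem IsTorusFamily.comm_of_ne (h : IsTorusFamily q T) {β β' : Bool} (hβ : β ≠ β')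
    {i a i' a' : ℕ} (hi : i < n) (ha : a < r) (hi' : i' < n) (ha' : a' < r) (x y : ℤ) :
    T (Pi.single (β, ⟨i, hi⟩, ⟨a, ha⟩) x) * T (Pi.single (β', ⟨i', hi'⟩, ⟨a', ha'⟩) y) =
      T (Pi.single (β', ⟨i', hi'⟩, ⟨a', ha'⟩) y) * T (Pi.single (β, ⟨i, hi⟩, ⟨a, ha⟩) x) := by
  rw [h]
  simp [rankOmega, hβ]

theorem IsTorusFamily.sideArray_comm (h : IsTorusFamily q T) {β β' : Bool} (hβ : β ≠ β')
    (b c i a b' c' i' a' : ℕ) :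
    sideArray T β b c i a * sideArray T β' b' c' i' a' =
      sideArray T β' b' c' i' a' * sideArray T β b c i a := by
  unfold sideArray
  refine triArray_mul_comm (fun j d => ?_) (fun j d => ?_) _ _ _ _ <;>
  refine (triArray_mul_comm (fun j' d' => ?_) (fun j' d' => ?_) _ _ _ _).symm <;>
  simp only [torusGen, torusInv] <;>
  (split_ifs with h1 h2 <;> try simp)
  · rw [sideVec_eq_single β' h1.2.1 h1.2.2, sideVec_eq_single β h2.2.1 h2.2.2, h.comm_of_ne hβ.symm]
  · rw [neg_sideVec_eq_single β' h1.2.1 h1.2.2, sideVec_eq_single β h2.2.1 h2.2.2,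
      h.comm_of_ne hβ.symm]
  · rw [sideVec_eq_single β' h1.2.1 h1.2.2, neg_sideVec_eq_single β h2.2.1 h2.2.2,
      h.comm_of_ne hβ.symm]
  · rw [neg_sideVec_eq_single β' h1.2.1 h1.2.2, neg_sideVec_eq_single β h2.2.1 h2.2.2,
      h.comm_of_ne hβ.symm]

theorem IsTorusFamily.isQuantumMatrix (h : IsTorusFamily q T) (hq : q ≠ 0)
    (hT : IsTwistedFamily T c) (hc : ∀ γ, c γ (-γ) = 1) : IsQuantumMatrix q (rankMatrix T) :=
  (isQuantumMatrix_triArray hq (h.isTorusData hT hc false) 0 r).mul hq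
    (isQuantumMatrix_triArray hq (h.isTorusData hT hc true) 0 r).transpose
    (fun i a b j => h.sideArray_comm (by simp) 0 r i a 0 r j b) r

theorem triArray_zero_of_lt {t ti : ℕ → ℕ → R} (ht : ∀ i a, i < a → t i a = 0) (b c i a : ℕ)
    (h : i < a) : triArray t ti b c i a = 0 := by
  induction c generalizing b i with
  | zero => rfl
  | succ c ih =>
    simp only [triArray]
    split_ifs with hb
    · subst hb; exact ht _ _ h
    · rw [Finset.sum_eq_zero, mul_zero]
      intro j hj
      rw [ih _ _ (by rw [Finset.mem_range] at hj; omega), mul_zero]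

theorem hasLead_sideArray (hT : IsTwistedFamily T c) (β : Bool) (b c' i a : ℕ) (hba : b ≤ a)
    (hac : a < b + c') (hai : a ≤ i) (hi : i < n) (ha : a < r) :
    HasLead k T (rankWeight n r) (sideArray T β b c' i a) (sideVec n r β i a) := by
  induction c' generalizing b i with
  | zero => omega
  | succ c' ih =>
    simp only [sideArray, triArray]
    split_ifs with hb
    · subst hb
      simp only [torusGen, hai, hi, ha, and_self, if_true]
      exact hasLead_self _
    · have hlead : ∀ j ≤ i, a ≤ j → HasLead k T (rankWeight n r) (torusGen T β i b *
          (torusInv T β j b * triArray (torusGen T β) (torusInv T β) (b + 1) c' j a))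
          (sideVec n r β i b + (-sideVec n r β j b + sideVec n r β j a)) := by
        intro j hji haj
        refine HasLead.mul hT ?_ (HasLead.mul hT ?_ (ih (b + 1) j (by omega) (by omega) haj
          (by omega)))
        · rw [torusGen, if_pos ⟨by omega, hi, by omega⟩]
          exact hasLead_self _
        · rw [torusInv, if_pos ⟨by omega, by omega, by omega⟩]
          exact hasLead_self _
      rw [Finset.mul_sum, Finset.sum_range_succ, add_comm]
      refine HasLead.add (by simpa using hlead i le_rfl hai) ?_
      refine Submodule.sum_mem _ fun j hj => ?_
      rw [Finset.mem_range] at hj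
      by_cases haj : a ≤ j
      · refine (hlead j hj.le haj).mem_lowSpan ?_
        rw [map_add, map_add, map_neg, rankWeight_sideVec β hi (by omega),
          rankWeight_sideVec β (by omega) (by omega), rankWeight_sideVec β (by omega) ha,
          rankWeight_sideVec β hi ha]
        have : (0 : ℤ) < ((i : ℤ) - j) * (a - b) := mul_pos (by omega) (by omega)
        linarith
      · rw [triArray_zero_of_lt (fun i a h => by simp [torusGen, h.not_ge]) _ _ _ _ (by omega)]
        simp

theorem sideArray_mem_lowSpan (hT : IsTwistedFamily T c) (β : Bool) (i a : ℕ) (hi : i < n)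
    (ha : a < r) : sideArray T β 0 r i a ∈
      lowSpan k T (rankWeight n r) (((i : ℤ) - n) * (a + 1) + 1) := by
  by_cases hai : a ≤ i
  · refine (hasLead_sideArray hT β 0 r i a (by omega) (by omega) hai hi ha).mem_lowSpan ?_
    rw [rankWeight_sideVec β hi ha]
    omega
  · rw [sideArray, triArray_zero_of_lt (fun i a h => by simp [torusGen, h.not_ge]) _ _ _ _
      (by omega)]
    exact Submodule.zero_mem _

theorem rearrange_weight {t : ℕ} (n : ℕ) (I : Fin t → ℕ) (hI : StrictMono I) (hn : ∀ i, I i < n)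
    (a : Fin t → ℕ) (ha : Function.Injective a) :
    (∑ i, ((I i : ℤ) - n) * (a i + 1) ≤ ∑ i, ((I i : ℤ) - n) * ((i : ℕ) + 1)) ∧
      ((∃ i, a i ≠ i) →
        ∑ i, ((I i : ℤ) - n) * (a i + 1) < ∑ i, ((I i : ℤ) - n) * ((i : ℕ) + 1)) := by
  have h := sum_mul_rearrange (fun i => (n : ℤ) - I i)
    (fun i j hij => by have := hI hij; dsimp only; omega) (fun i => by have := hn i; omega) a ha
  have e : ∀ f : Fin t → ℕ, ∑ i, ((I i : ℤ) - n) * (f i + 1) =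
      ∑ i, ((I i : ℤ) - n) - ∑ i, ((n : ℤ) - I i) * f i := fun f => by
    rw [← Finset.sum_sub_distrib]
    exact Finset.sum_congr rfl fun i _ => by ring
  rw [e a, e (fun i => (i : ℕ))]
  exact ⟨by linarith [h.1], fun hex => by linarith [h.2 hex]⟩

theorem qDetArray_side_term (hT : IsTwistedFamily T c) {t : ℕ} (J : Fin t → ℕ)
    (hJn : ∀ i, J i < n) (a : Fin t → ℕ) (har : ∀ i, a i < r)
    (σ : Equiv.Perm (Fin t)) :
    (List.ofFn fun i => sideArray T true 0 r (J (σ i)) (a i)).prod ∈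
      lowSpan k T (rankWeight n r) (∑ i, ((J i : ℤ) - n) * (a (σ⁻¹ i) + 1) + 1) := by
  have h := hT.prod_ofFn_mem_lowSpan (W := rankWeight n r)
    (fun i => sideArray T true 0 r (J (σ i)) (a i)) _
    (fun i => sideArray_mem_lowSpan hT true (J (σ i)) (a i) (hJn _) (har i))
  rw [← Equiv.sum_comp σ]
  simpa using h

theorem hasLead_qDetArray (h : IsTorusFamily q T) (hq : q ≠ 0) (hT : IsTwistedFamily T c)
    (hc : ∀ γ, c γ (-γ) = 1) {t : ℕ} (ht : t ≤ r) (I J : Fin t → ℕ) (hI : StrictMono I)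
    (hJ : StrictMono J) (hIn : ∀ i, I i < n) (hJn : ∀ i, J i < n) :
    HasLead k T (rankWeight n r) (qDetArray q (rankMatrix T) I J)
      (∑ i, sideVec n r false (I i) i + ∑ i, sideVec n r true (J i) i) := by
  have hW : ∀ (β : Bool) (L : Fin t → ℕ), (∀ i, L i < n) →
      rankWeight n r (∑ i, sideVec n r β (L i) i) = ∑ i, ((L i : ℤ) - n) * ((i : ℕ) + 1) := by
    intro β L hL
    rw [map_sum]
    exact Finset.sum_congr rfl fun i _ => rankWeight_sideVec β (hL i) (by omega)
  have hY : IsQuantumMatrix q (fun a j => sideArray T true 0 r j a) :=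
    (isQuantumMatrix_triArray hq (h.isTorusData hT hc true) 0 r).transpose
  have key := qDetArray_mul (q := q) (fun i a => sideArray T false 0 r i a)
    (fun a j => sideArray T true 0 r j a)
    (fun i a b j => h.sideArray_comm (by simp) 0 r i a 0 r j b) r I J
  have hdef : qDetArray q (rankMatrix T) I J = qDetArray q (fun i j => ∑ a ∈ Finset.range r,
    (fun i a => sideArray T false 0 r i a) i a * (fun a j => sideArray T true 0 r j a) a j) I J :=
    rfl
  rw [hdef, key]
  have hid : Function.Injective fun i : Fin t => Fin.castLE ht i := Fin.castLE_injective ht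
  rw [← Finset.add_sum_erase _ _ (Finset.mem_univ fun i : Fin t => Fin.castLE ht i)]
  refine HasLead.add ?_ ?_
  · refine HasLead.mul hT ?_ ?_
    · refine HasLead.prod_ofFn hT _ _ fun i => ?_
      exact hasLead_sideArray hT false 0 r _ _ (Nat.zero_le _) (by simp; omega)
        (le_apply_of_strictMono_fin hI i) (hIn i) (by simp; omega)
    · unfold qDetArray
      rw [← Finset.add_sum_erase _ _ (Finset.mem_univ 1)]
      refine HasLead.add ?_ ?_
      · refine HasLead.smul (HasLead.prod_ofFn hT _ _ fun i => ?_)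
          (pow_ne_zero _ (neg_ne_zero.mpr hq))
        exact hasLead_sideArray hT true 0 r _ _ (Nat.zero_le _) (by simp; omega)
          (le_apply_of_strictMono_fin hJ i) (hJn i) (by simp; omega)
      · refine Submodule.sum_mem _ fun σ hσ => Submodule.smul_mem _ _ ?_
        rw [Finset.mem_erase] at hσ
        refine lowSpan_mono ?_ (qDetArray_side_term hT J hJn
          (fun i => ((Fin.castLE ht i : Fin r) : ℕ))
          (fun i => by simp; omega) σ)
        rw [hW true J hJn]
        have := (rearrange_weight n J hJ hJn (fun i => ((σ⁻¹ i : Fin t) : ℕ))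
          (fun i j hij => σ⁻¹.injective (Fin.ext hij))).2 (by
            by_contra! hall
            refine hσ.1 ?_
            have : σ⁻¹ = 1 := Equiv.ext fun i => Fin.ext (hall i)
            simpa using this)
        simpa using this
  · refine Submodule.sum_mem _ fun a ha => ?_
    rw [Finset.mem_erase] at ha
    by_cases hinj : Function.Injective a
    · have hinj' : Function.Injective fun i => ((a i : Fin r) : ℕ) :=
        fun i j hij => hinj (Fin.ext hij)
      have h1 := hT.prod_ofFn_mem_lowSpan (W := rankWeight n r)
        (fun i => sideArray T false 0 r (I i) (a i)) _
        (fun i => sideArray_mem_lowSpan hT false (I i) (a i) (hIn i) (a i).2)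
      have h2 : qDetArray q (fun a j => sideArray T true 0 r j a) (fun i => ((a i : Fin r) : ℕ)) J ∈
          lowSpan k T (rankWeight n r) (∑ i, ((J i : ℤ) - n) * ((i : ℕ) + 1) + 1) := by
        refine Submodule.sum_mem _ fun σ _ => Submodule.smul_mem _ _ ?_
        refine lowSpan_mono ?_ (qDetArray_side_term hT J hJn _ (fun i => (a i).2) σ)
        have := (rearrange_weight n J hJ hJn _ (hinj'.comp (σ⁻¹ : Equiv.Perm (Fin t)).injective)).1
        simpa using this
      refine lowSpan_mono ?_ (hT.mul_mem_lowSpan h1 h2)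
      have h3 := (rearrange_weight n I hI hIn _ hinj').2 (by
        by_contra! hall
        exact ha.1 (funext fun i => Fin.ext (hall i)))
      rw [map_add, hW false I hIn, hW true J hJn]
      linarith
    · rw [qDetArray_eq_zero hq hY _ J hJ fun h' => hinj fun i j hij => h' (by simp [hij]),
        mul_zero]
      exact Submodule.zero_mem _

theorem qDetArray_rankMatrix_eq_zero (h : IsTorusFamily q T) (hq : q ≠ 0)
    (hT : IsTwistedFamily T c) (hc : ∀ γ, c γ (-γ) = 1) {t : ℕ} (ht : r < t) (I J : Fin t → ℕ)
    (hJ : StrictMono J) : qDetArray q (rankMatrix T) I J = 0 := by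
  have hY : IsQuantumMatrix q (fun a j => sideArray T true 0 r j a) :=
    (isQuantumMatrix_triArray hq (h.isTorusData hT hc true) 0 r).transpose
  have key := qDetArray_mul (q := q) (fun i a => sideArray T false 0 r i a)
    (fun a j => sideArray T true 0 r j a)
    (fun i a b j => h.sideArray_comm (by simp) 0 r i a 0 r j b) r I J
  refine key.trans (Finset.sum_eq_zero fun a _ => ?_)
  rw [qDetArray_eq_zero hq hY _ J hJ, mul_zero]
  intro hinj
  have := Fintype.card_le_of_injective a fun i j hij => hinj (by simp [hij])
  simp at this
  omega

end RankTorus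

section QMatLift

variable {k R : Type} [Field k] [Ring R] [Algebra k R] {q : k} {X : ℕ → ℕ → R}

/-- The algebra map out of `M_q(n, r)` defined by a quantum matrix. -/
noncomputable def IsQuantumMatrix.lift (hX : IsQuantumMatrix q X) (n r : ℕ) :
    QMat k q n r →ₐ[k] R :=
  RingQuot.liftAlgHom k ⟨FreeAlgebra.lift k fun p : Fin n × Fin r => X p.1 p.2, fun x y h => by
    cases h with
    | row i j l h => simpa using hX.row i j l h
    | col i s j h => simpa using hX.col i s j h
    | cross i s j l h1 h2 => simpa using hX.cross i s j l h1 h2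
    | diag i s j l h1 h2 => simpa using hX.diag i s j l h1 h2⟩

theorem IsQuantumMatrix.lift_Zgen (hX : IsQuantumMatrix q X) {n r : ℕ} (i : Fin n) (j : Fin r) :
    hX.lift n r (Zgen k q n r i j) = X i j := by
  simp [IsQuantumMatrix.lift, Zgen]

theorem IsQuantumMatrix.lift_qMinor (hX : IsQuantumMatrix q X) {n r t : ℕ} (ro : Fin t → Fin n)
    (co : Fin t → Fin r) :
    hX.lift n r (qMinor k q n r t ro co) =
      qDetArray q X (fun i => (ro i : ℕ)) (fun j => (co j : ℕ)) := by
  simp only [qMinor, qDetArray, map_sum, map_smul, map_list_prod, List.map_ofFn]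
  refine Finset.sum_congr rfl fun σ _ => ?_
  congr 3
  ext i
  simp [hX.lift_Zgen]

/-- The algebra map out of `M_q^{r+1}(n)` defined by a quantum matrix with vanishing minors. -/
noncomputable def IsQuantumMatrix.rankLift (hX : IsQuantumMatrix q X) (n r : ℕ)
    (h : ∀ I J : Fin (r + 1) → ℕ, StrictMono J → qDetArray q X I J = 0) :
    QMatRank k q n r →ₐ[k] R :=
  RingQuot.liftAlgHom k ⟨hX.lift n n, fun x y hxy => by
    obtain ⟨⟨ro, co, -, hco, rfl⟩, rfl⟩ := hxy
    rw [hX.lift_qMinor, map_zero]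
    exact h _ _ hco⟩

theorem IsQuantumMatrix.rankLift_rankProj (hX : IsQuantumMatrix q X) (n r : ℕ)
    (h : ∀ I J : Fin (r + 1) → ℕ, StrictMono J → qDetArray q X I J = 0) (x : QMat k q n n) :
    hX.rankLift n r h (rankProj k q n r x) = hX.lift n n x := by
  simp [IsQuantumMatrix.rankLift, rankProj]

end QMatLift

section RankWeyl

variable {k K : Type} [Field k] [CommRing K] [Algebra k K] {q : k} {m : ℕ}

/-- The additive character `z ↦ q ^ z` of `ZMod m`. -/
noncomputable def rootChar [NeZero m] (hq : q ^ m = 1) : AddChar (ZMod m) k := AddChar.zmodChar m hq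

theorem rootChar_intCast [NeZero m] (hq : q ^ m = 1) (z : ℤ) :
    rootChar hq (z : ZMod m) = q ^ z := by
  have h1 : rootChar hq ((1 : ℕ) : ZMod m) = q := by
    rw [rootChar, AddChar.zmodChar_apply', pow_one]
  rw [← zsmul_one, AddChar.map_zsmul_eq_zpow, ← Nat.cast_one, h1]

variable (n r : ℕ) [NeZero m] (hq : q ^ m = 1) (y : (RankIdx n r → ℤ) → K)

/-- The Weyl operators on pairs of arrays. -/
noncomputable def rankOp (γ : RankIdx n r → ℤ) : Module.End K ((RankIdx n r → ZMod m) → K) :=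
  weylOp (rankOmega n r) (rootChar hq) y γ

variable {n r y}

theorem isTwistedFamily_rankOp (hy0 : y 0 = 1) (hy : ∀ γ δ, y (γ + δ) = y γ * y δ) :
    IsTwistedFamily (k := k) (rankOp n r hq y)
      (fun γ δ => rootChar hq (halfForm (rankOmega n r) m (redMod m γ) (redMod m δ))) :=
  isTwistedFamily_weylOp (rankOmega_swap n r) _ _ hy0 hy

theorem rankOp_cocycle_neg (hodd : Odd m) (γ : RankIdx n r → ℤ) :
    rootChar hq (halfForm (rankOmega n r) m (redMod m γ) (redMod m (-γ))) = 1 := by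
  rw [map_neg, map_neg, halfForm_self hodd (rankOmega_swap n r), neg_zero, AddChar.map_zero_eq_one]

theorem rankOp_mul_comm (hodd : Odd m) (hy0 : y 0 = 1) (hy : ∀ γ δ, y (γ + δ) = y γ * y δ)
    (γ δ : RankIdx n r → ℤ) : rankOp n r hq y γ * rankOp n r hq y δ =
      rootChar hq (gramForm (rankOmega n r) m (redMod m γ) (redMod m δ)) •
        (rankOp n r hq y δ * rankOp n r hq y γ) := by
  have hT := isTwistedFamily_rankOp hq hy0 hy
  rw [hT.mul, hT.mul, smul_smul, add_comm δ γ, ← AddChar.map_add_eq_mul]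
  congr 2
  rw [halfForm_swap (rankOmega_swap n r) (redMod m γ) (redMod m δ), ← halfForm_add_self hodd]
  ring

theorem isTorusFamily_rankOp (hodd : Odd m) (hy0 : y 0 = 1)
    (hy : ∀ γ δ, y (γ + δ) = y γ * y δ) : IsTorusFamily q (rankOp n r hq y) := by
  intro s t a b
  rw [rankOp_mul_comm hq hodd hy0 hy, gramForm_single, rootChar_intCast]

end RankWeyl

section Faithful

variable {k : Type} [Field k] {q : k} {m n r : ℕ} [NeZero m] (hq : q ^ m = 1)

/-- The multiplicative map into the group algebra of the lattice. -/
noncomputable def latticeMonomial (k : Type) [Field k] {S : Type} (γ : S → ℤ) :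
    AddMonoidAlgebra k (S → ℤ) := AddMonoidAlgebra.single γ 1

theorem latticeMonomial_zero {S : Type} : latticeMonomial k (0 : S → ℤ) = 1 := rfl

theorem latticeMonomial_add {S : Type} (γ δ : S → ℤ) :
    latticeMonomial k (γ + δ) = latticeMonomial k γ * latticeMonomial k δ := by
  simp [latticeMonomial, AddMonoidAlgebra.single_mul_single]

/-- Evaluation of operators at a vector. -/
def evalAt (k : Type) [Field k] {K F : Type} [CommRing K] [Algebra k K] [AddCommGroup F]
    [Module K F] [Module k F] [IsScalarTower k K F] (f : F) : Module.End K F →ₗ[k] F where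
  toFun M := M f
  map_add' _ _ := rfl
  map_smul' _ _ := rfl

theorem exists_coeff_functional (C : Set (RankIdx n r → ZMod m)) (h0 : 0 ∈ C)
    (hodd : Odd m) (γ : RankIdx n r → ℤ) :
    ∃ ψ : ((RankIdx n r → ZMod m) → AddMonoidAlgebra k (RankIdx n r → ℤ)) →ₗ[k] k,
      ψ (evalAt k (C.indicator 1) (rankOp n r hq (latticeMonomial k) γ)) = 1 ∧
      ∀ δ, δ ≠ γ → ψ (evalAt k (C.indicator 1) (rankOp n r hq (latticeMonomial k) δ)) = 0 := by
  classical
  refine ⟨⟨⟨fun f => (f (redMod m γ)).coeff γ, fun f g => ?_⟩, fun a f => ?_⟩, ?_, ?_⟩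
  · simp
  · simp
  · change AddMonoidAlgebra.coeff (weylOp _ _ _ _ _ _) γ = 1
    rw [weylOp_apply, halfForm_self hodd (rankOmega_swap n r), sub_self,
      Set.indicator_of_mem h0]
    simp [latticeMonomial]
  · intro δ hδ
    change AddMonoidAlgebra.coeff (weylOp _ _ _ _ _ _) γ = 0
    rw [weylOp_apply, ← Algebra.smul_def, smul_mul_assoc, AddMonoidAlgebra.coeff_smul_apply]
    by_cases hC : redMod m γ - redMod m δ ∈ C
    · rw [Set.indicator_of_mem hC]
      simp [latticeMonomial, hδ]
    · rw [Set.indicator_of_notMem hC]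
      simp

end Faithful

/-! ### Growth diagrams -/

section Growth

/-- The growth diagram of a matrix of natural numbers. -/
def growth (a : ℕ → ℕ → ℕ) : ℕ → ℕ → ℕ → ℕ
  | 0, _, _ => 0
  | _ + 1, 0, _ => 0
  | i + 1, j + 1, 0 => max (growth a i (j + 1) 0) (growth a (i + 1) j 0) + a i j
  | i + 1, j + 1, l + 1 => max (growth a i (j + 1) (l + 1)) (growth a (i + 1) j (l + 1)) +
      min (growth a i (j + 1) l) (growth a (i + 1) j l) - growth a i j l
termination_by i j => (i, j)

/-- Gelfand–Tsetlin patterns. -/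
structure IsGTPattern (P : ℕ → ℕ → ℕ) : Prop where
  zero : ∀ l, P 0 l = 0
  le_succ : ∀ i l, P i l ≤ P (i + 1) l
  succ_le : ∀ i l, P (i + 1) (l + 1) ≤ P i l

variable (a : ℕ → ℕ → ℕ)

theorem growth_zero_left (j l : ℕ) : growth a 0 j l = 0 := by rw [growth]

theorem growth_zero_right (i l : ℕ) : growth a i 0 l = 0 := by cases i <;> rw [growth]

theorem growth_interlace (i j l : ℕ) :
    (growth a i j l ≤ growth a (i + 1) j l ∧ growth a (i + 1) j (l + 1) ≤ growth a i j l) ∧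
      (growth a i j l ≤ growth a i (j + 1) l ∧ growth a i (j + 1) (l + 1) ≤ growth a i j l) := by
  have step : ∀ i, (∀ j l, growth a i j l ≤ growth a i (j + 1) l ∧
      growth a i (j + 1) (l + 1) ≤ growth a i j l) → ∀ j,
      (∀ l, growth a i j l ≤ growth a (i + 1) j l ∧
        growth a (i + 1) j (l + 1) ≤ growth a i j l) ∧
      (∀ l, growth a (i + 1) j l ≤ growth a (i + 1) (j + 1) l ∧
        growth a (i + 1) (j + 1) (l + 1) ≤ growth a (i + 1) j l) := by
    intro i hi j
    have sq : ∀ j, (∀ l, growth a i j l ≤ growth a (i + 1) j l ∧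
        growth a (i + 1) j (l + 1) ≤ growth a i j l) →
        (∀ l, growth a i (j + 1) l ≤ growth a (i + 1) (j + 1) l ∧
          growth a (i + 1) (j + 1) (l + 1) ≤ growth a i (j + 1) l) ∧
        (∀ l, growth a (i + 1) j l ≤ growth a (i + 1) (j + 1) l ∧
          growth a (i + 1) (j + 1) (l + 1) ≤ growth a (i + 1) j l) := by
      intro j hj
      refine ⟨fun l => ?_, fun l => ?_⟩ <;>
      · have h1 := hi j l
        have h2 := hj l
        rw [growth.eq_4]
        cases l with
        | zero => rw [growth.eq_3]; omega
        | succ l =>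
          have h3 := hi j l
          have h4 := hj l
          rw [growth.eq_4]; omega
    induction j with
    | zero => exact ⟨fun l => by simp [growth_zero_right],
        (sq 0 fun l => by simp [growth_zero_right]).2⟩
    | succ j ih => exact ⟨(sq j ih.1).1, (sq (j + 1) (sq j ih.1).1).2⟩
  have main : ∀ i, ∀ j l, growth a i j l ≤ growth a i (j + 1) l ∧
      growth a i (j + 1) (l + 1) ≤ growth a i j l := by
    intro i
    induction i with
    | zero => intro j l; simp [growth_zero_left]
    | succ i ih => exact fun j => (step i ih j).2
  exact ⟨(step i (main i) j).1 l, main i j l⟩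

theorem isGTPattern_growth_left (n : ℕ) : IsGTPattern (fun i => growth a i n) where
  zero l := growth_zero_left a n l
  le_succ i l := (growth_interlace a i n l).1.1
  succ_le i l := (growth_interlace a i n l).1.2

theorem isGTPattern_growth_right (n : ℕ) : IsGTPattern (fun j => growth a n j) where
  zero l := growth_zero_right a n l
  le_succ j l := (growth_interlace a n j l).2.1
  succ_le j l := (growth_interlace a n j l).2.2

theorem IsGTPattern.eq_zero {P : ℕ → ℕ → ℕ} (h : IsGTPattern P) {i l : ℕ} (hl : i ≤ l) :
    P i l = 0 := by
  induction i generalizing l with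
  | zero => exact h.zero l
  | succ i ih =>
    obtain ⟨l, rfl⟩ : ∃ l', l = l' + 1 := ⟨l - 1, by omega⟩
    have := h.succ_le i l
    rw [ih (by omega)] at this
    omega

theorem IsGTPattern.mono {P : ℕ → ℕ → ℕ} (h : IsGTPattern P) {i i' : ℕ} (hi : i ≤ i') (l : ℕ) :
    P i l ≤ P i' l :=
  monotone_nat_of_le_succ (f := fun i => P i l) (fun i => h.le_succ i l) hi

theorem IsGTPattern.anti {P : ℕ → ℕ → ℕ} (h : IsGTPattern P) (i : ℕ) {l l' : ℕ} (hl : l ≤ l') :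
    P i l' ≤ P i l :=
  antitone_nat_of_succ_le (f := fun l => P i l)
    (fun l => (h.le_succ i (l + 1)).trans (h.succ_le i l)) hl

theorem sum_growth (n i j : ℕ) (hi : i ≤ n) (hj : j ≤ n) :
    ∑ l ∈ Finset.range (n + 1), growth a i j l =
      ∑ i' ∈ Finset.range i, ∑ j' ∈ Finset.range j, a i' j' := by
  induction i generalizing j with
  | zero => simp [growth_zero_left]
  | succ i ihi =>
    induction j with
    | zero => simp [growth_zero_right]
    | succ j ihj =>
      have hi1 := ihi (j + 1) (by omega) hj
      have hi2 := ihi j (by omega) (by omega)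
      have hi3 := ihj (by omega)
      have z1 : growth a i (j + 1) n = 0 := (isGTPattern_growth_left a (j + 1)).eq_zero (by omega)
      have z2 : growth a (i + 1) j n = 0 := (isGTPattern_growth_right a (i + 1)).eq_zero (by omega)
      have z3 : growth a i j n = 0 := (isGTPattern_growth_left a j).eq_zero (by omega)
      have e : ∑ l ∈ Finset.range (n + 1), growth a (i + 1) (j + 1) l +
          ∑ l ∈ Finset.range (n + 1), growth a i j l = a i j +
          (∑ l ∈ Finset.range (n + 1), growth a i (j + 1) l +
            ∑ l ∈ Finset.range (n + 1), growth a (i + 1) j l) := by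
        rw [Finset.sum_range_succ', growth.eq_3, Finset.sum_range_succ (growth a i j), z3]
        have e2 : ∑ l ∈ Finset.range n, growth a (i + 1) (j + 1) (l + 1) +
            ∑ l ∈ Finset.range n, growth a i j l =
            ∑ l ∈ Finset.range n,
              max (growth a i (j + 1) (l + 1)) (growth a (i + 1) j (l + 1)) +
            ∑ l ∈ Finset.range n, min (growth a i (j + 1) l) (growth a (i + 1) j l) := by
          rw [← Finset.sum_add_distrib, ← Finset.sum_add_distrib]
          refine Finset.sum_congr rfl fun l _ => ?_
          rw [growth.eq_4]
          have h1 := growth_interlace a i j l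
          omega
        have e3 : ∑ l ∈ Finset.range n,
              max (growth a i (j + 1) (l + 1)) (growth a (i + 1) j (l + 1)) +
              max (growth a i (j + 1) 0) (growth a (i + 1) j 0) =
            ∑ l ∈ Finset.range n, max (growth a i (j + 1) l) (growth a (i + 1) j l) := by
          rw [← Finset.sum_range_succ' (fun l => max (growth a i (j + 1) l) (growth a (i + 1) j l)),
            Finset.sum_range_succ, z1, z2]
          rfl
        have e4 : ∑ l ∈ Finset.range n, max (growth a i (j + 1) l) (growth a (i + 1) j l) +
            ∑ l ∈ Finset.range n, min (growth a i (j + 1) l) (growth a (i + 1) j l) =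
            ∑ l ∈ Finset.range n, growth a i (j + 1) l +
              ∑ l ∈ Finset.range n, growth a (i + 1) j l := by
          rw [← Finset.sum_add_distrib, ← Finset.sum_add_distrib]
          exact Finset.sum_congr rfl fun l _ => max_add_min _ _
        rw [Finset.sum_range_succ (growth a i (j + 1)), Finset.sum_range_succ (growth a (i + 1) j),
          z1, z2]
        omega
      rw [hi1, hi2, hi3] at e
      rw [Finset.sum_range_succ _ i] at e ⊢
      rw [Finset.sum_range_succ _ i, Finset.sum_range_succ (a i)] at *
      simp only [Finset.sum_range_succ _ j, Finset.sum_add_distrib] at e ⊢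
      omega

theorem growth_determines {a a' : ℕ → ℕ → ℕ} {n : ℕ}
    (hP : ∀ i ≤ n, ∀ l, growth a i n l = growth a' i n l)
    (hQ : ∀ j ≤ n, ∀ l, growth a n j l = growth a' n j l) :
    ∀ i < n, ∀ j < n, a i j = a' i j := by
  have key : ∀ d, ∀ i ≤ n, ∀ j ≤ n, n - i + (n - j) ≤ d →
      ∀ l, growth a i j l = growth a' i j l := by
    intro d
    induction d with
    | zero =>
      intro i hi j hj hd l
      obtain rfl : j = n := by omega
      exact hP i hi l
    | succ d ih =>
      intro i hi j hj hd l
      rcases hi.lt_or_eq with hi' | rfl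
      · rcases hj.lt_or_eq with hj' | rfl
        · have h1 := ih (i + 1) hi' (j + 1) hj' (by omega) (l + 1)
          have h2 := ih i hi (j + 1) hj' (by omega)
          have h3 := ih (i + 1) hi' j hj (by omega)
          rw [growth.eq_4, growth.eq_4, h2, h3, h2, h3] at h1
          have g1 := growth_interlace a i j l
          have g2 := growth_interlace a' i j l
          rw [h2, h3] at g1
          omega
        · exact hP i hi l
      · exact hQ j hj l
  intro i hi j hj
  have h1 := key _ (i + 1) hi (j + 1) hj le_rfl 0
  rw [growth.eq_3, growth.eq_3, key _ i hi.le (j + 1) hj le_rfl, key _ (i + 1) hi j hj.le le_rfl]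
    at h1
  omega

end Growth

section GTRows

/-- The length of column `b` of the shape of a pattern. -/
def gtLen (P : ℕ → ℕ → ℕ) (n b : ℕ) : ℕ := ((Finset.range n).filter fun a => b < P n a).card

/-- The entry at position `(a, b)` of the tableau of a pattern. -/
def gtEntry (P : ℕ → ℕ → ℕ) (n b a : ℕ) : ℕ :=
  ((Finset.range n).filter fun i => P (i + 1) a ≤ b).card

theorem card_filter_range_of_initial {p : ℕ → Prop} [DecidablePred p] {n : ℕ}
    (h : ∀ i j, i ≤ j → p j → p i) {i : ℕ} (hi : i < n) :
    i < ((Finset.range n).filter p).card ↔ p i := by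
  constructor
  · intro hlt
    by_contra hp
    have : (Finset.range n).filter p ⊆ Finset.range i := by
      intro j hj
      rw [Finset.mem_filter] at hj
      rw [Finset.mem_range]
      by_contra! hle
      exact hp (h i j hle hj.2)
    have := Finset.card_le_card this
    rw [Finset.card_range] at this
    omega
  · intro hp
    have : Finset.range (i + 1) ⊆ (Finset.range n).filter p := by
      intro j hj
      rw [Finset.mem_range] at hj
      rw [Finset.mem_filter, Finset.mem_range]
      exact ⟨by omega, h j i (by omega) hp⟩
    have := Finset.card_le_card this
    rw [Finset.card_range] at this
    omega

variable {P : ℕ → ℕ → ℕ} {n : ℕ}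

theorem IsGTPattern.lt_gtLen_iff (h : IsGTPattern P) (b a : ℕ) : a < gtLen P n b ↔ b < P n a := by
  by_cases ha : a < n
  · exact card_filter_range_of_initial (fun i j hij hj => lt_of_lt_of_le hj (h.anti n hij)) ha
  · rw [h.eq_zero (not_lt.mp ha)]
    have : gtLen P n b ≤ n := by
      simpa [gtLen] using Finset.card_filter_le (Finset.range n) fun a => b < P n a
    omega

theorem IsGTPattern.lt_gtEntry_iff (h : IsGTPattern P) (b a : ℕ) {i : ℕ} (hi : i < n) :
    i < gtEntry P n b a ↔ P (i + 1) a ≤ b :=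
  card_filter_range_of_initial (fun i j hij hj => (h.mono (by omega) a).trans hj) hi

theorem IsGTPattern.gtEntry_lt (h : IsGTPattern P) {b a : ℕ} (hb : b < P n a) :
    gtEntry P n b a < n := by
  have hn : n ≠ 0 := by
    rintro rfl
    rw [h.zero] at hb
    omega
  have h1 := (h.lt_gtEntry_iff b a (n := n) (i := n - 1) (by omega)).not
  rw [show n - 1 + 1 = n by omega] at h1
  omega

theorem IsGTPattern.gtEntry_eq_iff (h : IsGTPattern P) {b a i : ℕ} (hi : i < n) :
    (b < P n a ∧ gtEntry P n b a = i) ↔ P i a ≤ b ∧ b < P (i + 1) a := by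
  have h1 := h.lt_gtEntry_iff b a hi
  have h2 : i - 1 < gtEntry P n b a ↔ P (i - 1 + 1) a ≤ b := h.lt_gtEntry_iff b a (by omega)
  have hm := h.mono (show i + 1 ≤ n from hi) a
  rcases Nat.eq_zero_or_pos i with rfl | hi0
  · have := h.zero a
    omega
  · rw [show i - 1 + 1 = i by omega] at h2
    have h3 := @IsGTPattern.gtEntry_lt P n h b a
    omega

theorem IsGTPattern.gtEntry_lt_succ (h : IsGTPattern P) {b a : ℕ} (hb : b < P n (a + 1)) :
    gtEntry P n b a < gtEntry P n b (a + 1) := by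
  have hb' : b < P n a := lt_of_lt_of_le hb (h.anti n (Nat.le_succ a))
  have hlt := h.gtEntry_lt hb'
  rw [h.lt_gtEntry_iff b (a + 1) hlt]
  refine (h.succ_le _ a).trans ?_
  exact ((h.gtEntry_eq_iff hlt).mp ⟨hb', rfl⟩).1

theorem IsGTPattern.strictMono_gtEntry (h : IsGTPattern P) (b : ℕ) :
    StrictMono fun x : Fin (gtLen P n b) => gtEntry P n b x := by
  intro x y hxy
  have key : ∀ d x : ℕ, x + d + 1 < gtLen P n b →
      gtEntry P n b x < gtEntry P n b (x + d + 1) := by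
    intro d
    induction d with
    | zero => exact fun x hx => h.gtEntry_lt_succ ((h.lt_gtLen_iff b _).mp hx)
    | succ d ih =>
      exact fun x hx => (ih x (by omega)).trans (h.gtEntry_lt_succ ((h.lt_gtLen_iff b _).mp hx))
  have hxy' : (x : ℕ) < y := hxy
  have := key (y - x - 1) x (by omega)
  rwa [show (x : ℕ) + (y - x - 1) + 1 = y by omega] at this

/-- The total leading exponent of a tableau recovers the pattern. -/
theorem IsGTPattern.sum_sideVec (h : IsGTPattern P) {r : ℕ} (β β' : Bool) (i : Fin n) (a : Fin r) :
    (∑ b : Fin (P n 0), ∑ x : Fin (gtLen P n b), sideVec n r β (gtEntry P n b x) x) (β', i, a) =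
      if β' = β then (P (i + 1) a : ℤ) - P i a else 0 := by
  simp only [Finset.sum_apply, sideVec]
  by_cases hβ : β' = β
  · subst hβ
    simp only [true_and, if_true]
    have inner : ∀ b : ℕ, (∑ x : Fin (gtLen P n b),
        if (i : ℕ) = gtEntry P n b x ∧ (a : ℕ) = x then (1 : ℤ) else 0) =
        if P i a ≤ b ∧ b < P (i + 1) a then 1 else 0 := by
      intro b
      simp only [← h.gtEntry_eq_iff i.2]
      simp only [← h.lt_gtLen_iff (n := n)]
      rw [Finset.sum_boole]
      by_cases ha : (a : ℕ) < gtLen P n b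
      · by_cases he : gtEntry P n b a = i
        · rw [if_pos ⟨ha, he⟩]
          have : (Finset.univ.filter fun x : Fin (gtLen P n b) =>
              (i : ℕ) = gtEntry P n b x ∧ (a : ℕ) = x) = {⟨a, ha⟩} := by
            ext x
            simp only [Finset.mem_filter, Finset.mem_univ, true_and, Finset.mem_singleton,
              Fin.ext_iff]
            constructor
            · exact fun hx => hx.2.symm
            · intro hx; rw [hx]; exact ⟨he.symm, rfl⟩
          rw [this]; simp
        · rw [if_neg (fun h => he h.2), Finset.filter_false_of_mem]
          · simp
          · rintro x - ⟨h1, h2⟩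
            rw [← h2] at h1
            exact he h1.symm
      · rw [if_neg (fun h => ha h.1), Finset.filter_false_of_mem]
        · simp
        · rintro x - ⟨h1, h2⟩
          exact ha (h2 ▸ x.2)
    rw [Finset.sum_congr rfl fun (b : Fin (P n 0)) _ => inner b,
      Fin.sum_univ_eq_sum_range (fun b => if P i a ≤ b ∧ b < P (i + 1) a then (1 : ℤ) else 0),
      Finset.sum_boole]
    have : (Finset.range (P n 0)).filter (fun b => P i a ≤ b ∧ b < P (i + 1) a) =
        Finset.Ico (P i a) (P (i + 1) a) := by
      ext b
      simp only [Finset.mem_filter, Finset.mem_range, Finset.mem_Ico, and_iff_right_iff_imp]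
      intro hb
      have h1 := h.mono (show (i : ℕ) + 1 ≤ n from i.2) a
      have h2 := h.anti n (Nat.zero_le (a : ℕ))
      omega
    rw [this, Nat.card_Ico, Nat.cast_sub (h.le_succ _ _)]
  · simp [hβ]

theorem IsGTPattern.sum_gtLen (h : IsGTPattern P) :
    ∑ b : Fin (P n 0), gtLen P n b = ∑ l ∈ Finset.range n, P n l := by
  simp only [gtLen, Finset.card_filter]
  rw [Fin.sum_univ_eq_sum_range (fun b => ∑ a ∈ Finset.range n, if b < P n a then 1 else 0),
    Finset.sum_comm]
  refine Finset.sum_congr rfl fun l _ => ?_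
  rw [← Finset.card_filter]
  have : (Finset.range (P n 0)).filter (fun b => b < P n l) = Finset.range (P n l) := by
    ext b
    simp only [Finset.mem_filter, Finset.mem_range, and_iff_right_iff_imp]
    have := h.anti n (Nat.zero_le l)
    omega
  rw [this, Finset.card_range]

end GTRows

section Words

variable {k : Type} [Field k] {q : k} {n r : ℕ}

theorem Zgen_row (i : Fin n) (j l : Fin r) (h : j < l) :
    Zgen k q n r i j * Zgen k q n r i l = q • (Zgen k q n r i l * Zgen k q n r i j) := by
  simpa [Zgen] using RingQuot.mkAlgHom_rel k (QMatRel.row (k := k) (q := q) i j l h)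

theorem Zgen_col (i s : Fin n) (j : Fin r) (h : i < s) :
    Zgen k q n r i j * Zgen k q n r s j = q • (Zgen k q n r s j * Zgen k q n r i j) := by
  simpa [Zgen] using RingQuot.mkAlgHom_rel k (QMatRel.col (k := k) (q := q) i s j h)

theorem Zgen_cross (i s : Fin n) (j l : Fin r) (h1 : i < s) (h2 : l < j) :
    Zgen k q n r i j * Zgen k q n r s l = Zgen k q n r s l * Zgen k q n r i j := by
  simpa [Zgen] using RingQuot.mkAlgHom_rel k (QMatRel.cross (k := k) (q := q) i s j l h1 h2)

theorem Zgen_diag (i s : Fin n) (j l : Fin r) (h1 : i < s) (h2 : j < l) :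
    Zgen k q n r i j * Zgen k q n r s l = Zgen k q n r s l * Zgen k q n r i j +
      (q - q⁻¹) • (Zgen k q n r i l * Zgen k q n r s j) := by
  simpa [Zgen] using RingQuot.mkAlgHom_rel k (QMatRel.diag (k := k) (q := q) i s j l h1 h2)

/-- The monomial of a word in the generators. -/
noncomputable def wordProd (q : k) (l : List (Fin n × Fin n)) : QMat k q n n :=
  (l.map fun p => Zgen k q n n p.1 p.2).prod

theorem wordProd_append (l l' : List (Fin n × Fin n)) :
    wordProd q (l ++ l') = wordProd q l * wordProd q l' := by
  simp [wordProd]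

/-- The row-major code of a position. -/
def posCode (p : Fin n × Fin n) : ℕ := p.1 * n + p.2

theorem posCode_lt_iff (p p' : Fin n × Fin n) :
    posCode p < posCode p' ↔ p.1 < p'.1 ∨ p.1 = p'.1 ∧ p.2 < p'.2 := by
  obtain ⟨⟨i, hi⟩, ⟨j, hj⟩⟩ := p
  obtain ⟨⟨s, hs⟩, ⟨t, ht⟩⟩ := p'
  simp only [posCode, Fin.lt_def, Fin.ext_iff]
  rcases lt_trichotomy i s with h | rfl | h
  · have : (i + 1) * n ≤ s * n := Nat.mul_le_mul_right n h
    rw [add_mul] at this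
    omega
  · omega
  · have : (s + 1) * n ≤ i * n := Nat.mul_le_mul_right n h
    rw [add_mul] at this
    omega

theorem posCode_injective : Function.Injective (posCode : Fin n × Fin n → ℕ) := by
  intro p p' h
  have h1 := (posCode_lt_iff p p').not.mp h.not_lt
  have h2 := (posCode_lt_iff p' p).not.mp h.not_gt
  push Not at h1 h2
  have h3 : p.1 = p'.1 := le_antisymm h2.1 h1.1
  exact Prod.ext h3 (le_antisymm (h2.2 h3.symm) (h1.2 h3))

/-- The termination measure for straightening words. -/
def wordMeasure : List (Fin n × Fin n) → ℕ
  | [] => 0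
  | p :: l => posCode p * (l.length + 1) + wordMeasure l

theorem sorted_or_exists_descent (l : List (Fin n × Fin n)) :
    l.Pairwise (fun p p' => posCode p ≤ posCode p') ∨
      ∃ l₁ p p' l₂, l = l₁ ++ p :: p' :: l₂ ∧ posCode p' < posCode p := by
  induction l with
  | nil => exact Or.inl List.Pairwise.nil
  | cons p l ih =>
    rcases ih with ih | ⟨l₁, x, y, l₂, rfl, hlt⟩
    · cases l with
      | nil => exact Or.inl (List.pairwise_singleton _ _)
      | cons p' l =>
        rcases lt_or_ge (posCode p') (posCode p) with h | h
        · exact Or.inr ⟨[], p, p', l, rfl, h⟩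
        · refine Or.inl (List.pairwise_cons.mpr ⟨fun x hx => ?_, ih⟩)
          rcases List.mem_cons.mp hx with rfl | hx
          · exact h
          · exact h.trans ((List.pairwise_cons.mp ih).1 x hx)
    · exact Or.inr ⟨p :: l₁, x, y, l₂, rfl, hlt⟩

theorem wordMeasure_lt (l₁ l₂ : List (Fin n × Fin n)) {x y u v : Fin n × Fin n}
    (h : posCode u < posCode x) (h2 : posCode u + posCode v = posCode x + posCode y) :
    wordMeasure (l₁ ++ u :: v :: l₂) < wordMeasure (l₁ ++ x :: y :: l₂) := by
  induction l₁ with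
  | nil =>
    simp only [List.nil_append, wordMeasure, List.length_cons]
    have : posCode v = posCode x + posCode y - posCode u := by omega
    obtain ⟨d, hd⟩ : ∃ d, posCode x = posCode u + d + 1 := ⟨posCode x - posCode u - 1, by omega⟩
    have hv : posCode v = posCode y + d + 1 := by omega
    rw [hd, hv]
    nlinarith
  | cons p l ih =>
    simp only [List.cons_append, wordMeasure, List.length_append, List.length_cons] at ih ⊢
    omega

/-- The span of words of length `D`. -/
def wordSpan (q : k) (n D : ℕ) : Submodule k (QMat k q n n) :=
  Submodule.span k (wordProd q '' {l | l.length = D})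

theorem wordProd_mem_wordSpan (l : List (Fin n × Fin n)) : wordProd q l ∈ wordSpan q n l.length :=
  Submodule.subset_span ⟨l, rfl, rfl⟩

theorem mul_mem_wordSpan {D E : ℕ} {x y : QMat k q n n} (hx : x ∈ wordSpan q n D)
    (hy : y ∈ wordSpan q n E) : x * y ∈ wordSpan q n (D + E) := by
  unfold wordSpan at hx hy
  induction hx using Submodule.span_induction with
  | mem x hx =>
    obtain ⟨l, hl, rfl⟩ := hx
    induction hy using Submodule.span_induction with
    | mem y hy =>
      obtain ⟨l', hl', rfl⟩ := hy
      rw [← wordProd_append]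
      exact Submodule.subset_span ⟨_, by
        rw [Set.mem_ofPred_eq] at *; rw [List.length_append, hl, hl'], rfl⟩
    | zero => simp
    | add x y _ _ hx hy => rw [mul_add]; exact Submodule.add_mem _ hx hy
    | smul a x _ hx => rw [mul_smul_comm]; exact Submodule.smul_mem _ _ hx
  | zero => simp
  | add x y _ _ hx hy => rw [add_mul]; exact Submodule.add_mem _ hx hy
  | smul a x _ hx => rw [smul_mul_assoc]; exact Submodule.smul_mem _ _ hx

theorem exists_mem_wordSpan_sum (x : QMat k q n n) :
    x ∈ ⨆ D, wordSpan q n D := by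
  obtain ⟨z, rfl⟩ := RingQuot.mkAlgHom_surjective k (QMatRel k q n n) x
  induction z using FreeAlgebra.induction with
  | grade0 a =>
    rw [AlgHom.commutes, Algebra.algebraMap_eq_smul_one]
    exact Submodule.smul_mem _ _ (Submodule.mem_iSup_of_mem 0 (wordProd_mem_wordSpan []))
  | grade1 p =>
    have := wordProd_mem_wordSpan (q := q) [p]
    simp only [wordProd, List.map_cons, List.map_nil, List.prod_singleton] at this
    exact Submodule.mem_iSup_of_mem _ this
  | add x y hx hy => rw [map_add]; exact Submodule.add_mem _ hx hy
  | mul x y hx hy =>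
    rw [map_mul]
    generalize RingQuot.mkAlgHom k (QMatRel k q n n) x = x at hx ⊢
    generalize RingQuot.mkAlgHom k (QMatRel k q n n) y = y at hy ⊢
    induction hx using Submodule.iSup_induction' with
    | mem D x hx =>
      induction hy using Submodule.iSup_induction' with
      | mem E y hy => exact Submodule.mem_iSup_of_mem (D + E) (mul_mem_wordSpan hx hy)
      | zero => simp
      | add x y _ _ hx hy => rw [mul_add]; exact Submodule.add_mem _ hx hy
    | zero => simp
    | add x y _ _ hx hy => rw [add_mul]; exact Submodule.add_mem _ hx hy

theorem Zgen_mul_of_descent (hq : q ≠ 0) {x y : Fin n × Fin n} (h : posCode y < posCode x) :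
    ∃ c c' : k, ∃ u v : Fin n × Fin n, posCode u < posCode x ∧
      posCode u + posCode v = posCode x + posCode y ∧
      Zgen k q n n x.1 x.2 * Zgen k q n n y.1 y.2 =
        c • (Zgen k q n n y.1 y.2 * Zgen k q n n x.1 x.2) +
          c' • (Zgen k q n n u.1 u.2 * Zgen k q n n v.1 v.2) := by
  have h' := h
  rw [posCode_lt_iff] at h'
  obtain ⟨i, j⟩ := x
  obtain ⟨s, t⟩ := y
  dsimp only at h' ⊢
  rcases h' with h' | ⟨rfl, h'⟩
  · rcases lt_trichotomy j t with hjt | rfl | hjt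
    · exact ⟨1, 0, (s, t), (i, j), h, add_comm _ _, by simp [Zgen_cross s i t j h' hjt]⟩
    · refine ⟨q⁻¹, 0, (s, j), (i, j), h, add_comm _ _, ?_⟩
      rw [Zgen_col s i j h']
      simp [smul_smul, hq]
    · refine ⟨1, -(q - q⁻¹), (s, j), (i, t), ?_, ?_, ?_⟩
      · rw [posCode_lt_iff]; exact Or.inl h'
      · simp only [posCode]; omega
      · rw [Zgen_diag s i t j h' hjt]
        dsimp only
        module
  · refine ⟨q⁻¹, 0, (s, t), (s, j), h, add_comm _ _, ?_⟩
    rw [Zgen_row s t j h']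
    simp [smul_smul, hq]

theorem wordProd_mem_span_sorted (hq : q ≠ 0) (l : List (Fin n × Fin n)) :
    wordProd q l ∈ Submodule.span k (wordProd q ''
      {l' | l'.length = l.length ∧ l'.Pairwise (fun p p' => posCode p ≤ posCode p')}) := by
  induction hN : wordMeasure l using Nat.strong_induction_on generalizing l with
  | _ N ih =>
    subst hN
    rcases sorted_or_exists_descent l with h | ⟨l₁, x, y, l₂, rfl, hlt⟩
    · exact Submodule.subset_span ⟨l, ⟨rfl, h⟩, rfl⟩
    · obtain ⟨c, c', u, v, h1, h2, h3⟩ := Zgen_mul_of_descent (q := q) hq hlt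
      have e : wordProd q (l₁ ++ x :: y :: l₂) = c • wordProd q (l₁ ++ y :: x :: l₂) +
          c' • wordProd q (l₁ ++ u :: v :: l₂) := by
        simp only [wordProd, List.map_append, List.map_cons, List.prod_append, List.prod_cons]
        rw [← mul_assoc (Zgen k q n n x.1 x.2), h3]
        simp only [add_mul, mul_add, smul_mul_assoc, mul_smul_comm, mul_assoc]
      have i1 := ih _ (wordMeasure_lt l₁ l₂ hlt (add_comm _ _)) (l₁ ++ y :: x :: l₂) rfl
      have i2 := ih _ (wordMeasure_lt l₁ l₂ h1 h2) (l₁ ++ u :: v :: l₂) rfl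
      have len : ∀ a b a' b' : Fin n × Fin n,
          (l₁ ++ a :: b :: l₂).length = (l₁ ++ a' :: b' :: l₂).length := by simp
      rw [len y x x y] at i1
      rw [len u v x y] at i2
      rw [e]
      exact Submodule.add_mem _ (Submodule.smul_mem _ _ i1) (Submodule.smul_mem _ _ i2)

/-- The words of length `D` span a space of dimension at most the number of multisets. -/
theorem finrank_wordSpan_le (hq : q ≠ 0) (n D : ℕ) :
    Module.Finite k (wordSpan q n D) ∧
      Module.finrank k (wordSpan q n D) ≤ Fintype.card (Sym (Fin n × Fin n) D) := by
  classical
  let w : Sym (Fin n × Fin n) D → QMat k q n n := fun s =>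
    if h : ∃ l : List (Fin n × Fin n), (l : Multiset (Fin n × Fin n)) = s.1 ∧
      l.Pairwise (fun p p' => posCode p ≤ posCode p') then wordProd q h.choose else 0
  have hle : wordSpan q n D ≤ Submodule.span k (Set.range w) := by
    refine Submodule.span_le.mpr ?_
    rintro _ ⟨l, hl, rfl⟩
    refine Submodule.span_mono ?_ (wordProd_mem_span_sorted hq l)
    rintro _ ⟨l', ⟨hl', hs⟩, rfl⟩
    refine ⟨⟨l', by rw [Multiset.coe_card, hl']; exact hl⟩, ?_⟩
    have hex : ∃ l : List (Fin n × Fin n), (l : Multiset (Fin n × Fin n)) = l' ∧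
      l.Pairwise (fun p p' => posCode p ≤ posCode p') := ⟨l', rfl, hs⟩
    have : hex.choose = l' := by
      refine List.Perm.eq_of_pairwise ?_ hex.choose_spec.2 hs
        (Multiset.coe_eq_coe.mp hex.choose_spec.1)
      exact fun a b _ _ h1 h2 => posCode_injective (le_antisymm h1 h2)
    simp only [w]
    rw [dif_pos hex, this]
  have hfin : Module.Finite k (Submodule.span k (Set.range w)) :=
    Module.Finite.span_of_finite k (Set.finite_range w)
  have hfin2 : Module.Finite k (wordSpan q n D) :=
    Submodule.finiteDimensional_of_le hle
  exact ⟨hfin2, (Submodule.finrank_mono hle).trans (finrank_range_le_card w)⟩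

end Words

section Bitableau

variable {k : Type} [Field k] {q : k} {n : ℕ}

/-- The matrix of multiplicities of a multiset of positions. -/
def countMat (s : Multiset (Fin n × Fin n)) (i j : ℕ) : ℕ :=
  if h : i < n ∧ j < n then s.count (⟨i, h.1⟩, ⟨j, h.2⟩) else 0

theorem countMat_apply (s : Multiset (Fin n × Fin n)) (i j : Fin n) :
    countMat s i j = s.count (i, j) := by
  simp [countMat]

theorem sum_countMat (s : Multiset (Fin n × Fin n)) :
    ∑ i ∈ Finset.range n, ∑ j ∈ Finset.range n, countMat s i j = Multiset.card s := by
  rw [← Fin.sum_univ_eq_sum_range (fun i => ∑ j ∈ Finset.range n, countMat s i j)]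
  simp_rw [← Fin.sum_univ_eq_sum_range (fun j => countMat s _ j), countMat_apply]
  rw [← Fintype.sum_prod_type (fun p : Fin n × Fin n => s.count p)]
  exact Multiset.sum_count_eq_card fun a _ => Finset.mem_univ a

/-- The pattern of the row tableau of a multiset of positions. -/
def rowPat (s : Multiset (Fin n × Fin n)) (i : ℕ) : ℕ → ℕ := growth (countMat s) i n

/-- The pattern of the column tableau of a multiset of positions. -/
def colPat (s : Multiset (Fin n × Fin n)) (j : ℕ) : ℕ → ℕ := growth (countMat s) n j

theorem isGTPattern_rowPat (s : Multiset (Fin n × Fin n)) : IsGTPattern (rowPat s) :=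
  isGTPattern_growth_left _ n

theorem isGTPattern_colPat (s : Multiset (Fin n × Fin n)) : IsGTPattern (colPat s) :=
  isGTPattern_growth_right _ n

/-- The length of the `b`-th column of the bitableau. -/
def bitLen (s : Multiset (Fin n × Fin n)) (b : ℕ) : ℕ := gtLen (rowPat s) n b

/-- The row set of the `b`-th minor of the bitableau. -/
def bitRow (s : Multiset (Fin n × Fin n)) (b : ℕ) (x : Fin (bitLen s b)) : Fin n :=
  ⟨gtEntry (rowPat s) n b x,
    (isGTPattern_rowPat s).gtEntry_lt (((isGTPattern_rowPat s).lt_gtLen_iff b x).mp x.2)⟩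

/-- The column set of the `b`-th minor of the bitableau. -/
def bitCol (s : Multiset (Fin n × Fin n)) (b : ℕ) (x : Fin (bitLen s b)) : Fin n :=
  ⟨gtEntry (colPat s) n b x,
    (isGTPattern_colPat s).gtEntry_lt (((isGTPattern_colPat s).lt_gtLen_iff b x).mp x.2)⟩

theorem strictMono_bitRow (s : Multiset (Fin n × Fin n)) (b : ℕ) : StrictMono (bitRow s b) :=
  fun _ _ h => (isGTPattern_rowPat s).strictMono_gtEntry b h

theorem strictMono_bitCol (s : Multiset (Fin n × Fin n)) (b : ℕ) : StrictMono (bitCol s b) :=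
  fun _ _ h => (isGTPattern_colPat s).strictMono_gtEntry b h

/-- The product of quantum minors attached to a multiset of positions. -/
noncomputable def bitableau (q : k) (s : Multiset (Fin n × Fin n)) : QMat k q n n :=
  (List.ofFn fun b : Fin (rowPat s n 0) =>
    qMinor k q n n (bitLen s b) (bitRow s b) (bitCol s b)).prod

theorem sum_bitLen (s : Multiset (Fin n × Fin n)) :
    ∑ b : Fin (rowPat s n 0), bitLen s b = Multiset.card s := by
  have h1 := (isGTPattern_rowPat s).sum_gtLen (n := n)
  have h2 := sum_growth (countMat s) n n n le_rfl le_rfl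
  rw [sum_countMat, Finset.sum_range_succ, (isGTPattern_growth_left (countMat s) n).eq_zero le_rfl,
    add_zero] at h2
  exact h1.trans h2

theorem qMinor_mem_wordSpan (t : ℕ) (ro co : Fin t → Fin n) :
    qMinor k q n n t ro co ∈ wordSpan q n t := by
  refine Submodule.sum_mem _ fun σ _ => Submodule.smul_mem _ _ ?_
  have h := wordProd_mem_wordSpan (q := q) (List.ofFn fun a => (ro a, co (σ a)))
  rw [List.length_ofFn] at h
  simpa [wordProd, List.map_ofFn, Function.comp_def] using h

theorem prod_ofFn_mem_wordSpan {t : ℕ} (f : Fin t → QMat k q n n) (D : Fin t → ℕ)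
    (h : ∀ b, f b ∈ wordSpan q n (D b)) : (List.ofFn f).prod ∈ wordSpan q n (∑ b, D b) := by
  induction t with
  | zero => simpa [wordProd] using wordProd_mem_wordSpan (q := q) ([] : List (Fin n × Fin n))
  | succ t ih =>
    rw [List.ofFn_succ, List.prod_cons, Fin.sum_univ_succ]
    exact mul_mem_wordSpan (h 0) (ih _ _ fun b => h _)

theorem bitableau_mem_wordSpan (s : Multiset (Fin n × Fin n)) :
    bitableau q s ∈ wordSpan q n (Multiset.card s) := by
  rw [← sum_bitLen]
  exact prod_ofFn_mem_wordSpan _ _ fun b => qMinor_mem_wordSpan _ _ _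

/-- The leading exponent of a bitableau. -/
def bitExp (r : ℕ) (s : Multiset (Fin n × Fin n)) : RankIdx n r → ℤ :=
  ∑ b : Fin (rowPat s n 0), (∑ x : Fin (bitLen s b), sideVec n r false (bitRow s b x) x +
    ∑ x : Fin (bitLen s b), sideVec n r true (bitCol s b x) x)

theorem bitExp_apply (r : ℕ) (s : Multiset (Fin n × Fin n)) (β : Bool) (i : Fin n) (a : Fin r) :
    bitExp r s (β, i, a) = bif β then (colPat s (i + 1) a : ℤ) - colPat s i a
      else (rowPat s (i + 1) a : ℤ) - rowPat s i a := by
  rw [bitExp, Finset.sum_add_distrib, Pi.add_apply]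
  have h1 := (isGTPattern_rowPat s).sum_sideVec false β i a
  have h2 := (isGTPattern_colPat s).sum_sideVec true β i a
  refine (congrArg₂ (· + ·) h1 h2).trans ?_
  cases β <;> simp

theorem IsGTPattern.eq_of_diff {P P' : ℕ → ℕ → ℕ} (hP : IsGTPattern P) (hP' : IsGTPattern P')
    {n r : ℕ} (h0 : P n r = 0) (h0' : P' n r = 0)
    (h : ∀ i < n, ∀ a < r, (P (i + 1) a : ℤ) - P i a = P' (i + 1) a - P' i a) :
    ∀ i ≤ n, ∀ a, P i a = P' i a := by
  intro i hi a
  by_cases ha : a < r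
  · induction i with
    | zero => rw [hP.zero, hP'.zero]
    | succ i ih =>
      have h1 := h i hi a ha
      have h2 := ih (by omega)
      omega
  · have h1 := (hP.mono hi a).trans (hP.anti n (not_lt.mp ha))
    have h2 := (hP'.mono hi a).trans (hP'.anti n (not_lt.mp ha))
    omega

theorem bitExp_injOn (r : ℕ) {s s' : Multiset (Fin n × Fin n)} (hs : rowPat s n r = 0)
    (hs' : rowPat s' n r = 0) (h : bitExp r s = bitExp r s') : s = s' := by
  have hrow := (isGTPattern_rowPat s).eq_of_diff (isGTPattern_rowPat s') hs hs'
    fun i hi a ha => by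
      simpa [bitExp_apply] using congrFun h (false, ⟨i, hi⟩, ⟨a, ha⟩)
  have hcol := (isGTPattern_colPat s).eq_of_diff (isGTPattern_colPat s') hs hs'
    fun i hi a ha => by
      simpa [bitExp_apply] using congrFun h (true, ⟨i, hi⟩, ⟨a, ha⟩)
  have key := growth_determines hrow hcol
  ext ⟨i, j⟩
  rw [← countMat_apply, ← countMat_apply]
  exact key i i.2 j j.2

theorem bitLen_le {s : Multiset (Fin n × Fin n)} {r : ℕ} (hs : rowPat s n r = 0) (b : ℕ) :
    bitLen s b ≤ r := by
  by_contra! h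
  have := ((isGTPattern_rowPat s).lt_gtLen_iff b r).mp h
  omega

theorem lt_bitLen_zero {s : Multiset (Fin n × Fin n)} {r : ℕ} (hs : rowPat s n r ≠ 0) :
    r < bitLen s 0 :=
  ((isGTPattern_rowPat s).lt_gtLen_iff 0 r).mpr (Nat.pos_of_ne_zero hs)

variable {R : Type} [Ring R] [Algebra k R] {r : ℕ} {T : (RankIdx n r → ℤ) → R}
  {c : (RankIdx n r → ℤ) → (RankIdx n r → ℤ) → k}

theorem hasLead_bitableau (h : IsTorusFamily q T) (hq : q ≠ 0) (hT : IsTwistedFamily T c)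
    (hc : ∀ γ, c γ (-γ) = 1) {s : Multiset (Fin n × Fin n)} (hs : rowPat s n r = 0) :
    HasLead k T (rankWeight n r) ((h.isQuantumMatrix hq hT hc).lift n n (bitableau q s))
      (bitExp r s) := by
  rw [bitableau, map_list_prod, List.map_ofFn]
  refine HasLead.prod_ofFn hT _ _ fun b => ?_
  rw [Function.comp_apply, IsQuantumMatrix.lift_qMinor]
  exact hasLead_qDetArray h hq hT hc (bitLen_le hs b) _ _ (strictMono_bitRow s b)
    (strictMono_bitCol s b) (fun i => (bitRow s b i).2) (fun i => (bitCol s b i).2)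

end Bitableau

section Straightening

variable {k : Type} [Field k] {q : k} {m n r : ℕ} [NeZero m] (hq : q ^ m = 1)

theorem ne_zero_of_pow_eq_one {q : k} (hq : q ^ m = 1) : q ≠ 0 := by
  rintro rfl
  rw [zero_pow (NeZero.ne m)] at hq
  exact zero_ne_one hq

theorem isQuantumMatrix_rankOp {K : Type} [CommRing K] [Algebra k K] {y : (RankIdx n r → ℤ) → K}
    (hodd : Odd m) (hy0 : y 0 = 1) (hy : ∀ γ δ, y (γ + δ) = y γ * y δ) :
    IsQuantumMatrix q (rankMatrix (rankOp n r hq y)) :=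
  (isTorusFamily_rankOp hq hodd hy0 hy).isQuantumMatrix (ne_zero_of_pow_eq_one hq)
    (isTwistedFamily_rankOp hq hy0 hy) (rankOp_cocycle_neg hq hodd)

theorem isQuantumMatrix_generic (n r : ℕ) (hodd : Odd m) :
    IsQuantumMatrix q (rankMatrix (rankOp n r hq (latticeMonomial k))) :=
  isQuantumMatrix_rankOp hq hodd latticeMonomial_zero latticeMonomial_add

theorem linearIndependent_bitableau_apply (hodd : Odd m) (C : Set (RankIdx n r → ZMod m))
    (h0 : 0 ∈ C) {ι : Type} (s : ι → Multiset (Fin n × Fin n)) (hs : ∀ i, rowPat (s i) n r = 0)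
    (hinj : Function.Injective s) :
    LinearIndependent k fun i => evalAt k (C.indicator 1)
      ((isQuantumMatrix_generic hq n r hodd).lift n n (bitableau q (s i))) := by
  have h1 := exists_coeff_functional (k := k) hq C h0 hodd
  have h2 : ∀ i, HasLead k (rankOp n r hq (latticeMonomial k)) (rankWeight n r)
      ((isQuantumMatrix_generic hq n r hodd).lift n n (bitableau q (s i))) (bitExp r (s i)) :=
    fun i => hasLead_bitableau (isTorusFamily_rankOp hq hodd latticeMonomial_zero latticeMonomial_add)
      (ne_zero_of_pow_eq_one hq) (isTwistedFamily_rankOp hq latticeMonomial_zero latticeMonomial_add)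
      (rankOp_cocycle_neg hq hodd) (hs i)
  have h3 := linearIndependent_of_hasLead (evalAt k (C.indicator 1)) h1 _
    (fun i => bitExp r (s i)) (fun i j h => hinj (bitExp_injOn r (hs i) (hs j) h)) h2
  exact h3

theorem linearIndependent_bitableau (hq : q ^ m = 1) (hodd : Odd m) :
    LinearIndependent k (bitableau q : Multiset (Fin n × Fin n) → QMat k q n n) := by
  have h1 := linearIndependent_bitableau_apply (r := n) (n := n) hq hodd {0} rfl
    id (fun s => (isGTPattern_rowPat s).eq_zero le_rfl) Function.injective_id
  let f := evalAt k (K := AddMonoidAlgebra k (RankIdx n n → ℤ)) (({0} : Set (RankIdx n n → ZMod m)).indicator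
    (1 : (RankIdx n n → ZMod m) → AddMonoidAlgebra k (RankIdx n n → ℤ)))
  let g := ((isQuantumMatrix_generic hq n n hodd).lift n n).toLinearMap
  have h2 : LinearIndependent k (f ∘ g ∘ bitableau q) := h1
  exact LinearIndependent.of_comp g (LinearIndependent.of_comp f h2)

theorem le_span_of_finrank_le_card {V ι : Type} [AddCommGroup V] [Module k V] [Fintype ι]
    {W : Submodule k V} [Module.Finite k W] {v : ι → V} (hv : LinearIndependent k v)
    (hmem : ∀ i, v i ∈ W) (hle : Module.finrank k W ≤ Fintype.card ι) :
    W ≤ Submodule.span k (Set.range v) := by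
  refine (Submodule.eq_of_le_of_finrank_le (Submodule.span_le.mpr ?_) ?_).ge
  · rintro _ ⟨i, rfl⟩
    exact hmem i
  · rwa [finrank_span_eq_card hv]

theorem span_bitableau (hq : q ^ m = 1) (hodd : Odd m) :
    Submodule.span k (Set.range (bitableau q : Multiset (Fin n × Fin n) → QMat k q n n)) = ⊤ := by
  have key : ∀ D, wordSpan q n D ≤
      Submodule.span k (Set.range (bitableau q : Multiset (Fin n × Fin n) → QMat k q n n)) := by
    intro D
    obtain ⟨hfin, hle⟩ := finrank_wordSpan_le (ne_zero_of_pow_eq_one hq) n D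
    refine (le_span_of_finrank_le_card ((linearIndependent_bitableau hq hodd).comp
      (fun s : Sym (Fin n × Fin n) D => s.1) Subtype.val_injective) (fun s => ?_) hle).trans
      (Submodule.span_mono (Set.range_comp_subset_range _ _))
    have := bitableau_mem_wordSpan (q := q) s.1
    rwa [s.2] at this
  rw [eq_top_iff]
  exact fun x _ => iSup_le key (exists_mem_wordSpan_sum x)

end Straightening

section Laplace

/-- The permutation sending the last element to `c` and permuting the others by `τ`. -/
def lastInsert {t : ℕ} (c : Fin (t + 1)) (τ : Equiv.Perm (Fin t)) : Equiv.Perm (Fin (t + 1)) :=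
  (finSuccEquiv' (Fin.last t)).trans ((Equiv.optionCongr τ).trans (finSuccEquiv' c).symm)

variable {t : ℕ} (c : Fin (t + 1)) (τ : Equiv.Perm (Fin t))

theorem lastInsert_last : lastInsert c τ (Fin.last t) = c := by
  simp [lastInsert]

theorem lastInsert_castSucc (x : Fin t) : lastInsert c τ x.castSucc = c.succAbove (τ x) := by
  have : finSuccEquiv' (Fin.last t) x.castSucc = some x := by
    rw [← Fin.succAbove_last_apply, finSuccEquiv'_succAbove]
  simp [lastInsert, this]

theorem lastInsert_bijective :
    Function.Bijective fun p : Fin (t + 1) × Equiv.Perm (Fin t) => lastInsert p.1 p.2 := by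
  rw [Fintype.bijective_iff_injective_and_card]
  constructor
  · rintro ⟨c, τ⟩ ⟨c', τ'⟩ h
    have h1 := congrArg (fun σ => σ (Fin.last t)) h
    simp only [lastInsert_last] at h1
    subst h1
    have h2 : τ = τ' := by
      ext x
      have := congrArg (fun σ => σ x.castSucc) h
      simp only [lastInsert_castSucc] at this
      rw [Fin.succAbove_right_injective this]
    rw [h2]
  · simp [Fintype.card_perm, Nat.factorial_succ]

theorem invCount_lastInsert :
    invCount (lastInsert c τ) = invCount τ + (Finset.univ.filter fun x => c < c.succAbove x).card := by
  classical
  simp only [invCount, Finset.card_filter, Fintype.sum_prod_type, Fin.sum_univ_castSucc,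
    lastInsert_last, lastInsert_castSucc, Finset.sum_add_distrib]
  simp only [Fin.castSucc_lt_castSucc_iff, (Fin.strictMono_succAbove c).lt_iff_lt,
    Fin.castSucc_lt_last, true_and, not_lt_of_gt (Fin.castSucc_lt_last _), false_and, if_false,
    lt_irrefl, Finset.sum_const_zero, add_zero]
  congr 1
  exact Equiv.sum_comp τ fun x => if c < c.succAbove x then 1 else 0

variable {k : Type} [Field k] {q : k} {n : ℕ}

/-- Laplace expansion along the last row. -/
theorem qMinor_succ (ro co : Fin (t + 1) → Fin n) :
    qMinor k q n n (t + 1) ro co = ∑ c, (-q) ^ (Finset.univ.filter fun x => c < c.succAbove x).card •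
      (qMinor k q n n t (ro ∘ Fin.castSucc) (co ∘ c.succAbove) *
        Zgen k q n n (ro (Fin.last t)) (co c)) := by
  rw [qMinor, ← (Equiv.ofBijective _ lastInsert_bijective).sum_comp, Fintype.sum_prod_type]
  refine Finset.sum_congr rfl fun c _ => ?_
  rw [qMinor, Finset.sum_mul, Finset.smul_sum]
  refine Finset.sum_congr rfl fun τ _ => ?_
  rw [Equiv.ofBijective_apply, invCount_lastInsert, smul_mul_assoc, smul_smul, pow_add, mul_comm]
  congr 1
  rw [List.ofFn_succ', List.concat_eq_append, List.prod_append]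
  simp [lastInsert_last, lastInsert_castSucc]

theorem rankProj_qMinor {r t : ℕ} (ht : r < t) (ro co : Fin t → Fin n) (hro : StrictMono ro)
    (hco : StrictMono co) : rankProj k q n r (qMinor k q n n t ro co) = 0 := by
  induction t with
  | zero => omega
  | succ t ih =>
    rcases Nat.lt_or_ge r t with h | h
    · rw [qMinor_succ, map_sum]
      refine Finset.sum_eq_zero fun c _ => ?_
      rw [map_smul, map_mul, ih h _ _ (hro.comp (Fin.strictMono_castSucc))
        (hco.comp (Fin.strictMono_succAbove c)), zero_mul, smul_zero]
    · obtain rfl : r = t := by omega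
      have h := RingQuot.mkAlgHom_rel k (s := minorRel k q n (r + 1))
        (show minorRel k q n (r + 1) (qMinor k q n n (r + 1) ro co) 0 from
          ⟨⟨ro, co, hro, hco, rfl⟩, rfl⟩)
      rw [map_zero] at h
      exact h

theorem rankProj_bitableau {r : ℕ} {s : Multiset (Fin n × Fin n)} (hs : rowPat s n r ≠ 0) :
    rankProj k q n r (bitableau q s) = 0 := by
  have h0 : rowPat s n 0 ≠ 0 := by
    have := (isGTPattern_rowPat s).anti n (Nat.zero_le r)
    omega
  obtain ⟨l, hl⟩ := Nat.exists_eq_succ_of_ne_zero h0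
  have : ∀ l, 0 < l → rankProj k q n r (List.ofFn fun b : Fin l =>
      qMinor k q n n (bitLen s b) (bitRow s b) (bitCol s b)).prod = 0 := by
    intro l hl
    obtain ⟨l, rfl⟩ := Nat.exists_eq_succ_of_ne_zero hl.ne'
    rw [List.ofFn_succ, List.prod_cons, map_mul]
    have := rankProj_qMinor (k := k) (q := q) (lt_bitLen_zero hs) (bitRow s 0) (bitCol s 0)
      (strictMono_bitRow s 0) (strictMono_bitCol s 0)
    rw [Fin.val_zero, this, zero_mul]
  exact this _ (Nat.pos_of_ne_zero h0)

end Laplace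

section Faithful

variable {k : Type} [Field k] {q : k} {m n r : ℕ} [NeZero m] (hq : q ^ m = 1)

/-- The representation of `M_q^{r+1}(n)` on functions over the finite Heisenberg group. -/
noncomputable def rankRep {K : Type} [CommRing K] [Algebra k K] {y : (RankIdx n r → ℤ) → K}
    (hodd : Odd m) (hy0 : y 0 = 1) (hy : ∀ γ δ, y (γ + δ) = y γ * y δ) :
    QMatRank k q n r →ₐ[k] Module.End K ((RankIdx n r → ZMod m) → K) :=
  (isQuantumMatrix_rankOp hq hodd hy0 hy).rankLift n r fun I J hJ =>
    qDetArray_rankMatrix_eq_zero (isTorusFamily_rankOp hq hodd hy0 hy) (ne_zero_of_pow_eq_one hq)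
      (isTwistedFamily_rankOp hq hy0 hy) (rankOp_cocycle_neg hq hodd) (Nat.lt_succ_self r) I J hJ

theorem rankRep_rankProj {K : Type} [CommRing K] [Algebra k K] {y : (RankIdx n r → ℤ) → K}
    (hodd : Odd m) (hy0 : y 0 = 1) (hy : ∀ γ δ, y (γ + δ) = y γ * y δ) (x : QMat k q n n) :
    rankRep hq hodd hy0 hy (rankProj k q n r x) =
      (isQuantumMatrix_rankOp hq hodd hy0 hy).lift n n x :=
  IsQuantumMatrix.rankLift_rankProj _ _ _ _ _

/-- The generic representation separates points when evaluated at the indicator of any set that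
contains the origin. -/
theorem rankRep_apply_indicator_eq_zero (hodd : Odd m) (C : Set (RankIdx n r → ZMod m))
    (h0 : 0 ∈ C) (a : QMatRank k q n r)
    (ha : rankRep hq hodd (latticeMonomial_zero (k := k)) latticeMonomial_add a (C.indicator 1) = 0) :
    a = 0 := by
  classical
  let ι := {s : Multiset (Fin n × Fin n) // rowPat s n r = 0}
  let v : ι → QMatRank k q n r := fun s => rankProj k q n r (bitableau q s.1)
  have hspan : Submodule.span k (Set.range v) = ⊤ := by
    rw [eq_top_iff]
    intro a _
    obtain ⟨x, rfl⟩ := RingQuot.mkAlgHom_surjective k (minorRel k q n (r + 1)) a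
    have hx : x ∈ Submodule.span k
        (Set.range (bitableau q : Multiset (Fin n × Fin n) → QMat k q n n)) := by
      rw [span_bitableau hq hodd]; trivial
    have := Submodule.mem_map_of_mem (f := (rankProj k q n r).toLinearMap) hx
    rw [Submodule.map_span] at this
    refine Submodule.span_le.mpr ?_ this
    rintro _ ⟨_, ⟨s, rfl⟩, rfl⟩
    by_cases hs : rowPat s n r = 0
    · exact Submodule.subset_span ⟨⟨s, hs⟩, rfl⟩
    · have := rankProj_bitableau (k := k) (q := q) hs
      rw [AlgHom.toLinearMap_apply, this]
      exact zero_mem _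
  have hli := linearIndependent_bitableau_apply hq hodd C h0 (fun s : ι => s.1) (fun s => s.2)
    Subtype.val_injective
  let L : QMatRank k q n r →ₗ[k] _ := evalAt k (C.indicator 1) ∘ₗ
    (rankRep hq hodd (latticeMonomial_zero (k := k)) latticeMonomial_add).toLinearMap
  have hli' : LinearIndependent k (L ∘ v) := by
    convert hli using 2 with s
    simp only [L, v, Function.comp_apply, LinearMap.comp_apply, AlgHom.toLinearMap_apply,
      rankRep_rankProj]
  have ha' : a ∈ Submodule.span k (Set.range v) := by rw [hspan]; trivial
  obtain ⟨w, rfl⟩ := (Finsupp.mem_span_range_iff_exists_finsupp).mp ha'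
  have hL : L (w.sum fun i c => c • v i) = 0 := ha
  rw [map_finsuppSum] at hL
  have : w = 0 := by
    refine linearIndependent_iff.mp hli' w ?_
    rw [Finsupp.linearCombination_apply]
    simpa using hL
  rw [this, Finsupp.sum_zero_index]

end Faithful

/-! ### The radical of the commutation form -/

section SignedRotation

variable {R : Type} [CommRing R]

/-- Signed cyclic rotation of the first `t` entries. -/
def signedRot (t : ℕ) (E : ℕ → R) (b : ℕ) : R :=
  if b = 0 then -E (t - 1) else if b < t then E (b - 1) else E b

/-- Iterated signed rotations of growing length, capped at `r`. -/
def rotSeq (r : ℕ) (E : ℕ → R) : ℕ → ℕ → R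
  | 0 => E
  | s + 1 => signedRot (min (s + 1) r) (rotSeq r E s)

/-- Signed reversal of the first `s` entries. -/
def signedRev (s : ℕ) (E : ℕ → R) (b : ℕ) : R := if b < s then -E (s - 1 - b) else E b

theorem rotSeq_eq_signedRev {r s : ℕ} (hs : s ≤ r) (E : ℕ → R) :
    rotSeq r E s = signedRev s E := by
  induction s with
  | zero => ext b; simp [rotSeq, signedRev]
  | succ s ih =>
    ext b
    rw [rotSeq, ih (by omega), min_eq_left hs]
    unfold signedRot signedRev
    rcases Nat.eq_zero_or_pos b with rfl | hb
    · simp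
    · rw [if_neg hb.ne']
      by_cases h : b < s + 1
      · rw [if_pos h, if_pos h, if_pos (by omega), show s - 1 - (b - 1) = s + 1 - 1 - b by omega]
      · rw [if_neg h, if_neg h, if_neg (by omega)]

theorem rotSeq_add {r : ℕ} (E : ℕ → R) (j : ℕ) :
    rotSeq r E (r + j) = (signedRot r)^[j] (signedRev r E) := by
  induction j with
  | zero => exact rotSeq_eq_signedRev le_rfl E
  | succ j ih => rw [← add_assoc, rotSeq, ih, min_eq_right (by omega), Function.iterate_succ_apply']

theorem signedRot_signedRev_signedRot {r : ℕ} (hr : 0 < r) (E : ℕ → R) :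
    signedRot r (signedRev r (signedRot r E)) = signedRev r E := by
  ext b
  unfold signedRot signedRev
  rcases Nat.eq_zero_or_pos b with rfl | hb
  · simp [hr]
  · rw [if_neg hb.ne']
    by_cases h : b < r
    · rw [if_pos h, if_pos h, if_pos (by omega)]
      beta_reduce
      rw [if_neg (by omega), if_pos (by omega), show r - 1 - (b - 1) - 1 = r - 1 - b by omega]
    · simp [h, hb.ne']

theorem signedRev_signedRev (r : ℕ) (E : ℕ → R) : signedRev r (signedRev r E) = E := by
  ext b
  unfold signedRev
  by_cases h : b < r
  · rw [if_pos h, if_pos (by omega), neg_neg, show r - 1 - (r - 1 - b) = b by omega]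
  · simp [h]

theorem iterate_signedRot_signedRev {r : ℕ} (hr : 0 < r) (j : ℕ) (E : ℕ → R) :
    (signedRot r)^[j] (signedRev r ((signedRot r)^[j] E)) = signedRev r E := by
  induction j generalizing E with
  | zero => rfl
  | succ j ih =>
    rw [Function.iterate_succ_apply, Function.iterate_succ_apply',
      signedRot_signedRev_signedRot hr, ih]

/-- The composite of all rotations is an involution. -/
theorem rotSeq_rotSeq {r n : ℕ} (hr : 0 < r) (hrn : r ≤ n) (E : ℕ → R) :
    rotSeq r (rotSeq r E n) n = E := by
  obtain ⟨j, rfl⟩ := Nat.exists_eq_add_of_le hrn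
  rw [rotSeq_add, rotSeq_add, iterate_signedRot_signedRev hr, signedRev_signedRev]

theorem signedRot_neg (t : ℕ) (E : ℕ → R) : signedRot t (-E) = -signedRot t E := by
  ext b
  simp only [signedRot, Pi.neg_apply]
  split_ifs <;> rfl

theorem rotSeq_neg (r : ℕ) (E : ℕ → R) (s : ℕ) : rotSeq r (-E) s = -rotSeq r E s := by
  induction s with
  | zero => rfl
  | succ s ih => rw [rotSeq, rotSeq, ih, signedRot_neg]

/-- The pairing of an array with the unit array at `(s, b)`. -/
def arrayPairing (n r : ℕ) (l : ℕ → ℕ → R) (s b : ℕ) : R :=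
  (∑ a ∈ Finset.range b, l s a + ∑ a ∈ Finset.range (b + 1), l s a - ∑ a ∈ Finset.range r, l s a) +
  (∑ i ∈ Finset.range s, l i b + ∑ i ∈ Finset.range (s + 1), l i b - ∑ i ∈ Finset.range n, l i b)

/-- The array of successive differences of the rotations. -/
def rotArray (r : ℕ) (E : ℕ → R) (s b : ℕ) : R := rotSeq r E s b - rotSeq r E (s + 1) b

theorem sum_rotArray_col (r : ℕ) (E : ℕ → R) (s b : ℕ) :
    ∑ i ∈ Finset.range s, rotArray r E i b = E b - rotSeq r E s b := by
  simp only [rotArray]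
  rw [Finset.sum_range_sub', rotSeq]

theorem rotArray_eq_zero {r : ℕ} (E : ℕ → R) {s b : ℕ} (h : s < b) : rotArray r E s b = 0 := by
  unfold rotArray
  rw [rotSeq, signedRot, if_neg (by omega), if_neg (by omega), sub_self]

theorem sum_sub_signedRot {t : ℕ} (E : ℕ → R) {b : ℕ} (hb : b < t) :
    ∑ a ∈ Finset.range (b + 1), (E a - signedRot t E a) = E b + E (t - 1) := by
  induction b with
  | zero => simp [signedRot]
  | succ b ih =>
    rw [Finset.sum_range_succ, ih (by omega), signedRot, if_neg (by omega), if_pos hb,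
      Nat.add_sub_cancel]
    ring

theorem sum_sub_signedRot_of_le {t : ℕ} (ht : 0 < t) (E : ℕ → R) {r : ℕ} (hr : t ≤ r) :
    ∑ a ∈ Finset.range r, (E a - signedRot t E a) = E (t - 1) + E (t - 1) := by
  rw [← sum_sub_signedRot E (show t - 1 < t by omega), show t - 1 + 1 = t by omega]
  refine (Finset.sum_subset (Finset.range_mono hr) fun a _ ha => ?_).symm
  rw [Finset.mem_range] at ha
  rw [signedRot, if_neg (by omega), if_neg ha, sub_self]

theorem arrayPairing_rotArray {n r : ℕ} (_hr : 0 < r) (E : ℕ → R) {s b : ℕ} (hb : b ≤ s)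
    (hbr : b < r) : arrayPairing n r (rotArray r E) s b = E b + rotSeq r E n b := by
  have h1 : b < min (s + 1) r := by omega
  have h2 : ∀ c, ∑ a ∈ Finset.range c, rotArray r E s a =
      ∑ a ∈ Finset.range c, (rotSeq r E s a - signedRot (min (s + 1) r) (rotSeq r E s) a) :=
    fun c => rfl
  have h3 : rotSeq r E (s + 1) b = signedRot (min (s + 1) r) (rotSeq r E s) b := rfl
  unfold arrayPairing
  rw [sum_rotArray_col, sum_rotArray_col, sum_rotArray_col, h2, h2, h2, sum_sub_signedRot _ h1,
    sum_sub_signedRot_of_le (by omega) _ (min_le_right _ _), h3]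
  rcases Nat.eq_zero_or_pos b with rfl | hb0
  · simp only [Finset.sum_range_zero, signedRot, if_true]; ring
  · have h4 := sum_sub_signedRot (rotSeq r E s) (show b - 1 < min (s + 1) r by omega)
    rw [show b - 1 + 1 = b by omega] at h4
    rw [h4, signedRot, if_neg hb0.ne', if_pos h1]; ring

theorem eq_rotArray_of_pairing {n r : ℕ} (_hr : 0 < r) (h2 : ∀ x y : R, x + x = y + y → x = y)
    {l : ℕ → ℕ → R} (hl : ∀ s b, s < b → l s b = 0) {ε E : ℕ → R}
    (hE : ∀ b < r, E b + E b = ∑ i ∈ Finset.range n, l i b + ε b)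
    (hε : ∀ s < n, ∀ b ≤ s, b < r → arrayPairing n r l s b = ε b) :
    ∀ s < n, ∀ b < r, l s b = rotArray r E s b := by
  have key : ∀ s ≤ n, ∀ b < r, ∑ i ∈ Finset.range s, l i b = E b - rotSeq r E s b := by
    intro s
    induction s with
    | zero => intro _ b _; simp [rotSeq]
    | succ s ih =>
      intro hs
      replace ih := ih (by omega)
      set F := rotSeq r E s with hF
      set t := min (s + 1) r with ht
      have e1 : ∀ b < t, ∑ a ∈ Finset.range (b + 1), l s a + ∑ a ∈ Finset.range (b + 1), l s a =
          F b + F b + ∑ a ∈ Finset.range r, l s a := by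
        intro b hb
        have := hε s (by omega) b (by omega) (by omega)
        unfold arrayPairing at this
        rw [Finset.sum_range_succ (fun i => l i b) s, ih b (by omega)] at this
        have := hE b (by omega)
        rw [Finset.sum_range_succ] at *
        linear_combination ‹_ + _ = ε b› - this
      have e2 : ∑ a ∈ Finset.range t, l s a = ∑ a ∈ Finset.range r, l s a :=
        Finset.sum_subset (Finset.range_mono (min_le_right _ _)) fun a ha ha' => by
          rw [Finset.mem_range] at ha ha'
          exact hl s a (by omega)
      have e3 : ∑ a ∈ Finset.range r, l s a = F (t - 1) + F (t - 1) := by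
        have := e1 (t - 1) (by omega)
        rw [show t - 1 + 1 = t by omega, e2] at this
        linear_combination this
      have e4 : ∀ b < t, ∑ a ∈ Finset.range (b + 1), l s a = F b + F (t - 1) := by
        intro b hb
        apply h2
        rw [e1 b hb, e3]; ring
      intro b hb
      rw [Finset.sum_range_succ, ih b hb]
      suffices l s b = F b - signedRot t F b by rw [this, rotSeq]; ring
      by_cases hbt : b < t
      · have h5 := e4 b hbt
        rw [Finset.sum_range_succ] at h5
        rcases Nat.eq_zero_or_pos b with rfl | hb0
        · simp only [Finset.sum_range_zero, zero_add] at h5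
          rw [h5, signedRot, if_pos rfl]; ring
        · have h6 := e4 (b - 1) (by omega)
          rw [show b - 1 + 1 = b by omega] at h6
          rw [h6] at h5
          rw [signedRot, if_neg hb0.ne', if_pos hbt]
          linear_combination h5
      · rw [hl s b (by omega), signedRot, if_neg (by omega), if_neg hbt, sub_self]
  intro s hs b hb
  have h1 := key (s + 1) hs b hb
  rw [Finset.sum_range_succ, key s hs.le b hb] at h1
  unfold rotArray
  linear_combination h1

end SignedRotation

/-! ### Lagrangian subgroups -/

section Lagrangian

variable {H : Type} [AddCommGroup H] {m : ℕ} [Module (ZMod m) H]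

/-- `C` is an isotropic subgroup of `G` that equals its own orthogonal in `G`. -/
structure IsLagrangian (ω : LinearMap.BilinForm (ZMod m) H) (G C : AddSubgroup H) : Prop where
  le : C ≤ G
  isotropic : ∀ x ∈ C, ∀ y ∈ C, ω x y = 0
  mem : ∀ g ∈ G, (∀ c ∈ C, ω c g = 0) → g ∈ C

theorem exists_isLagrangian [Finite H] {ω : LinearMap.BilinForm (ZMod m) H}
    (hω : ∀ x y, ω y x = -ω x y) (hω' : ∀ x, ω x x = 0) (G : AddSubgroup H) :
    ∃ C, IsLagrangian ω G C := by
  obtain ⟨C, hC⟩ := Set.Finite.exists_maximal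
    (s := {C : AddSubgroup H | C ≤ G ∧ ∀ x ∈ C, ∀ y ∈ C, ω x y = 0}) (Set.toFinite _)
    ⟨⊥, bot_le, by simp⟩
  refine ⟨C, hC.prop.1, hC.prop.2, fun g hg hgC => ?_⟩
  have hmem : C ⊔ AddSubgroup.zmultiples g ∈
      {C : AddSubgroup H | C ≤ G ∧ ∀ x ∈ C, ∀ y ∈ C, ω x y = 0} := by
    refine ⟨sup_le hC.prop.1 (by simpa using hg), ?_⟩
    intro x hx y hy
    obtain ⟨x₁, hx₁, x₂, hx₂, rfl⟩ := AddSubgroup.mem_sup.mp hx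
    obtain ⟨y₁, hy₁, y₂, hy₂, rfl⟩ := AddSubgroup.mem_sup.mp hy
    obtain ⟨a, rfl⟩ := AddSubgroup.mem_zmultiples_iff.mp hx₂
    obtain ⟨b, rfl⟩ := AddSubgroup.mem_zmultiples_iff.mp hy₂
    simp only [map_add, LinearMap.add_apply, map_zsmul, LinearMap.smul_apply,
      hC.prop.2 _ hx₁ _ hy₁, hgC _ hx₁, hω', hω y₁ g, hgC _ hy₁, smul_zero, neg_zero, add_zero]
  exact hC.le_of_ge hmem le_sup_left
    (AddSubgroup.mem_sup_right (AddSubgroup.mem_zmultiples g))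

variable {k : Type} [Field k]

theorem sum_addChar_bilin {χ : AddChar (ZMod m) k} (hχ : ∀ z, χ z = 1 → z = 0)
    (ω : LinearMap.BilinForm (ZMod m) H) (G : AddSubgroup H) [Fintype G] (c : H)
    [Decidable (∀ g ∈ G, ω c g = 0)] :
    ∑ g : G, χ (ω c g) = if ∀ g ∈ G, ω c g = 0 then (Fintype.card G : k) else 0 := by
  classical
  have h := AddChar.sum_eq_ite (χ.compAddMonoidHom ((ω c).toAddMonoidHom.comp G.subtype))
  refine Eq.trans (by rfl) (h.trans ?_)
  congr 1
  rw [eq_iff_iff, DFunLike.ext_iff]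
  constructor
  · intro h g hg
    exact hχ _ (h ⟨g, hg⟩)
  · rintro h ⟨g, hg⟩
    change χ (ω c g) = 1
    rw [h g hg, AddChar.map_zero_eq_one]

theorem IsLagrangian.card_sq [CharZero k] [Finite H] {χ : AddChar (ZMod m) k} (hχ : ∀ z, χ z = 1 → z = 0)
    {ω : LinearMap.BilinForm (ZMod m) H} (hω : ∀ x y, ω y x = -ω x y) {G C : AddSubgroup H}
    (hC : IsLagrangian ω G C) :
    Nat.card C * Nat.card C = Nat.card {g // g ∈ G ∧ ∀ h ∈ G, ω g h = 0} * Nat.card G := by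
  classical
  have := Fintype.ofFinite H
  have h1 : ∑ g : G, ∑ c : C, χ (ω c g) = (Fintype.card C * Fintype.card C : k) := by
    have : ∀ g : G, ∑ c : C, χ (ω c g) = if (g : H) ∈ C then (Fintype.card C : k) else 0 := by
      intro g
      have e : ∀ c : C, χ (ω c g) = χ (ω (-(g : H)) c) := by
        intro c; rw [map_neg, LinearMap.neg_apply, hω (g : H) c]
      rw [Finset.sum_congr rfl fun c _ => e c, sum_addChar_bilin hχ ω C]
      congr 1
      rw [eq_iff_iff]
      constructor
      · intro h
        refine hC.mem g g.2 fun c hc => ?_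
        rw [hω (g : H) c, ← LinearMap.neg_apply, ← map_neg]
        exact h c hc
      · intro h c hc
        rw [map_neg, LinearMap.neg_apply, hC.isotropic _ h _ hc, neg_zero]
    rw [Finset.sum_congr rfl fun g _ => this g, ← Finset.sum_filter, Finset.sum_const,
      nsmul_eq_mul]
    congr 2
    rw [← Fintype.card_subtype]
    exact Fintype.card_congr ⟨fun g => ⟨g.1, g.2⟩, fun c => ⟨⟨c, hC.le c.2⟩, c.2⟩,
      fun _ => rfl, fun _ => rfl⟩
  have h2 : ∑ c : C, ∑ g : G, χ (ω c g) =
      (Fintype.card {g // g ∈ G ∧ ∀ h ∈ G, ω g h = 0} * Fintype.card G : k) := by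
    rw [Finset.sum_congr rfl fun (c : C) _ => sum_addChar_bilin hχ ω G (c : H), ← Finset.sum_filter,
      Finset.sum_const, nsmul_eq_mul]
    congr 2
    rw [← Fintype.card_subtype]
    refine Fintype.card_congr ⟨fun g => ⟨g.1, hC.le g.1.2, g.2⟩,
      fun c => ⟨⟨c, hC.mem c c.2.1 fun d hd => ?_⟩, c.2.2⟩, fun _ => rfl, fun _ => rfl⟩
    rw [hω, c.2.2 d (hC.le hd), neg_zero]
  rw [Finset.sum_comm, h2] at h1
  simp only [Nat.card_eq_fintype_card]
  exact_mod_cast h1.symm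

end Lagrangian

section RankLattice

variable {n r m : ℕ}

/-- One side of a pair of arrays, extended by zero. -/
def sideFun {R : Type} [Zero R] (g : RankIdx n r → R) (β : Bool) (i a : ℕ) : R :=
  if h : i < n ∧ a < r then g (β, ⟨i, h.1⟩, ⟨a, h.2⟩) else 0

theorem sideFun_apply {R : Type} [Zero R] (g : RankIdx n r → R) (β : Bool) (i : Fin n) (a : Fin r) :
    sideFun g β i a = g (β, i, a) := by
  simp [sideFun]

/-- Pairs of trapezoidal arrays with equal column sums. -/
def rankLattice (n r m : ℕ) : AddSubgroup (RankIdx n r → ZMod m) where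
  carrier := {g | (∀ (β : Bool) (i : Fin n) (a : Fin r), (i : ℕ) < a → g (β, i, a) = 0) ∧
    ∀ a : Fin r, ∑ i : Fin n, g (false, i, a) = ∑ i : Fin n, g (true, i, a)}
  add_mem' hg hh := ⟨fun β i a h => by simp [hg.1 β i a h, hh.1 β i a h],
    fun a => by simp [Finset.sum_add_distrib, hg.2 a, hh.2 a]⟩
  zero_mem' := ⟨fun _ _ _ _ => rfl, fun _ => by simp⟩
  neg_mem' hg := ⟨fun β i a h => by simp [hg.1 β i a h], fun a => by simp [hg.2 a]⟩

theorem sum_split_range {R : Type} [CommRing R] (f : ℕ → R) {b r : ℕ} (hb : b < r) :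
    ∑ a ∈ Finset.range r, f a * ((if a < b then 1 else 0) - (if b < a then 1 else 0)) =
      ∑ a ∈ Finset.range b, f a + ∑ a ∈ Finset.range (b + 1), f a - ∑ a ∈ Finset.range r, f a := by
  have h : ∀ c ≤ r, ∑ a ∈ Finset.range c, f a = ∑ a ∈ Finset.range r, if a < c then f a else 0 := by
    intro c hc
    rw [← Finset.sum_filter]
    congr 1
    ext a
    simp only [Finset.mem_range, Finset.mem_filter]
    omega
  rw [h b hb.le, h (b + 1) hb, ← Finset.sum_add_distrib, ← Finset.sum_sub_distrib]
  refine Finset.sum_congr rfl fun a _ => ?_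
  rcases lt_trichotomy a b with h | rfl | h
  · simp [h, h.trans (Nat.lt_succ_self b), not_lt_of_gt h]
  · simp
  · simp [h, not_lt_of_gt h, show ¬ a < b + 1 by omega]

theorem torusExp_eq (i a s b : ℕ) : torusExp i a s b =
    (if i = s then (if a < b then 1 else 0) - (if b < a then 1 else 0) else 0) +
    (if a = b then (if i < s then 1 else 0) - (if s < i then 1 else 0) else 0) := by
  unfold torusExp
  split_ifs <;> omega

theorem gramForm_single_right (g : RankIdx n r → ZMod m) (β : Bool) (s : Fin n) (b : Fin r) :
    gramForm (rankOmega n r) m g (Pi.single (β, s, b) 1) = arrayPairing n r (sideFun g β) s b := by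
  rw [gramForm_apply]
  have h1 : ∀ t : RankIdx n r, ∑ u, g t * (rankOmega n r t u : ZMod m) *
      (Pi.single (β, s, b) 1 : RankIdx n r → ZMod m) u =
      g t * (rankOmega n r t (β, s, b) : ZMod m) := by
    intro t
    rw [Finset.sum_eq_single (β, s, b)]
    · simp
    · intro u _ hu; simp [hu]
    · simp
  rw [Finset.sum_congr rfl fun t _ => h1 t, Fintype.sum_prod_type, Finset.sum_eq_single β]
  · rw [Fintype.sum_prod_type]
    have h2 : ∀ (i : Fin n) (a : Fin r), g (β, i, a) *
        (rankOmega n r (β, i, a) (β, s, b) : ZMod m) =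
        (if i = s then sideFun g β s a * ((if (a : ℕ) < b then 1 else 0) -
          (if (b : ℕ) < a then 1 else 0)) else 0) +
        (if a = b then sideFun g β i b * ((if (i : ℕ) < s then 1 else 0) -
          (if (s : ℕ) < i then 1 else 0)) else 0) := by
      intro i a
      rw [rankOmega, if_pos rfl, torusExp_eq]
      push_cast
      rw [← sideFun_apply g β i a, mul_add]
      simp only [Fin.ext_iff]
      congr 1
      · split_ifs <;> simp_all
      · split_ifs <;> simp_all
    simp only [h2, Finset.sum_add_distrib, Finset.sum_ite_eq', Finset.mem_univ, if_true]
    rw [Finset.sum_comm]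
    simp only [Finset.sum_ite_eq', Finset.mem_univ, if_true]
    rw [arrayPairing, ← sum_split_range (fun a => sideFun g β s a) b.2,
      ← sum_split_range (fun i => sideFun g β i b) s.2, Finset.sum_range, Finset.sum_range]
  · intro β' _ hβ
    refine Finset.sum_eq_zero fun t _ => ?_
    simp [rankOmega, hβ]
  · simp

theorem gramForm_eq_sum (g h : RankIdx n r → ZMod m) :
    gramForm (rankOmega n r) m g h = ∑ β, ∑ i : Fin n, ∑ a : Fin r,
      h (β, i, a) * arrayPairing n r (sideFun g β) i a := by
  have : h = ∑ t, h t • (Pi.single t 1 : RankIdx n r → ZMod m) := by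
    ext u
    simp [Finset.sum_apply, Pi.single_apply]
  conv_lhs => rw [this]
  simp only [map_sum, map_smul, smul_eq_mul]
  rw [Fintype.sum_prod_type]
  refine Finset.sum_congr rfl fun β _ => ?_
  rw [Fintype.sum_prod_type]
  simp only [gramForm_single_right]

theorem arrayPairing_congr {R : Type} [CommRing R] {l l' : ℕ → ℕ → R} {s b : ℕ} (hs : s < n)
    (hb : b < r) (h : ∀ i < n, ∀ a < r, l i a = l' i a) :
    arrayPairing n r l s b = arrayPairing n r l' s b := by
  have h1 : ∀ c ≤ r, ∑ a ∈ Finset.range c, l s a = ∑ a ∈ Finset.range c, l' s a :=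
    fun c hc => Finset.sum_congr rfl fun a ha => h s hs a (by rw [Finset.mem_range] at ha; omega)
  have h2 : ∀ c ≤ n, ∑ i ∈ Finset.range c, l i b = ∑ i ∈ Finset.range c, l' i b :=
    fun c hc => Finset.sum_congr rfl fun i hi => h i (by rw [Finset.mem_range] at hi; omega) b hb
  unfold arrayPairing
  rw [h1 _ hb.le, h1 _ hb, h1 _ le_rfl, h2 _ hs.le, h2 _ hs, h2 _ le_rfl]

theorem rotSeq_of_le {R : Type} [CommRing R] (E : ℕ → R) (hr : 0 < r) (s : ℕ) {b : ℕ} (hb : r ≤ b) :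
    rotSeq r E s b = E b := by
  induction s with
  | zero => rfl
  | succ s ih => rw [rotSeq, signedRot, if_neg (by omega), if_neg (by omega), ih]

/-- The starting sequence of side `β` of the radical element attached to `E`. -/
def radSeq (n r : ℕ) {R : Type} [CommRing R] (E : ℕ → R) (β : Bool) : ℕ → R :=
  bif β then -rotSeq r E n else E

/-- The radical element attached to `E`. -/
def radElem (n r : ℕ) {R : Type} [CommRing R] (E : ℕ → R) : RankIdx n r → R :=
  fun t => rotArray r (radSeq n r E t.1) t.2.1 t.2.2

section Radical

variable {R : Type} [CommRing R] (E : ℕ → R)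

theorem sideFun_radElem (β : Bool) : ∀ i < n, ∀ a < r,
    sideFun (radElem n r E) β i a = rotArray r (radSeq n r E β) i a := by
  intro i hi a ha
  simp [sideFun, hi, ha, radElem]

theorem rotSeq_radSeq (hr : 0 < r) (hrn : r ≤ n) (β : Bool) (b : ℕ) :
    rotSeq r (radSeq n r E β) n b = bif β then -E b else rotSeq r E n b := by
  cases β
  · rfl
  · simp [radSeq, rotSeq_neg, rotSeq_rotSeq hr hrn]

theorem sum_radElem (hr : 0 < r) (hrn : r ≤ n) (β : Bool) (a : Fin r) :
    ∑ i, radElem n r E (β, i, a) = E a - rotSeq r E n a := by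
  have h := sum_rotArray_col r (radSeq n r E β) n a
  rw [Finset.sum_range] at h
  refine h.trans ?_
  rw [rotSeq_radSeq E hr hrn]
  cases β <;> simp [radSeq, sub_eq_add_neg, add_comm]

theorem arrayPairing_radElem (hr : 0 < r) (hrn : r ≤ n) (β : Bool) {s b : ℕ} (hb : b ≤ s)
    (hs : s < n) (hbr : b < r) : arrayPairing n r (sideFun (radElem n r E) β) s b =
      bif β then -(E b + rotSeq r E n b) else E b + rotSeq r E n b := by
  rw [arrayPairing_congr hs hbr (sideFun_radElem E β), arrayPairing_rotArray hr _ hb hbr,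
    rotSeq_radSeq E hr hrn]
  cases β <;> simp [radSeq, add_comm]

end Radical

theorem radElem_mem (hr : 0 < r) (hrn : r ≤ n) (E : ℕ → ZMod m) :
    radElem n r E ∈ rankLattice n r m ∧
      ∀ h ∈ rankLattice n r m, gramForm (rankOmega n r) m (radElem n r E) h = 0 := by
  refine ⟨⟨fun β i a h => rotArray_eq_zero _ h, fun a => ?_⟩, fun h hh => ?_⟩
  · rw [sum_radElem E hr hrn, sum_radElem E hr hrn]
  · rw [gramForm_eq_sum]
    have key : ∀ β (i : Fin n) (a : Fin r),
        h (β, i, a) * arrayPairing n r (sideFun (radElem n r E) β) i a =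
        h (β, i, a) * (bif β then -(E a + rotSeq r E n a) else E a + rotSeq r E n a) := by
      intro β i a
      by_cases hia : (i : ℕ) < a
      · rw [hh.1 β i a hia, zero_mul, zero_mul]
      · rw [arrayPairing_radElem E hr hrn β (not_lt.mp hia) i.2 a.2]
    simp only [key]
    have hsum : ∀ β : Bool, ∀ u : ℕ → ZMod m, ∑ i : Fin n, ∑ a : Fin r, h (β, i, a) * u a =
        ∑ a : Fin r, (∑ i : Fin n, h (false, i, a)) * u a := by
      intro β u
      rw [Finset.sum_comm]
      refine Finset.sum_congr rfl fun a _ => ?_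
      rw [← Finset.sum_mul]
      cases β
      · rfl
      · rw [hh.2 a]
    rw [Fintype.sum_bool]
    simp only [cond_true, cond_false]
    rw [hsum true fun a => -(E a + rotSeq r E n a), hsum false fun a => E a + rotSeq r E n a,
      ← Finset.sum_add_distrib]
    exact Finset.sum_eq_zero fun a _ => by ring

theorem single_add_single_mem {s s' b : ℕ} (hs : s < n) (hs' : s' < n) (hb : b < r) (hbs : b ≤ s)
    (hbs' : b ≤ s') : (Pi.single (false, ⟨s, hs⟩, ⟨b, hb⟩) 1 + Pi.single (true, ⟨s', hs'⟩, ⟨b, hb⟩) 1 :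
      RankIdx n r → ZMod m) ∈ rankLattice n r m := by
  refine ⟨fun β i a h => ?_, fun a => ?_⟩
  · rw [Pi.add_apply, Pi.single_eq_of_ne, Pi.single_eq_of_ne, add_zero]
    all_goals
      rintro ⟨⟩
      simp only at h
      omega
  · simp [Pi.single_apply, Prod.ext_iff, ite_and]

theorem exists_radElem (hodd : Odd m) (hr : 0 < r) (hrn : r ≤ n) {g : RankIdx n r → ZMod m}
    (hg : g ∈ rankLattice n r m) (hg' : ∀ h ∈ rankLattice n r m, gramForm (rankOmega n r) m g h = 0) :
    ∃ E : ℕ → ZMod m, (∀ b, r ≤ b → E b = 0) ∧ radElem n r E = g := by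
  have h2 : ∀ x y : ZMod m, x + x = y + y → x = y := fun x y h =>
    sub_eq_zero.mp (eq_zero_of_add_self_zmod hodd (by linear_combination h))
  set l : Bool → ℕ → ℕ → ZMod m := sideFun g with hl
  set ε : ℕ → ZMod m := fun b => arrayPairing n r (l false) b b with hε
  set κ : ℕ → ZMod m := fun b => ∑ i ∈ Finset.range n, l false i b with hκ
  have hpair : ∀ s < n, ∀ s' < n, ∀ b < r, b ≤ s → b ≤ s' →
      arrayPairing n r (l false) s b + arrayPairing n r (l true) s' b = 0 := by
    intro s hs s' hs' b hb hbs hbs'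
    have := hg' _ (single_add_single_mem hs hs' hb hbs hbs')
    rwa [map_add, gramForm_single_right, gramForm_single_right] at this
  have ht : ∀ s < n, ∀ b ≤ s, b < r → arrayPairing n r (l true) s b = -ε b := fun s hs b hb hbr =>
    (neg_eq_of_add_eq_zero_right (hpair b (hbr.trans_le hrn) s hs b hbr le_rfl hb)).symm
  have hf : ∀ s < n, ∀ b ≤ s, b < r → arrayPairing n r (l false) s b = ε b := fun s hs b hb hbr => by
    have h := hpair s hs s hs b hbr hb hb
    rw [ht s hs b hb hbr] at h
    exact add_neg_eq_zero.mp h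
  have hκ' : ∀ b < r, ∑ i ∈ Finset.range n, l true i b = κ b := by
    intro b hb
    have h := hg.2 ⟨b, hb⟩
    simp only [← sideFun_apply g] at h
    simp only [hκ, Finset.sum_range]
    exact h.symm
  have hl0 : ∀ β s b, s < b → l β s b = 0 := by
    intro β s b hsb
    simp only [hl, sideFun]
    split_ifs with h
    · exact hg.1 _ _ _ hsb
    · rfl
  have hhalf : ∀ x : ZMod m, 2⁻¹ * x + 2⁻¹ * x = x := fun x => by
    linear_combination x * two_mul_inv_two_zmod hodd
  set E : ℕ → ZMod m := fun b => if b < r then 2⁻¹ * (κ b + ε b) else 0 with hE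
  set F : ℕ → ZMod m := fun b => if b < r then 2⁻¹ * (κ b - ε b) else 0 with hF
  have hEl := eq_rotArray_of_pairing (n := n) (ε := ε) (E := E) hr h2 (hl0 false)
    (fun b hb => by simp only [hE, if_pos hb, hhalf, hκ]) hf
  have hFl := eq_rotArray_of_pairing (n := n) (ε := fun b => -ε b) (E := F) hr h2 (hl0 true)
    (fun b hb => by simp only [hF, if_pos hb, hhalf, hκ' b hb, sub_eq_add_neg]) ht
  have hFE : F = -rotSeq r E n := by
    ext b
    rw [Pi.neg_apply]
    by_cases hb : b < r
    · have h := sum_rotArray_col r E n b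
      rw [← Finset.sum_congr rfl fun i hi => hEl i (Finset.mem_range.mp hi) b hb] at h
      have h1 : E b + E b = κ b + ε b := by simp only [hE, if_pos hb, hhalf]
      have h3 : F b + F b = κ b - ε b := by simp only [hF, if_pos hb, hhalf]
      have h4 : κ b = E b - rotSeq r E n b := h
      apply h2
      linear_combination h3 + h1 + 2 * h4
    · rw [rotSeq_of_le E hr n (not_lt.mp hb)]
      simp only [hE, hF, if_neg hb, neg_zero]
  refine ⟨E, fun b hb => if_neg (not_lt.mpr hb), ?_⟩
  funext ⟨β, i, a⟩
  rw [← sideFun_apply g]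
  cases β
  · exact (hEl i i.2 a a.2).symm
  · rw [radElem]
    simp only [radSeq, cond_true]
    rw [← hFE]
    exact (hFl i i.2 a a.2).symm

theorem card_radical (hodd : Odd m) (hr : 0 < r) (hrn : r ≤ n) :
    Nat.card {g // g ∈ rankLattice n r m ∧
      ∀ h ∈ rankLattice n r m, gramForm (rankOmega n r) m g h = 0} = m ^ r := by
  let Φ : (Fin r → ZMod m) → {g // g ∈ rankLattice n r m ∧
      ∀ h ∈ rankLattice n r m, gramForm (rankOmega n r) m g h = 0} :=
    fun E => ⟨radElem n r fun b => if h : b < r then E ⟨b, h⟩ else 0, radElem_mem hr hrn _⟩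
  have hΦ : Function.Bijective Φ := by
    constructor
    · intro E E' h
      have h' := congrArg Subtype.val h
      simp only [Φ] at h'
      ext ⟨b, hb⟩
      have h1 := sum_radElem (n := n) (fun b => if h : b < r then E ⟨b, h⟩ else 0) hr hrn false ⟨b, hb⟩
      have h2 := sum_radElem (n := n) (fun b => if h : b < r then E' ⟨b, h⟩ else 0) hr hrn false ⟨b, hb⟩
      have h3 := arrayPairing_radElem (n := n) (fun b => if h : b < r then E ⟨b, h⟩ else 0) hr hrn
        false le_rfl (hb.trans_le hrn) hb
      have h4 := arrayPairing_radElem (n := n) (fun b => if h : b < r then E' ⟨b, h⟩ else 0) hr hrn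
        false le_rfl (hb.trans_le hrn) hb
      rw [h'] at h1 h3
      simp only [cond_false, dif_pos hb] at h1 h2 h3 h4
      refine sub_eq_zero.mp (eq_zero_of_add_self_zmod hodd ?_)
      linear_combination h2 - h1 + h4 - h3
    · rintro ⟨g, hg, hg'⟩
      obtain ⟨E, hE, rfl⟩ := exists_radElem hodd hr hrn hg hg'
      refine ⟨fun b => E b, Subtype.ext ?_⟩
      simp only [Φ]
      congr 1
      ext b
      split_ifs with hb
      · rfl
      · exact (hE b (not_lt.mp hb)).symm
  rw [← Nat.card_congr (Equiv.ofBijective Φ hΦ), Nat.card_fun, Nat.card_zmod, Nat.card_fin]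

end RankLattice

section Cardinalities

variable {n r m : ℕ}

/-- The array supported on the diagonal of the second side with the given entries. -/
def diagFun (n : ℕ) {R : Type} [Zero R] (x : Fin r → R) : RankIdx n r → R :=
  fun t => if t.1 = true ∧ (t.2.1 : ℕ) = t.2.2 then x t.2.2 else 0

theorem sum_diagFun_true (hrn : r ≤ n) (x : Fin r → ZMod m) (a : Fin r) :
    ∑ i, diagFun n x (true, i, a) = x a := by
  rw [Finset.sum_eq_single ⟨a, a.2.trans_le hrn⟩]
  · simp [diagFun]
  · intro i _ hi
    have : (i : ℕ) ≠ a := fun h => hi (Fin.ext h)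
    simp [diagFun, this]
  · simp

theorem sum_diagFun_false (x : Fin r → ZMod m) (a : Fin r) :
    ∑ i, diagFun n x (false, i, a) = 0 := by
  simp [diagFun]

theorem sum_range_sub_eq (hrn : r ≤ n) :
    ∑ a ∈ Finset.range r, (n - a) = (n * r - r * (r + 1) / 2) + r := by
  have h1 : ∑ a ∈ Finset.range r, (n - a) + ∑ a ∈ Finset.range r, (a + 1) = r * (n + 1) := by
    rw [← Finset.sum_add_distrib, Finset.sum_congr rfl
      (g := fun _ => n + 1) fun a ha => by rw [Finset.mem_range] at ha; omega]
    simp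
  have h2 : ∑ a ∈ Finset.range r, (a + 1) = r * (r + 1) / 2 := by
    have := Finset.sum_range_id (r + 1)
    rw [Finset.sum_range_succ'] at this
    simpa [mul_comm] using this
  have h3 : r * (r + 1) / 2 ≤ n * r := by
    refine Nat.div_le_of_le_mul ?_
    rcases Nat.eq_zero_or_pos r with rfl | hr
    · simp
    · nlinarith [Nat.mul_le_mul_right r hrn, Nat.mul_le_mul_right r (hr.trans_le hrn)]
  rw [h2, show r * (n + 1) = n * r + r by ring] at h1
  omega

theorem card_trapezoid (hrn : r ≤ n) :
    Fintype.card {t : RankIdx n r // (t.2.2 : ℕ) ≤ t.2.1} =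
      2 * ((n * r - r * (r + 1) / 2) + r) := by
  rw [Fintype.card_subtype, Finset.card_filter, Fintype.sum_prod_type, Fintype.sum_bool,
    Fintype.sum_prod_type, Finset.sum_comm, ← two_mul, ← sum_range_sub_eq hrn, Finset.sum_range]
  congr 1
  refine Finset.sum_congr rfl fun a _ => ?_
  rw [← Finset.sum_range fun i => if (a : ℕ) ≤ i then 1 else 0, ← Finset.card_filter,
    show (Finset.range n).filter (fun i => (a : ℕ) ≤ i) = Finset.Ico (a : ℕ) n by
      ext i; simp [and_comm], Nat.card_Ico]

theorem card_rankLattice_mul (hrn : r ≤ n) :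
    Nat.card (rankLattice n r m) * m ^ r = m ^ (2 * ((n * r - r * (r + 1) / 2) + r)) := by
  let Φ : rankLattice n r m × (Fin r → ZMod m) → {t : RankIdx n r // (t.2.2 : ℕ) ≤ t.2.1} → ZMod m :=
    fun p t => p.1.1 t + diagFun n p.2 t
  have hsum : ∀ (p : rankLattice n r m × (Fin r → ZMod m)) (a : Fin r),
      ∑ i, (p.1.1 (true, i, a) + diagFun n p.2 (true, i, a)) -
        ∑ i, (p.1.1 (false, i, a) + diagFun n p.2 (false, i, a)) = p.2 a := by
    intro p a
    rw [Finset.sum_add_distrib, Finset.sum_add_distrib, sum_diagFun_true hrn, sum_diagFun_false,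
      p.1.2.2 a]
    ring
  have hΦ : Function.Bijective Φ := by
    constructor
    · intro p p' h
      have h1 : ∀ t, p.1.1 t + diagFun n p.2 t = p'.1.1 t + diagFun n p'.2 t := by
        intro t
        by_cases ht : (t.2.2 : ℕ) ≤ t.2.1
        · exact congrFun h ⟨t, ht⟩
        · rw [p.1.2.1 t.1 t.2.1 t.2.2 (not_le.mp ht), p'.1.2.1 t.1 t.2.1 t.2.2 (not_le.mp ht)]
          have : (t.2.1 : ℕ) ≠ t.2.2 := by omega
          simp [diagFun, this]
      have h2 : p.2 = p'.2 := by
        ext a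
        rw [← hsum p a, ← hsum p' a]
        simp only [h1]
      refine Prod.ext (Subtype.ext (funext fun t => ?_)) h2
      have := h1 t
      rw [h2] at this
      exact add_right_cancel this
    · intro f
      let g : RankIdx n r → ZMod m := fun t => if h : (t.2.2 : ℕ) ≤ t.2.1 then f ⟨t, h⟩ else 0
      let x : Fin r → ZMod m := fun a => ∑ i, g (true, i, a) - ∑ i, g (false, i, a)
      have hg : g - diagFun n x ∈ rankLattice n r m := by
        refine ⟨fun β i a h => ?_, fun a => ?_⟩
        · have h' : (i : ℕ) ≠ a := by omega
          simp [g, diagFun, h, h']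
        · simp only [Pi.sub_apply]
          rw [Finset.sum_sub_distrib, Finset.sum_sub_distrib, sum_diagFun_true hrn,
            sum_diagFun_false]
          simp only [x]
          ring
      refine ⟨(⟨_, hg⟩, x), funext fun ⟨t, ht⟩ => ?_⟩
      simp [Φ, g, ht]
  have := Nat.card_congr (Equiv.ofBijective Φ hΦ)
  rwa [Nat.card_prod, Nat.card_fun, Nat.card_fun, Nat.card_zmod, Nat.card_fin,
    Nat.card_eq_fintype_card (α := {t : RankIdx n r // _}), card_trapezoid hrn] at this

theorem gramForm_self_rank (hodd : Odd m) (x : RankIdx n r → ZMod m) :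
    gramForm (rankOmega n r) m x x = 0 :=
  eq_zero_of_add_self_zmod hodd
    (by nth_rewrite 1 [gramForm_swap (rankOmega_swap n r)]; exact neg_add_cancel _)

variable {k : Type} [Field k] [CharZero k]

theorem IsLagrangian.card_quotient [NeZero m] (hodd : Odd m) (hr : 0 < r) (hrn : r ≤ n)
    {χ : AddChar (ZMod m) k} (hχ : ∀ z, χ z = 1 → z = 0) {C : AddSubgroup (RankIdx n r → ZMod m)}
    (hC : IsLagrangian (gramForm (rankOmega n r) m) (rankLattice n r m) C) :
    Nat.card (rankLattice n r m ⧸ C.addSubgroupOf (rankLattice n r m)) =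
      m ^ (n * r - r * (r + 1) / 2) := by
  set N := n * r - r * (r + 1) / 2
  have hm : 0 < m := Nat.pos_of_ne_zero (NeZero.ne m)
  have h1 := hC.card_sq hχ (gramForm_swap (rankOmega_swap n r))
  rw [card_radical hodd hr hrn, mul_comm, mul_comm (m ^ r), card_rankLattice_mul hrn,
    ← sq, mul_comm 2, pow_mul] at h1
  have h2 : Nat.card C = m ^ (N + r) := (Nat.pow_left_injective two_ne_zero) h1
  have h3 := AddSubgroup.card_eq_card_quotient_mul_card_addSubgroup (C.addSubgroupOf (rankLattice n r m))
  have h4 : Nat.card (C.addSubgroupOf (rankLattice n r m)) = Nat.card C :=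
    Nat.card_congr (AddSubgroup.addSubgroupOfEquivOfLe hC.le).toEquiv
  have h5 := card_rankLattice_mul (m := m) hrn
  rw [h3, h4, h2, mul_assoc] at h5
  have h6 : m ^ (2 * (N + r)) = m ^ N * (m ^ (N + r) * m ^ r) := by
    rw [← pow_add, ← pow_add]
    congr 1
    ring
  rw [h6] at h5
  exact Nat.eq_of_mul_eq_mul_right (by positivity) h5

end Cardinalities

/-! ### Covariant functions on a coset -/

section Covariant

variable {H : Type} [AddCommGroup H] {m : ℕ} [Module (ZMod m) H] {k : Type} [Field k]
  (K : Type) [CommRing K] [Algebra k K] (χ : AddChar (ZMod m) k) (B : LinearMap.BilinForm (ZMod m) H)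
  (G C : AddSubgroup H)

/-- Functions supported on the coset `x` of `G` and covariant under translation by `C`. -/
def covariantFun (x : H ⧸ G) : Submodule K (H → K) where
  carrier := {f | (∀ h : H, (h : H ⧸ G) ≠ x → f h = 0) ∧
    ∀ h, ∀ c ∈ C, f (h + c) = algebraMap k K (χ (B h c)) * f h}
  add_mem' hf hg := ⟨fun h hh => by rw [Pi.add_apply, hf.1 h hh, hg.1 h hh, add_zero],
    fun h c hc => by rw [Pi.add_apply, hf.2 h c hc, hg.2 h c hc, Pi.add_apply, mul_add]⟩
  zero_mem' := ⟨fun _ _ => rfl, fun _ _ _ => by simp⟩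
  smul_mem' a f hf := ⟨fun h hh => by rw [Pi.smul_apply, hf.1 h hh, smul_zero],
    fun h c hc => by rw [Pi.smul_apply, hf.2 h c hc, Pi.smul_apply, smul_eq_mul, smul_eq_mul,
      mul_left_comm]⟩

/-- The operator `f` moves the coset of covariant functions by `x`. -/
def ShiftsBy (f : Module.End K (H → K)) (x : H ⧸ G) : Prop :=
  ∀ y, ∀ v ∈ covariantFun K χ B G C y, f v ∈ covariantFun K χ B G C (y + x)

variable {K χ B G C}

theorem ShiftsBy.zero (x : H ⧸ G) : ShiftsBy K χ B G C 0 x := fun _ _ _ => zero_mem _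

theorem ShiftsBy.add {f g : Module.End K (H → K)} {x : H ⧸ G} (hf : ShiftsBy K χ B G C f x)
    (hg : ShiftsBy K χ B G C g x) : ShiftsBy K χ B G C (f + g) x :=
  fun y v hv => add_mem (hf y v hv) (hg y v hv)

theorem ShiftsBy.sum {ι : Type} (s : Finset ι) {f : ι → Module.End K (H → K)} {x : H ⧸ G}
    (hf : ∀ i ∈ s, ShiftsBy K χ B G C (f i) x) : ShiftsBy K χ B G C (∑ i ∈ s, f i) x :=
  Finset.sum_induction _ (fun f => ShiftsBy K χ B G C f x) (fun _ _ => ShiftsBy.add)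
    (ShiftsBy.zero x) hf

theorem ShiftsBy.mul {f g : Module.End K (H → K)} {x z : H ⧸ G} (hf : ShiftsBy K χ B G C f x)
    (hg : ShiftsBy K χ B G C g z) : ShiftsBy K χ B G C (f * g) (x + z) := by
  intro y v hv
  have := hf _ _ (hg y v hv)
  rwa [add_assoc, add_comm z x] at this

theorem indicator_mem_covariantFun (hle : C ≤ G) (hB : ∀ x ∈ C, ∀ y ∈ C, B x y = 0) :
    (C : Set H).indicator (1 : H → K) ∈ covariantFun K χ B G C 0 := by
  classical
  refine ⟨fun h hh => Set.indicator_of_notMem (fun hC => hh ?_) _, fun h c hc => ?_⟩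
  · exact (QuotientAddGroup.eq_zero_iff h).mpr (hle hC)
  · by_cases hh : h ∈ C
    · rw [Set.indicator_of_mem (show h + c ∈ (C : Set H) from C.add_mem hh hc),
        Set.indicator_of_mem (show h ∈ (C : Set H) from hh), hB h hh c hc]
      simp
    · rw [Set.indicator_of_notMem (show h ∉ (C : Set H) from hh),
        Set.indicator_of_notMem (show h + c ∉ (C : Set H) from fun h' =>
          hh ((C.add_mem_cancel_right hc).mp h')), mul_zero]

/-- The value of a covariant function at the chosen representative of each coset. -/
noncomputable def covariantEval : covariantFun K χ B G C 0 →ₗ[K] (G ⧸ C.addSubgroupOf G → K) where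
  toFun f x := f.1 (x.out : G)
  map_add' _ _ := rfl
  map_smul' _ _ := rfl

theorem out_sub_mem (g : G) :
    (g : H) - ((g : G ⧸ C.addSubgroupOf G).out : G) ∈ C := by
  have h : -((g : G ⧸ C.addSubgroupOf G).out) + g ∈ C.addSubgroupOf G :=
    QuotientAddGroup.eq.mp (Quotient.out_eq _)
  rw [sub_eq_neg_add]
  exact h

theorem covariantEval_injective :
    Function.Injective (covariantEval : covariantFun K χ B G C 0 →ₗ[K] _) := by
  rw [← LinearMap.ker_eq_bot, LinearMap.ker_eq_bot']
  intro f hf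
  refine Subtype.ext (funext fun h => ?_)
  by_cases hG : h ∈ G
  · have h1 := f.2.2 ((⟨h, hG⟩ : G) : G ⧸ C.addSubgroupOf G).out.1 _ (out_sub_mem ⟨h, hG⟩)
    rw [add_sub_cancel] at h1
    change f.1 h = 0
    rw [h1, show f.1 _ = 0 from congrFun hf ((⟨h, hG⟩ : G) : G ⧸ C.addSubgroupOf G), mul_zero]
  · exact f.2.1 h fun h' => hG ((QuotientAddGroup.eq_zero_iff h).mp h')

theorem covariantEval_surjective (hle : C ≤ G) (hB : ∀ x ∈ C, ∀ y ∈ C, B x y = 0) :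
    Function.Surjective (covariantEval : covariantFun K χ B G C 0 →ₗ[K] _) := by
  classical
  intro g
  let F : H → K := fun h => if hG : h ∈ G then
    algebraMap k K (χ (B ((⟨h, hG⟩ : G) : G ⧸ C.addSubgroupOf G).out.1
      (h - ((⟨h, hG⟩ : G) : G ⧸ C.addSubgroupOf G).out.1))) * g (⟨h, hG⟩ : G) else 0
  have hF : F ∈ covariantFun K χ B G C 0 := by
    refine ⟨fun h hh => dif_neg fun hG => hh ((QuotientAddGroup.eq_zero_iff h).mpr hG),
      fun h c hc => ?_⟩
    by_cases hG : h ∈ G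
    · have hG' : h + c ∈ G := G.add_mem hG (hle hc)
      have hq : ((⟨h + c, hG'⟩ : G) : G ⧸ C.addSubgroupOf G) = (⟨h, hG⟩ : G) := by
        rw [QuotientAddGroup.eq]
        have : -(h + c) + h ∈ C := by
          rw [neg_add_rev, add_assoc, neg_add_cancel, add_zero]
          exact C.neg_mem hc
        exact this
      simp only [F, dif_pos hG, dif_pos hG', hq]
      rw [add_sub_right_comm, map_add, AddChar.map_add_eq_mul, map_mul]
      have h1 : B h c = B ((⟨h, hG⟩ : G) : G ⧸ C.addSubgroupOf G).out.1 c := by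
        rw [← sub_eq_zero, ← LinearMap.sub_apply, ← map_sub]
        exact hB _ (out_sub_mem ⟨h, hG⟩) c hc
      rw [h1]
      ring
    · have hG' : h + c ∉ G := fun h' => hG ((G.add_mem_cancel_right (hle hc)).mp h')
      simp only [F, dif_neg hG, dif_neg hG', mul_zero]
  refine ⟨⟨F, hF⟩, funext fun x => ?_⟩
  change F x.out.1 = g x
  have h1 : ((x.out : G) : G ⧸ C.addSubgroupOf G) = x := Quotient.out_eq x
  simp only [F, dif_pos x.out.2, Subtype.coe_eta, h1, sub_self, map_zero, AddChar.map_zero_eq_one,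
    map_one, one_mul]

/-- A basis of the covariant functions indexed by the cosets. -/
noncomputable def covariantBasis [Finite H] (hle : C ≤ G) (hB : ∀ x ∈ C, ∀ y ∈ C, B x y = 0) :
    Module.Basis (G ⧸ C.addSubgroupOf G) K (covariantFun K χ B G C 0) :=
  Module.Basis.ofEquivFun (LinearEquiv.ofBijective covariantEval
    ⟨covariantEval_injective, covariantEval_surjective hle hB⟩)

end Covariant

section CovariantWeyl

variable {S : Type} [Fintype S] [DecidableEq S] {k K : Type} [Field k] [CommRing K] [Algebra k K] {m : ℕ}
  {χ : AddChar (ZMod m) k}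

theorem shiftsBy_weylOp (Ω : S → S → ℤ) (y : (S → ℤ) → K)
    (G C : AddSubgroup (S → ZMod m)) (γ : S → ℤ) :
    ShiftsBy K χ (halfForm Ω m) G C (weylOp Ω χ y γ)
      ((redMod m γ : S → ZMod m) : (S → ZMod m) ⧸ G) := by
  intro x v hv
  refine ⟨fun h hh => ?_, fun h c hc => ?_⟩
  · rw [weylOp_apply, hv.1, mul_zero]
    intro h'
    apply hh
    rw [← h', ← QuotientAddGroup.mk_add, sub_add_cancel]
  · rw [weylOp_apply, weylOp_apply, add_sub_right_comm, hv.2 _ c hc, map_add, map_sub,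
      LinearMap.sub_apply, sub_eq_add_neg, AddChar.map_add_eq_mul, AddChar.map_add_eq_mul, map_mul,
      map_mul]
    have : algebraMap k K (χ (halfForm Ω m (redMod m γ) c)) *
        algebraMap k K (χ (-halfForm Ω m (redMod m γ) c)) = 1 := by
      rw [← map_mul, ← AddChar.map_add_eq_mul, add_neg_cancel, AddChar.map_zero_eq_one, map_one]
    linear_combination (algebraMap k K (χ (halfForm Ω m (redMod m γ) h)) * y γ *
      algebraMap k K (χ (halfForm Ω m h c)) * v (h - redMod m γ)) * this

end CovariantWeyl

theorem RingQuot.algHom_range_le {k X : Type} [Field k] {s : FreeAlgebra k X → FreeAlgebra k X → Prop}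
    {R : Type} [Ring R] [Algebra k R] (f : RingQuot s →ₐ[k] R) (P : Subalgebra k R)
    (h : ∀ x, f (RingQuot.mkAlgHom k s (FreeAlgebra.ι k x)) ∈ P) (a : RingQuot s) : f a ∈ P := by
  obtain ⟨a, rfl⟩ := RingQuot.mkAlgHom_surjective k s a
  induction a using FreeAlgebra.induction with
  | grade0 z => rw [AlgHom.commutes, AlgHom.commutes]; exact P.algebraMap_mem z
  | grade1 x => exact h x
  | mul a b ha hb => rw [map_mul, map_mul]; exact P.mul_mem ha hb
  | add a b ha hb => rw [map_add, map_add]; exact P.add_mem ha hb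

section RankShift

variable {n r m : ℕ} {k K : Type} [Field k] [CommRing K] [Algebra k K]
  {χ : AddChar (ZMod m) k} {B : LinearMap.BilinForm (ZMod m) (RankIdx n r → ZMod m)}
  {C : AddSubgroup (RankIdx n r → ZMod m)}

theorem shiftsBy_triArray {H : Type} [AddCommGroup H] [Module (ZMod m) H]
    {B : LinearMap.BilinForm (ZMod m) H} {G C : AddSubgroup H}
    {t ti : ℕ → ℕ → Module.End K (H → K)} {u : ℕ → H ⧸ G}
    (ht : ∀ i a, ShiftsBy K χ B G C (t i a) (u a)) (hti : ∀ i a, ShiftsBy K χ B G C (ti i a) (-u a))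
    (b c i a : ℕ) : ShiftsBy K χ B G C (triArray t ti b c i a) (u a) := by
  induction c generalizing b i with
  | zero => rw [triArray]; exact ShiftsBy.zero _
  | succ c ih =>
    rw [triArray]
    beta_reduce
    split_ifs with h
    · subst h; exact ht i a
    · have := (ht i b).mul (ShiftsBy.sum (Finset.range (i + 1))
        fun j _ => (hti j b).mul (ih (b + 1) j))
      rwa [add_neg_cancel_left] at this

theorem mk_sideVec (β : Bool) {i a : ℕ} (ha : a ≤ i) (hi : i < n) (har : a < r) :
    ((redMod m (sideVec n r β i a) : RankIdx n r → ZMod m) : _ ⧸ rankLattice n r m) =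
      (redMod m (sideVec n r β a a) : RankIdx n r → ZMod m) := by
  rw [QuotientAddGroup.eq]
  refine ⟨fun β' i' a' h => ?_, fun a' => ?_⟩
  · have h1 : ¬ ((i' : ℕ) = i ∧ (a' : ℕ) = a) := by omega
    have h2 : ¬ ((i' : ℕ) = a ∧ (a' : ℕ) = a) := by omega
    simp [redMod, sideVec, h1, h2]
  · have key : ∀ β' : Bool, ∑ i' : Fin n, (-redMod m (sideVec n r β i a) +
        redMod m (sideVec n r β a a)) (β', i', a') = 0 := by
      intro β'
      simp only [Pi.add_apply, Pi.neg_apply, Finset.sum_add_distrib, Finset.sum_neg_distrib]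
      rw [neg_add_eq_zero, sideVec_eq_single β hi har, sideVec_eq_single β (ha.trans_lt hi) har]
      simp [redMod, Pi.single_apply, Prod.ext_iff, ite_and]
    rw [key, key]

theorem mk_sideVec_add {a : ℕ} (ha : a < n) (har : a < r) :
    ((redMod m (sideVec n r false a a) : RankIdx n r → ZMod m) : _ ⧸ rankLattice n r m) +
      ((redMod m (sideVec n r true a a) : RankIdx n r → ZMod m) : _ ⧸ rankLattice n r m) = 0 := by
  rw [← QuotientAddGroup.mk_add, QuotientAddGroup.eq_zero_iff]
  convert single_add_single_mem (m := m) ha ha har le_rfl le_rfl using 1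
  rw [sideVec_eq_single _ ha har, sideVec_eq_single _ ha har]
  congr 1 <;> ext t <;> simp [redMod, Pi.single_apply]

variable [NeZero m] {q : k} (hq : q ^ m = 1) (y : (RankIdx n r → ℤ) → K)

theorem shiftsBy_sideArray (β : Bool) (b c i a : ℕ) :
    ShiftsBy K (rootChar hq) (halfForm (rankOmega n r) m) (rankLattice n r m) C
      (sideArray (rankOp n r hq y) β b c i a)
      ((redMod m (sideVec n r β a a) : RankIdx n r → ZMod m) : _ ⧸ rankLattice n r m) := by
  refine shiftsBy_triArray (u := fun a => ((redMod m (sideVec n r β a a) : RankIdx n r → ZMod m) :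
    _ ⧸ rankLattice n r m)) (fun i a => ?_) (fun i a => ?_) b c i a
  · unfold torusGen
    split_ifs with h
    · rw [← mk_sideVec β h.1 h.2.1 h.2.2]
      exact shiftsBy_weylOp (rankOmega n r) y _ _ _
    · exact ShiftsBy.zero _
  · unfold torusInv
    split_ifs with h
    · rw [← mk_sideVec β h.1 h.2.1 h.2.2, ← QuotientAddGroup.mk_neg, ← map_neg]
      exact shiftsBy_weylOp (rankOmega n r) y _ _ _
    · exact ShiftsBy.zero _

theorem shiftsBy_rankMatrix (hrn : r ≤ n) (i j : ℕ) :
    ShiftsBy K (rootChar hq) (halfForm (rankOmega n r) m) (rankLattice n r m) C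
      (rankMatrix (rankOp n r hq y) i j) 0 := by
  rw [rankMatrix]
  refine ShiftsBy.sum (Finset.range r) fun a ha => ?_
  rw [Finset.mem_range] at ha
  rw [← mk_sideVec_add (m := m) (ha.trans_le hrn) ha]
  exact (shiftsBy_sideArray hq y false 0 r i a).mul (shiftsBy_sideArray hq y true 0 r j a)

end RankShift

section Restriction

variable {k K A W : Type} [Field k] [CommRing K] [Algebra k K] [Semiring A] [Algebra k A]
  [AddCommGroup W] [Module K W] [Module k W] [SMulCommClass K k W] [IsScalarTower k K W]

/-- The operators that preserve a submodule. -/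
def preservingSubalgebra (k : Type) [Field k] [Algebra k K] [Module k W] [SMulCommClass K k W]
    [IsScalarTower k K W] (V : Submodule K W) : Subalgebra k (Module.End K W) where
  carrier := {f | ∀ v ∈ V, f v ∈ V}
  mul_mem' hf hg v hv := hf _ (hg v hv)
  add_mem' hf hg v hv := V.add_mem (hf v hv) (hg v hv)
  algebraMap_mem' c v hv := by
    rw [Module.algebraMap_end_apply, ← algebraMap_smul K c v]
    exact V.smul_mem _ hv

/-- The restriction of a representation to an invariant submodule. -/
def restrictRep (ρ : A →ₐ[k] Module.End K W) (V : Submodule K W) (h : ∀ a, ∀ v ∈ V, ρ a v ∈ V) :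
    A →+* Module.End K V where
  toFun a := (ρ a).restrict (h a)
  map_one' := by ext v; simp
  map_mul' a b := by ext v; simp
  map_zero' := by ext v; simp
  map_add' a b := by ext v; simp

end Restriction

theorem degLE_of_forall_eq_zero {A K V ι : Type} [Ring A] [CommRing K] [AddCommGroup V] [Module K V]
    [Fintype ι] [DecidableEq ι] (b : Module.Basis ι K V) (g : A →+* Module.End K V) (hg : ∀ a, g a = 0 → a = 0) :
    DegLE A (Fintype.card ι) :=
  degLE_of_injective b g ((injective_iff_map_eq_zero g).mpr hg)

section UpperBound

variable {n r m : ℕ} {k : Type} [Field k] [NeZero m] {q : k} (hq : q ^ m = 1)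

theorem rankRep_mem_covariantFun {K : Type} [CommRing K] [Algebra k K]
    {y : (RankIdx n r → ℤ) → K} (hodd : Odd m) (hy0 : y 0 = 1)
    (hy : ∀ γ δ, y (γ + δ) = y γ * y δ) (hrn : r ≤ n) (C : AddSubgroup (RankIdx n r → ZMod m))
    (a : QMatRank k q n r) : ∀ v ∈ covariantFun K (rootChar hq) (halfForm (rankOmega n r) m)
      (rankLattice n r m) C 0, rankRep hq hodd hy0 hy a v ∈
        covariantFun K (rootChar hq) (halfForm (rankOmega n r) m) (rankLattice n r m) C 0 := by
  obtain ⟨x, rfl⟩ := RingQuot.mkAlgHom_surjective k (minorRel k q n (r + 1)) a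
  have h := rankRep_rankProj hq hodd hy0 hy x
  rw [rankProj] at h
  rw [h]
  refine RingQuot.algHom_range_le _ (preservingSubalgebra k (covariantFun K (rootChar hq)
    (halfForm (rankOmega n r) m) (rankLattice n r m) C 0)) (fun ⟨i, j⟩ v hv => ?_) x
  have h1 := (isQuantumMatrix_rankOp hq hodd hy0 hy).lift_Zgen (n := n) (r := n) i j
  rw [Zgen] at h1
  rw [h1]
  have := shiftsBy_rankMatrix (C := C) hq y hrn i j 0 v hv
  rwa [add_zero] at this

/-- The representation of `M_q^{r+1}(n)` on the covariant functions. -/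
noncomputable def covariantRep {K : Type} [CommRing K] [Algebra k K]
    {y : (RankIdx n r → ℤ) → K} (hodd : Odd m) (hy0 : y 0 = 1)
    (hy : ∀ γ δ, y (γ + δ) = y γ * y δ) (hrn : r ≤ n) (C : AddSubgroup (RankIdx n r → ZMod m)) :
    QMatRank k q n r →+* Module.End K (covariantFun K (rootChar hq) (halfForm (rankOmega n r) m)
      (rankLattice n r m) C 0) :=
  restrictRep (k := k) (W := (RankIdx n r → ZMod m) → K) (rankRep (q := q) hq hodd hy0 hy)
    (covariantFun K (rootChar hq) (halfForm (rankOmega n r) m) (rankLattice n r m) C 0)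
    (rankRep_mem_covariantFun hq hodd hy0 hy hrn C)

variable [CharZero k]

theorem degLE_QMatRank (hodd : Odd m) (hr : 0 < r) (hrn : r ≤ n)
    (hχ : ∀ z, rootChar hq z = 1 → z = 0) {C : AddSubgroup (RankIdx n r → ZMod m)}
    (hC : IsLagrangian (gramForm (rankOmega n r) m) (rankLattice n r m) C) :
    DegLE (QMatRank k q n r) (m ^ (n * r - r * (r + 1) / 2)) := by
  classical
  have hB : ∀ x ∈ C, ∀ y ∈ C, halfForm (rankOmega n r) m x y = 0 := fun x hx y hy =>
    halfForm_eq_zero (hC.isotropic x hx y hy)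
  have := Fintype.ofFinite (rankLattice n r m ⧸ C.addSubgroupOf (rankLattice n r m))
  rw [← hC.card_quotient hodd hr hrn hχ, Nat.card_eq_fintype_card]
  let ρ := covariantRep (q := q) hq hodd (latticeMonomial_zero (k := k)) latticeMonomial_add hrn C
  refine degLE_of_forall_eq_zero (covariantBasis hC.le hB) ρ fun a ha =>
    rankRep_apply_indicator_eq_zero hq hodd C C.zero_mem a ?_
  exact congrArg Subtype.val (LinearMap.congr_fun ha ⟨_, indicator_mem_covariantFun hC.le hB⟩)

end UpperBound

/-! ### The image of the algebra contains the whole torus -/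

section Peeling

variable {R : Type} [Ring R]

/-- The product of two truncated triangular arrays. -/
def triProd (t ti t' ti' : ℕ → ℕ → R) (r b i j : ℕ) : R :=
  ∑ a ∈ Finset.range r, triArray t ti b (r - b) i a * triArray t' ti' b (r - b) j a

variable {t ti t' ti' : ℕ → ℕ → R} {r : ℕ}

theorem triArray_succ_eq {b : ℕ} (hb : b < r) (i a : ℕ) :
    triArray t ti b (r - b) i a = (if a = b then t i b else 0) +
      t i b * ∑ s ∈ Finset.range (i + 1), ti s b * triArray t ti (b + 1) (r - (b + 1)) s a := by
  rw [show r - b = r - (b + 1) + 1 by omega, triArray]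
  beta_reduce
  split_ifs with h
  · subst h
    rw [Finset.sum_eq_zero, mul_zero, add_zero]
    intro s _
    rw [triArray_of_lt _ _ _ _ (Nat.lt_succ_self a), mul_zero]
  · rw [zero_add]

theorem triProd_succ (h1 : ∀ i a j b, t i a * t' j b = t' j b * t i a)
    (h2 : ∀ i a j b, t i a * ti' j b = ti' j b * t i a)
    (h3 : ∀ i a j b, ti i a * t' j b = t' j b * ti i a)
    (h4 : ∀ i a j b, ti i a * ti' j b = ti' j b * ti i a) {b : ℕ} (hb : b < r) (i j : ℕ) :
    triProd t ti t' ti' r b i j = t i b * t' j b +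
      ∑ s ∈ Finset.range (i + 1), ∑ s' ∈ Finset.range (j + 1),
        (t i b * ti s b) * (t' j b * ti' s' b) * triProd t ti t' ti' r (b + 1) s s' := by
  set X := triArray t ti (b + 1) (r - (b + 1)) with hX
  set Y := triArray t' ti' (b + 1) (r - (b + 1)) with hY
  have hXb : ∀ s, X s b = 0 := fun s => triArray_of_lt _ _ _ _ (Nat.lt_succ_self b)
  have hYb : ∀ s, Y s b = 0 := fun s => triArray_of_lt _ _ _ _ (Nat.lt_succ_self b)
  have hXt : ∀ s a j, X s a * t' j b = t' j b * X s a := fun s a j =>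
    triArray_mul_comm (fun i c => h1 i c j b) (fun i c => h3 i c j b) _ _ _ _
  have hXti : ∀ s a j, X s a * ti' j b = ti' j b * X s a := fun s a j =>
    triArray_mul_comm (fun i c => h2 i c j b) (fun i c => h4 i c j b) _ _ _ _
  have hterm : ∀ a, triArray t ti b (r - b) i a * triArray t' ti' b (r - b) j a =
      (if a = b then t i b * t' j b else 0) +
        ∑ s ∈ Finset.range (i + 1), ∑ s' ∈ Finset.range (j + 1),
          (t i b * ti s b) * (t' j b * ti' s' b) * (X s a * Y s' a) := by
    intro a
    rw [triArray_succ_eq hb, triArray_succ_eq hb]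
    by_cases h : a = b
    · subst h
      rw [if_pos rfl, if_pos rfl, if_pos rfl]
      simp only [← hX, ← hY, hXb, hYb, mul_zero, Finset.sum_const_zero, add_zero]
    · rw [if_neg h, if_neg h, if_neg h, zero_add, zero_add, zero_add, Finset.mul_sum,
        Finset.mul_sum, Finset.sum_mul_sum]
      refine Finset.sum_congr rfl fun s _ => Finset.sum_congr rfl fun s' _ => ?_
      rw [← hX, ← hY]
      simp only [mul_assoc]
      rw [← mul_assoc (X s a) (t' j b), hXt, mul_assoc, ← mul_assoc (X s a) (ti' s' b), hXti,
        mul_assoc]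
  rw [triProd, Finset.sum_congr rfl fun a _ => hterm a, Finset.sum_add_distrib,
    Finset.sum_ite_eq', if_pos (Finset.mem_range.mpr hb), Finset.sum_comm]
  congr 1
  refine Finset.sum_congr rfl fun s _ => ?_
  rw [Finset.sum_comm]
  refine Finset.sum_congr rfl fun s' _ => ?_
  rw [triProd, Finset.mul_sum]

theorem triProd_eq_zero_left (ht : ∀ i a, i < a → t i a = 0) {b i j : ℕ} (h : i < b) :
    triProd t ti t' ti' r b i j = 0 := by
  refine Finset.sum_eq_zero fun a _ => ?_
  rcases lt_or_ge a b with hab | hab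
  · rw [triArray_of_lt _ _ _ _ hab, zero_mul]
  · rw [triArray_zero_of_lt ht _ _ _ _ (h.trans_le hab), zero_mul]

theorem triProd_eq_zero_right (ht : ∀ i a, i < a → t' i a = 0) {b i j : ℕ} (h : j < b) :
    triProd t ti t' ti' r b i j = 0 := by
  refine Finset.sum_eq_zero fun a _ => ?_
  rcases lt_or_ge a b with hab | hab
  · rw [triArray_of_lt _ _ _ _ hab, zero_mul]
  · rw [triArray_zero_of_lt ht _ _ _ _ (h.trans_le hab), mul_zero]

end Peeling

section TorusInImage

variable {k R : Type} [Field k] [Ring R] [Algebra k R] {n r : ℕ}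
  {q : k} {T : (RankIdx n r → ℤ) → R} {c : (RankIdx n r → ℤ) → (RankIdx n r → ℤ) → k}

theorem IsTwistedFamily.mem_of_mul_mem (hT : IsTwistedFamily T c) (P : Subalgebra k R)
    {γ δ : RankIdx n r → ℤ} (h : T γ * T δ ∈ P) : T (γ + δ) ∈ P := by
  rw [hT.mul] at h
  have := P.smul_mem h (c γ δ)⁻¹
  rwa [smul_smul, inv_mul_cancel₀ (hT.ne_zero γ δ), one_smul] at this

theorem IsTwistedFamily.mul_mem_of_mem (hT : IsTwistedFamily T c) (P : Subalgebra k R)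
    {γ δ : RankIdx n r → ℤ} (h : T (γ + δ) ∈ P) : T γ * T δ ∈ P := by
  rw [hT.mul]
  exact P.smul_mem h _

/-- The lattice vectors whose torus element lies in `P`. -/
def torusSubgroup (hT : IsTwistedFamily T c) (P : Subalgebra k R)
    (hneg : ∀ γ, T γ ∈ P → T (-γ) ∈ P) : AddSubgroup (RankIdx n r → ℤ) where
  carrier := {γ | T γ ∈ P}
  zero_mem' := by change T 0 ∈ P; rw [hT.zero]; exact P.one_mem
  add_mem' ha hb := hT.mem_of_mul_mem P (P.mul_mem ha hb)
  neg_mem' ha := hneg _ ha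

theorem torusGen_comm (h : IsTorusFamily q T) (i a j b : ℕ) :
    torusGen T false i a * torusGen T true j b = torusGen T true j b * torusGen T false i a := by
  unfold torusGen
  split_ifs with h1 h2 <;> try simp
  rw [sideVec_eq_single _ h1.2.1 h1.2.2, sideVec_eq_single _ h2.2.1 h2.2.2,
    h.comm_of_ne (by simp)]

theorem torusGen_comm_inv (h : IsTorusFamily q T) (i a j b : ℕ) :
    torusGen T false i a * torusInv T true j b = torusInv T true j b * torusGen T false i a := by
  unfold torusGen torusInv
  split_ifs with h1 h2 <;> try simp
  rw [sideVec_eq_single _ h1.2.1 h1.2.2, neg_sideVec_eq_single _ h2.2.1 h2.2.2,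
    h.comm_of_ne (by simp)]

theorem torusInv_comm (h : IsTorusFamily q T) (i a j b : ℕ) :
    torusInv T false i a * torusGen T true j b = torusGen T true j b * torusInv T false i a := by
  unfold torusGen torusInv
  split_ifs with h1 h2 <;> try simp
  rw [neg_sideVec_eq_single _ h1.2.1 h1.2.2, sideVec_eq_single _ h2.2.1 h2.2.2,
    h.comm_of_ne (by simp)]

theorem torusInv_comm_inv (h : IsTorusFamily q T) (i a j b : ℕ) :
    torusInv T false i a * torusInv T true j b = torusInv T true j b * torusInv T false i a := by
  unfold torusInv
  split_ifs with h1 h2 <;> try simp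
  rw [neg_sideVec_eq_single _ h1.2.1 h1.2.2, neg_sideVec_eq_single _ h2.2.1 h2.2.2,
    h.comm_of_ne (by simp)]

/-- The truncations of `rankMatrix`. -/
def rankTrunc (T : (RankIdx n r → ℤ) → R) (b i j : ℕ) : R :=
  triProd (torusGen T false) (torusInv T false) (torusGen T true) (torusInv T true) r b i j

theorem torusGen_eq (β : Bool) {i a : ℕ} (hai : a ≤ i) (hi : i < n) (ha : a < r) :
    torusGen T β i a = T (sideVec n r β i a) := if_pos ⟨hai, hi, ha⟩

theorem torusInv_eq (β : Bool) {i a : ℕ} (hai : a ≤ i) (hi : i < n) (ha : a < r) :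
    torusInv T β i a = T (-sideVec n r β i a) := if_pos ⟨hai, hi, ha⟩

theorem torusGen_of_lt (β : Bool) {i a : ℕ} (h : i < a) : torusGen T β i a = 0 :=
  if_neg fun h' => by omega

theorem torusInv_of_lt (β : Bool) {i a : ℕ} (h : i < a) : torusInv T β i a = 0 :=
  if_neg fun h' => by omega

theorem rankTrunc_succ (h : IsTorusFamily q T) {b : ℕ} (hb : b < r) (i j : ℕ) :
    rankTrunc T b i j = torusGen T false i b * torusGen T true j b +
      ∑ s ∈ Finset.range (i + 1), ∑ s' ∈ Finset.range (j + 1),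
        (torusGen T false i b * torusInv T false s b) *
          (torusGen T true j b * torusInv T true s' b) * rankTrunc T (b + 1) s s' :=
  triProd_succ (torusGen_comm h) (torusGen_comm_inv h) (torusInv_comm h) (torusInv_comm_inv h) hb i j

theorem rankTrunc_of_lt_left {b i j : ℕ} (h : i < b) : rankTrunc T b i j = 0 :=
  triProd_eq_zero_left (fun _ _ => torusGen_of_lt false) h

theorem rankTrunc_of_lt_right {b i j : ℕ} (h : j < b) : rankTrunc T b i j = 0 :=
  triProd_eq_zero_right (fun _ _ => torusGen_of_lt true) h

theorem torus_pair_mem_of_rankTrunc_mem (h : IsTorusFamily q T) (hT : IsTwistedFamily T c)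
    (P : Subalgebra k R) (hneg : ∀ γ, T γ ∈ P → T (-γ) ∈ P) {b : ℕ} (hb : b < r) (hrn : r ≤ n)
    (hZ : ∀ i < n, ∀ j < n, rankTrunc T b i j ∈ P) :
    ∀ i < n, ∀ j < n, b ≤ i → b ≤ j →
      sideVec n r false i b + sideVec n r true j b ∈ torusSubgroup hT P hneg := by
  have hbn : b < n := hb.trans_le hrn
  have hf : ∀ i < n, b ≤ i →
      sideVec n r false i b + sideVec n r true b b ∈ torusSubgroup hT P hneg := by
    intro i hi hbi
    have := hZ i hi b hbn
    rw [rankTrunc_succ h hb, Finset.sum_eq_zero fun s _ => Finset.sum_eq_zero fun s' hs' => by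
      rw [rankTrunc_of_lt_right (by simpa using hs'), mul_zero], add_zero,
      torusGen_eq _ hbi hi hb, torusGen_eq _ le_rfl hbn hb] at this
    exact hT.mem_of_mul_mem P this
  have ht : ∀ j < n, b ≤ j →
      sideVec n r false b b + sideVec n r true j b ∈ torusSubgroup hT P hneg := by
    intro j hj hbj
    have := hZ b hbn j hj
    rw [rankTrunc_succ h hb, Finset.sum_eq_zero fun s hs => Finset.sum_eq_zero fun s' _ => by
      rw [rankTrunc_of_lt_left (by simpa using hs), mul_zero], add_zero,
      torusGen_eq _ hbj hj hb, torusGen_eq _ le_rfl hbn hb] at this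
    exact hT.mem_of_mul_mem P this
  intro i hi j hj hbi hbj
  have := sub_mem (add_mem (hf i hi hbi) (ht j hj hbj)) (hf b hbn le_rfl)
  convert this using 1
  abel

theorem rankTrunc_succ_mem (h : IsTorusFamily q T) (hT : IsTwistedFamily T c)
    (hc : ∀ γ, c γ (-γ) = 1)
    (P : Subalgebra k R) (hneg : ∀ γ, T γ ∈ P → T (-γ) ∈ P) {b : ℕ} (hb : b < r) (hrn : r ≤ n)
    (hZ : ∀ i < n, ∀ j < n, rankTrunc T b i j ∈ P) :
    ∀ i < n, ∀ j < n, rankTrunc T (b + 1) i j ∈ P := by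
  have hpair := torus_pair_mem_of_rankTrunc_mem h hT P hneg hb hrn hZ
  have hcoef : ∀ i < n, ∀ j < n, b ≤ i → b ≤ j → ∀ s < n, ∀ s' < n,
      (torusGen T false i b * torusInv T false s b) *
        (torusGen T true j b * torusInv T true s' b) ∈ P := by
    intro i hi j hj hbi hbj s hs s' hs'
    rcases lt_or_ge s b with hsb | hsb
    · rw [torusInv_of_lt _ hsb, mul_zero, zero_mul]; exact P.zero_mem
    rcases lt_or_ge s' b with hsb' | hsb'
    · rw [torusInv_of_lt _ hsb', mul_zero, mul_zero]; exact P.zero_mem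
    rw [torusGen_eq _ hbi hi hb, torusGen_eq _ hbj hj hb, torusInv_eq _ hsb hs hb,
      torusInv_eq _ hsb' hs' hb, hT.mul, hT.mul, smul_mul_smul_comm]
    refine P.smul_mem (hT.mul_mem_of_mem P ?_) _
    have := sub_mem (hpair i hi j hj hbi hbj) (hpair s hs s' hs' hsb hsb')
    change _ ∈ torusSubgroup hT P hneg
    convert this using 1
    abel
  have hone : ∀ (β : Bool) (i : ℕ), i < n → b ≤ i → torusGen T β i b * torusInv T β i b = 1 := by
    intro β i hi hbi
    rw [torusGen_eq _ hbi hi hb, torusInv_eq _ hbi hi hb, hT.mul, hc, one_smul, add_neg_cancel,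
      hT.zero]
  suffices H : ∀ N, ∀ i < n, ∀ j < n, i + j = N → rankTrunc T (b + 1) i j ∈ P from
    fun i hi j hj => H _ i hi j hj rfl
  intro N
  induction N using Nat.strong_induction_on with
  | _ N ih =>
    intro i hi j hj hN
    rcases lt_or_ge i b with hib | hbi
    · rw [rankTrunc_of_lt_left (by omega)]; exact P.zero_mem
    rcases lt_or_ge j b with hjb | hbj
    · rw [rankTrunc_of_lt_right (by omega)]; exact P.zero_mem
    have hrec := rankTrunc_succ h hb i j
    rw [Finset.sum_range_succ, Finset.sum_range_succ (fun s' => (torusGen T false i b *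
      torusInv T false i b) * (torusGen T true j b * torusInv T true s' b) *
        rankTrunc T (b + 1) i s'), hone _ i hi hbi, hone _ j hj hbj, one_mul, one_mul] at hrec
    have h0 : torusGen T false i b * torusGen T true j b ∈ P := by
      rw [torusGen_eq _ hbi hi hb, torusGen_eq _ hbj hj hb]
      exact hT.mul_mem_of_mem P (hpair i hi j hj hbi hbj)
    have h1 : ∑ s ∈ Finset.range i, ∑ s' ∈ Finset.range (j + 1),
        (torusGen T false i b * torusInv T false s b) *
          (torusGen T true j b * torusInv T true s' b) * rankTrunc T (b + 1) s s' ∈ P := by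
      refine P.sum_mem fun s hs => P.sum_mem fun s' hs' => ?_
      rw [Finset.mem_range] at hs hs'
      exact P.mul_mem (hcoef i hi j hj hbi hbj s (by omega) s' (by omega))
        (ih (s + s') (by omega) s (by omega) s' (by omega) rfl)
    have h2 : ∑ s' ∈ Finset.range j,
        1 * (torusGen T true j b * torusInv T true s' b) * rankTrunc T (b + 1) i s' ∈ P := by
      refine P.sum_mem fun s' hs' => ?_
      rw [Finset.mem_range] at hs'
      rw [← hone false i hi hbi]
      exact P.mul_mem (hcoef i hi j hj hbi hbj i hi s' (by omega))
        (ih (i + s') (by omega) i hi s' (by omega) rfl)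
    simp only [one_mul] at hrec h2
    have h3 := P.sub_mem (P.sub_mem (P.sub_mem (hZ i hi j hj) h0) h1) h2
    rw [hrec] at h3
    convert h3 using 1
    abel

theorem torus_pair_mem (h : IsTorusFamily q T) (hT : IsTwistedFamily T c)
    (hc : ∀ γ, c γ (-γ) = 1) (P : Subalgebra k R) (hneg : ∀ γ, T γ ∈ P → T (-γ) ∈ P) (hrn : r ≤ n)
    (hZ : ∀ i < n, ∀ j < n, rankMatrix T i j ∈ P) {b : ℕ} (hb : b < r) {i j : ℕ} (hi : i < n)
    (hj : j < n) (hbi : b ≤ i) (hbj : b ≤ j) :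
    sideVec n r false i b + sideVec n r true j b ∈ torusSubgroup hT P hneg := by
  have key : ∀ b ≤ r, ∀ i < n, ∀ j < n, rankTrunc T b i j ∈ P := by
    intro b
    induction b with
    | zero => exact fun _ => hZ
    | succ b ih =>
      exact fun hb => rankTrunc_succ_mem h hT hc P hneg hb hrn (ih (by omega))
  exact torus_pair_mem_of_rankTrunc_mem h hT P hneg hb hrn (key b hb.le) i hi j hj hbi hbj

end TorusInImage

section LatticeGenerators

variable {n r m : ℕ}

theorem mem_of_mem_rankLattice (hrn : r ≤ n) (L : Submodule (ZMod m) (RankIdx n r → ZMod m))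
    (hL : ∀ (a : Fin r) (i j : Fin n), (a : ℕ) ≤ i → (a : ℕ) ≤ j →
      (Pi.single (false, i, a) 1 + Pi.single (true, j, a) 1 : RankIdx n r → ZMod m) ∈ L)
    {h : RankIdx n r → ZMod m} (hh : h ∈ rankLattice n r m) : h ∈ L := by
  have key : h = ∑ a : Fin r,
      (∑ i : Fin n, h (false, i, a) • (Pi.single (false, i, a) 1 +
          Pi.single (true, Fin.castLE hrn a, a) 1 : RankIdx n r → ZMod m) +
        ∑ j : Fin n, h (true, j, a) • (Pi.single (false, Fin.castLE hrn a, a) 1 +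
          Pi.single (true, j, a) 1 : RankIdx n r → ZMod m) -
        (∑ i : Fin n, h (true, i, a)) • (Pi.single (false, Fin.castLE hrn a, a) 1 +
          Pi.single (true, Fin.castLE hrn a, a) 1 : RankIdx n r → ZMod m)) := by
    ext ⟨β, i, a⟩
    have hs : ∀ a, ∑ i, h (false, i, a) = ∑ i, h (true, i, a) := hh.2
    cases β <;>
    simp [Finset.sum_apply, Pi.single_apply, Prod.ext_iff, ite_and, Finset.sum_add_distrib,
      hs]
  have hcoef : ∀ (β : Bool) (i : Fin n) (a : Fin r) (v : RankIdx n r → ZMod m),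
      ((a : ℕ) ≤ i → v ∈ L) → h (β, i, a) • v ∈ L := by
    intro β i a v hv
    rcases lt_or_ge (i : ℕ) a with hi | hi
    · rw [hh.1 β i a hi, zero_smul]; exact L.zero_mem
    · exact L.smul_mem _ (hv hi)
  rw [key]
  refine L.sum_mem fun a _ => L.sub_mem (L.add_mem (L.sum_mem fun i _ => ?_)
    (L.sum_mem fun j _ => ?_)) (L.smul_mem _ (hL a _ _ le_rfl le_rfl))
  · exact hcoef _ _ _ _ fun hi => hL a _ _ hi le_rfl
  · exact hcoef _ _ _ _ fun hj => hL a _ _ le_rfl hj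

end LatticeGenerators

section TorusRange

variable {n r m : ℕ} {k : Type} [Field k] {q : k}

theorem redMod_surjective {S : Type} : Function.Surjective (redMod m : (S → ℤ) → S → ZMod m) :=
  fun h => ⟨fun s => (h s).cast, funext fun s => ZMod.intCast_zmod_cast (h s)⟩

variable [NeZero m] (hq : q ^ m = 1)

theorem rankOp_congr {K : Type} [CommRing K] [Algebra k K] {y : (RankIdx n r → ℤ) → K}
    {γ δ : RankIdx n r → ℤ} (h : redMod m γ = redMod m δ) (hy : y γ = y δ) :
    rankOp n r hq y γ = rankOp n r hq y δ := by
  refine LinearMap.ext fun f => funext fun g => ?_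
  rw [rankOp, rankOp, weylOp_apply, weylOp_apply, h, hy]

theorem IsTwistedFamily.nsmul_mem {R : Type} [Ring R] [Algebra k R]
    {T : (RankIdx n r → ℤ) → R} {c : (RankIdx n r → ℤ) → (RankIdx n r → ℤ) → k}
    (hT : IsTwistedFamily T c) (P : Subalgebra k R) {γ : RankIdx n r → ℤ} (h : T γ ∈ P) (t : ℕ) :
    T (t • γ) ∈ P := by
  induction t with
  | zero => rw [zero_smul, hT.zero]; exact P.one_mem
  | succ t ih => rw [succ_nsmul]; exact hT.mem_of_mul_mem P (P.mul_mem ih h)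

/-- The torus elements of the lattice are in the image of the algebra. -/
theorem exists_rankRep_eq_rankOp (hodd : Odd m) (hrn : r ≤ n)
    {y : (RankIdx n r → ℤ) → k} (hy0 : y 0 = 1) (hy : ∀ γ δ, y (γ + δ) = y γ * y δ)
    (hy1 : ∀ γ, y γ = 1) {γ : RankIdx n r → ℤ} (hγ : redMod m γ ∈ rankLattice n r m) :
    ∃ a, rankRep hq hodd hy0 hy a = rankOp n r hq y γ := by
  set P : Subalgebra k (Module.End k ((RankIdx n r → ZMod m) → k)) :=
    (rankRep (q := q) hq hodd hy0 hy).range with hP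
  have hT := isTwistedFamily_rankOp (q := q) hq hy0 hy
  have hneg : ∀ δ, rankOp n r hq y δ ∈ P →
      rankOp n r hq y (-δ) ∈ P := by
    intro δ hδ
    have hm : 0 < m := Nat.pos_of_ne_zero (NeZero.ne m)
    rw [rankOp_congr hq (γ := -δ) (δ := (m - 1) • δ) _ ((hy1 _).trans (hy1 _).symm)]
    · exact hT.nsmul_mem P hδ (m - 1)
    · rw [map_neg, map_nsmul, neg_eq_iff_add_eq_zero, ← succ_nsmul',
        Nat.sub_add_cancel hm]
      ext s
      simp
  have hZ : ∀ i < n, ∀ j < n, rankMatrix (rankOp n r hq y) i j ∈ P := by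
    intro i hi j hj
    refine ⟨rankProj k q n r (Zgen k q n n ⟨i, hi⟩ ⟨j, hj⟩), ?_⟩
    have h1 := rankRep_rankProj hq hodd hy0 hy (Zgen k q n n ⟨i, hi⟩ ⟨j, hj⟩)
    have h2 := (isQuantumMatrix_rankOp hq hodd hy0 hy).lift_Zgen (n := n) (r := n) ⟨i, hi⟩ ⟨j, hj⟩
    exact h1.trans h2
  have key := mem_of_mem_rankLattice hrn
    (AddSubgroup.toZModSubmodule m ((torusSubgroup hT P hneg).map (redMod m)))
    (fun a i j hi hj => ⟨_, torus_pair_mem (isTorusFamily_rankOp hq hodd hy0 hy) hT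
      (rankOp_cocycle_neg hq hodd) P hneg hrn hZ a.2 i.2 j.2 hi hj, by
        rw [sideVec_eq_single _ i.2 a.2, sideVec_eq_single _ j.2 a.2]
        ext s
        simp [redMod, Pi.single_apply]⟩) hγ
  obtain ⟨δ, hδ, h⟩ := key
  rw [← rankOp_congr hq h ((hy1 _).trans (hy1 _).symm)]
  exact hδ

end TorusRange

/-! ### Irreducibility of the covariant functions -/

section Irreducible

variable {H : Type} [AddCommGroup H] [Finite H] {m : ℕ} [Module (ZMod m) H] {k : Type} [Field k]
  [CharZero k] {χ : AddChar (ZMod m) k} {B ω : LinearMap.BilinForm (ZMod m) H} {G C : AddSubgroup H}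

/-- The part of a covariant function supported on a coset of `C` is obtained by averaging. -/
theorem indicator_coset_mem (hχ : ∀ z, χ z = 1 → z = 0) (hBω : ∀ x y, B x y + B x y = ω x y)
    (hB : ∀ x y, B y x = -B x y) (hC : IsLagrangian ω G C) {N : Submodule k (H → k)}
    (hN : ∀ g ∈ G, ∀ v ∈ N, (fun h => χ (B g h) * v (h - g)) ∈ N)
    {v : H → k} (hv : v ∈ N) (hvV : v ∈ covariantFun k χ B G C 0) {h₀ : H} (hh₀ : h₀ ∈ G) :
    {h | h - h₀ ∈ C}.indicator v ∈ N := by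
  classical
  have := Fintype.ofFinite C
  have hcard : (Fintype.card C : k) ≠ 0 := by exact_mod_cast Fintype.card_ne_zero
  have hswap : ∀ x y, ω y x = -ω x y := fun x y => by
    rw [← hBω, ← hBω, hB x y, neg_add]
  have hact : ∀ c ∈ C, ∀ h, χ (B c h) * v (h - c) = χ (ω c h) * v h := by
    intro c hc h
    rw [sub_eq_add_neg, hvV.2 h _ (C.neg_mem hc), map_neg, ← hB h c, Algebra.algebraMap_self_apply,
      ← mul_assoc, ← AddChar.map_add_eq_mul, hBω]
  have hsum : (Fintype.card C : k) • {h | h - h₀ ∈ C}.indicator v =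
      ∑ c : C, χ (-ω c h₀) • fun h => χ (B c h) * v (h - c) := by
    ext h
    rw [Finset.sum_apply, Pi.smul_apply, smul_eq_mul]
    simp only [Pi.smul_apply, smul_eq_mul]
    rw [Finset.sum_congr rfl fun c _ => by rw [hact c c.2, ← mul_assoc, ← AddChar.map_add_eq_mul,
      show -ω c h₀ + ω c h = ω (-(h - h₀)) c by
        rw [map_neg, LinearMap.neg_apply, ← hswap (h - h₀) c, map_sub, sub_eq_neg_add]], ← Finset.sum_mul,
      sum_addChar_bilin hχ ω C]
    by_cases hG : h ∈ G
    · have hiff : (∀ g ∈ C, ω (-(h - h₀)) g = 0) ↔ h - h₀ ∈ C := by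
        refine ⟨fun H => hC.mem _ (G.sub_mem hG hh₀) fun c hc => ?_, fun H g hg =>
          hC.isotropic _ (C.neg_mem H) g hg⟩
        have := H c hc
        rwa [map_neg, LinearMap.neg_apply, ← hswap] at this
      by_cases hh : h - h₀ ∈ C
      · rw [if_pos (hiff.mpr hh), Set.indicator_of_mem (show h ∈ {h | h - h₀ ∈ C} from hh)]
      · rw [if_neg (mt hiff.mp hh), Set.indicator_of_notMem (show h ∉ {h | h - h₀ ∈ C} from hh),
          mul_zero, zero_mul]
    · have h0 : v h = 0 := hvV.1 h fun h' => hG ((QuotientAddGroup.eq_zero_iff h).mp h')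
      rw [h0, mul_zero, Set.indicator_apply, h0, ite_self, mul_zero]
  rw [← inv_smul_smul₀ hcard ({h | h - h₀ ∈ C}.indicator v), hsum]
  exact N.smul_mem _ (N.sum_mem fun c _ => N.smul_mem _ (hN c (hC.le c.2) v hv))

/-- A nonzero stable space of covariant functions contains all of them. -/
theorem covariantFun_le_of_stable (hχ : ∀ z, χ z = 1 → z = 0)
    (hBω : ∀ x y, B x y + B x y = ω x y)
    (hB : ∀ x y, B y x = -B x y) (hC : IsLagrangian ω G C) {N : Submodule k (H → k)}
    (hN : ∀ g ∈ G, ∀ v ∈ N, (fun h => χ (B g h) * v (h - g)) ∈ N)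
    (hNV : N ≤ covariantFun k χ B G C 0)
    {v : H → k} (hv : v ∈ N) (hv0 : v ≠ 0) : covariantFun k χ B G C 0 ≤ N := by
  classical
  obtain ⟨h₀, hvh₀⟩ := Function.ne_iff.mp hv0
  rw [Pi.zero_apply] at hvh₀
  have hh₀ : h₀ ∈ G := by
    by_contra h
    exact hvh₀ ((hNV hv).1 h₀ fun h' => h ((QuotientAddGroup.eq_zero_iff h₀).mp h'))
  have hχ0 : ∀ z, χ z ≠ 0 := fun z hz => by
    have := χ.map_add_eq_mul z (-z)
    rw [add_neg_cancel, AddChar.map_zero_eq_one, hz, zero_mul] at this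
    exact one_ne_zero this
  set p := {h | h - h₀ ∈ C}.indicator v with hp
  have hpN : p ∈ N := indicator_coset_mem hχ hBω hB hC hN hv (hNV hv) hh₀
  have hpmem : ∀ g : G, (fun h => χ (B (g - h₀) h) * p (h - (g - h₀))) ∈ N := fun g =>
    hN _ (G.sub_mem g.2 hh₀) p hpN
  have := Fintype.ofFinite (G ⧸ C.addSubgroupOf G)
  intro w hw
  let u : H → k := ∑ x : G ⧸ C.addSubgroupOf G,
    (w (x.out : G) * (χ (B ((x.out : G) - h₀) (x.out : G)) * v h₀)⁻¹) •
      fun h => χ (B ((x.out : G) - h₀) h) * p (h - ((x.out : G) - h₀))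
  have huN : u ∈ N := N.sum_mem fun x _ => N.smul_mem _ (hpmem _)
  suffices h : (⟨w, hw⟩ : covariantFun k χ B G C 0) = ⟨u, hNV huN⟩ by
    rw [show w = u from congrArg Subtype.val h]; exact huN
  refine covariantEval_injective (funext fun x => ?_)
  change w (x.out : G) = u (x.out : G)
  simp only [u, Finset.sum_apply, Pi.smul_apply, smul_eq_mul]
  rw [Finset.sum_eq_single x]
  · have h1 : p ((x.out : G) - ((x.out : G) - h₀)) = v h₀ := by
      rw [sub_sub_cancel, hp, Set.indicator_of_mem]
      rw [Set.mem_ofPred_eq, sub_self]; exact C.zero_mem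
    rw [h1, mul_assoc, inv_mul_cancel₀ (mul_ne_zero (hχ0 _) hvh₀), mul_one]
  · intro z _ hz
    have h1 : p ((x.out : G) - ((z.out : G) - h₀)) = 0 := by
      rw [hp, Set.indicator_of_notMem]
      intro hmem
      apply hz
      rw [← Quotient.out_eq z, ← Quotient.out_eq x]
      refine QuotientAddGroup.eq.mpr ?_
      have h2 : ((x.out : G) : H) - ((z.out : G) - h₀) - h₀ = -((z.out : G) : H) + (x.out : G) := by
        abel
      rw [Set.mem_ofPred_eq, h2] at hmem
      exact hmem
    rw [h1, mul_zero, mul_zero]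
  · exact fun h => absurd (Finset.mem_univ x) h

end Irreducible

section LowerBound

variable {n r m : ℕ} {k : Type} [Field k] [CharZero k] [NeZero m] {q : k} (hq : q ^ m = 1)

theorem exists_isSimpleModule_finrank (hodd : Odd m) (hr : 0 < r) (hrn : r ≤ n)
    (hχ : ∀ z, rootChar hq z = 1 → z = 0) :
    ∃ (V : Type) (_ : AddCommGroup V) (_ : Module k V) (_ : Module (QMatRank k q n r) V)
      (_ : IsScalarTower k (QMatRank k q n r) V), IsSimpleModule (QMatRank k q n r) V ∧
        Module.Finite k V ∧ m ^ (n * r - r * (r + 1) / 2) = Module.finrank k V := by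
  classical
  obtain ⟨C, hC⟩ := exists_isLagrangian (gramForm_swap (m := m) (rankOmega_swap n r))
    (gramForm_self_rank hodd) (rankLattice n r m)
  have hB : ∀ x ∈ C, ∀ y ∈ C, halfForm (rankOmega n r) m x y = 0 := fun x hx y hy =>
    halfForm_eq_zero (hC.isotropic x hx y hy)
  let y : (RankIdx n r → ℤ) → k := fun _ => 1
  have hy0 : y 0 = 1 := rfl
  have hy : ∀ γ δ, y (γ + δ) = y γ * y δ := fun _ _ => (one_mul 1).symm
  let V := covariantFun k (rootChar hq) (halfForm (rankOmega n r) m) (rankLattice n r m) C 0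
  have := Fintype.ofFinite (rankLattice n r m ⧸ C.addSubgroupOf (rankLattice n r m))
  let b : Module.Basis _ k V := covariantBasis hC.le hB
  let ρ : QMatRank k q n r →+* Module.End k V := covariantRep hq hodd hy0 hy hrn C
  let _ : Module (QMatRank k q n r) V := Module.compHom V ρ
  have hsmul : ∀ (a : QMatRank k q n r) (v : V),
      ((a • v : V) : (RankIdx n r → ZMod m) → k) = rankRep hq hodd hy0 hy a v := fun _ _ => rfl
  have htower : IsScalarTower k (QMatRank k q n r) V := ⟨fun c a v => by
    refine Subtype.ext ?_
    rw [hsmul, map_smul, LinearMap.smul_apply]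
    rfl⟩
  have hfin : Module.finrank k V = m ^ (n * r - r * (r + 1) / 2) := by
    rw [Module.finrank_eq_nat_card_basis b, hC.card_quotient hodd hr hrn hχ]
  have hfinite : Module.Finite k V := Module.Finite.of_basis b
  refine ⟨V, inferInstance, inferInstance, inferInstance, htower, ?_, hfinite, hfin.symm⟩
  have hnt : Nontrivial V := by
    apply Module.nontrivial_of_finrank_pos (R := k)
    rw [hfin]
    exact pow_pos (Nat.pos_of_ne_zero (NeZero.ne m)) _
  rw [isSimpleModule_iff]
  refine ⟨fun M => or_iff_not_imp_left.mpr fun hM => ?_⟩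
  obtain ⟨v, hv, hv0⟩ := (Submodule.ne_bot_iff M).mp hM
  let N : Submodule k ((RankIdx n r → ZMod m) → k) := (M.restrictScalars k).map V.subtype
  have hNV : N ≤ V := by
    rintro _ ⟨w, _, rfl⟩
    exact w.2
  have hN : ∀ g ∈ rankLattice n r m, ∀ w ∈ N,
      (fun h => rootChar hq (halfForm (rankOmega n r) m g h) * w (h - g)) ∈ N := by
    rintro g hg _ ⟨w, hw, rfl⟩
    obtain ⟨γ, rfl⟩ := redMod_surjective g
    obtain ⟨a, ha⟩ := exists_rankRep_eq_rankOp hq hodd hrn hy0 hy (fun _ => rfl) hg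
    refine ⟨a • w, M.smul_mem a hw, ?_⟩
    change rankRep hq hodd hy0 hy a w = _
    rw [ha]
    funext h
    rw [rankOp, weylOp_apply, mul_one]
    rfl
  have key := covariantFun_le_of_stable hχ (halfForm_add_self hodd (rankOmega n r))
    (halfForm_swap (rankOmega_swap n r)) hC hN hNV ⟨v, hv, rfl⟩
    (fun h => hv0 (Subtype.ext h))
  refine eq_top_iff.mpr fun w _ => ?_
  obtain ⟨w', hw', h⟩ := key w.2
  have e : w' = w := Subtype.ext h
  exact e ▸ hw'

end LowerBound

theorem eq_zero_of_rootChar_eq_one {k : Type} [Field k] {q : k} {m : ℕ} [NeZero m]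
    (hq : IsPrimitiveRoot q m) (z : ZMod m) (hz : rootChar hq.pow_eq_one z = 1) : z = 0 := by
  rw [← ZMod.natCast_zmod_val z, ← Int.cast_natCast, rootChar_intCast, zpow_natCast,
    hq.pow_eq_one_iff_dvd] at hz
  rw [← ZMod.natCast_zmod_val z, ZMod.natCast_eq_zero_iff]
  exact hz

/-- For `k` algebraically closed of characteristic zero, `m` odd,
`q` a primitive `m`-th root of unity and `1 ≤ r ≤ n - 1`,
`deg M^{r+1}_q(n) = m^(nr - r(r+1)/2)`; equivalently the supremum of the dimensions of
the finite-dimensional irreducible `M^{r+1}_q(n)`-modules is `m^(nr - r(r+1)/2)`. -/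
theorem deg_QMatRank
    (k : Type) [Field k] [IsAlgClosed k] [CharZero k] (q : k) (m : ℕ)
    (hm : 0 < m) (hodd : Odd m) (hq : IsPrimitiveRoot q m)
    (n r : ℕ) (hr : 1 ≤ r) (hrn : r + 1 ≤ n) :
    HasDeg (QMatRank k q n r) (m ^ (n * r - r * (r + 1) / 2)) ∧
      sSup {c : ℕ | ∃ (V : Type) (_ : AddCommGroup V) (_ : Module k V)
          (_ : Module (QMatRank k q n r) V) (_ : IsScalarTower k (QMatRank k q n r) V),
          IsSimpleModule (QMatRank k q n r) V ∧ Module.Finite k V ∧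
            c = Module.finrank k V} =
        m ^ (n * r - r * (r + 1) / 2) := by
  have : NeZero m := ⟨hm.ne'⟩
  have hχ := eq_zero_of_rootChar_eq_one hq
  obtain ⟨C, hC⟩ := exists_isLagrangian (gramForm_swap (m := m) (rankOmega_swap n r))
    (gramForm_self_rank hodd) (rankLattice n r m)
  have hle := degLE_QMatRank hq.pow_eq_one hodd hr (by omega) hχ hC
  have hex := exists_isSimpleModule_finrank hq.pow_eq_one hodd hr (show r ≤ n by omega) hχ
  refine ⟨⟨hle, fun e he => ?_⟩, IsGreatest.csSup_eq ⟨hex, ?_⟩⟩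
  · obtain ⟨V, _, _, _, _, _, _, hV⟩ := hex
    rw [hV]
    exact finrank_le_of_isSimpleModule k he
  · rintro _ ⟨V, _, _, _, _, _, _, rfl⟩
    exact finrank_le_of_isSimpleModule k hle
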